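/- The conjugator length function of Thompson's group F has quadratic growth: there exist constants 0 < a < b and a natural number N such that for all n ≥ N, a·n² ≤ CLF(n) ≤ b·n². -/

import Mathlib

noncomputable section

open Set

noncomputable section

open Set

def x0fun : ℝ → ℝ := fun t =>
  if t < 0 then t
  else if t ≤ 1/2 then t / 2
  else if t ≤ 3/4 then t - 1/4
  else if t ≤ 1 then 2 * t - 1
  else t

def x0inv : ℝ → ℝ := fun t =>
  if t < 0 then t
  else if t ≤ 1/4 then 2 * t
  else if t ≤ 1/2 then t + 1/4
  else if t ≤ 1 then (t + 1) / 2
  else t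

/-- The generator `x₀` of Thompson's group `F`, as a permutation of `ℝ`
(the identity outside `[0,1]`). -/
def x0 : Equiv.Perm ℝ where
  toFun := x0fun
  invFun := x0inv
  left_inv := by
    intro t
    show x0inv (x0fun t) = t
    unfold x0fun
    split_ifs <;> (unfold x0inv; split_ifs <;> linarith)
  right_inv := by
    intro t
    show x0fun (x0inv t) = t
    unfold x0inv
    split_ifs <;> (unfold x0fun; split_ifs <;> linarith)

def x1fun : ℝ → ℝ := fun t =>
  if t < 0 then t
  else if t ≤ 1/2 then t
  else if t ≤ 3/4 then t / 2 + 1/4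
  else if t ≤ 7/8 then t - 1/8
  else if t ≤ 1 then 2 * t - 1
  else t

def x1inv : ℝ → ℝ := fun t =>
  if t < 0 then t
  else if t ≤ 1/2 then t
  else if t ≤ 5/8 then 2 * t - 1/2
  else if t ≤ 3/4 then t + 1/8
  else if t ≤ 1 then (t + 1) / 2
  else t

set_option maxHeartbeats 2000000 in
/-- The generator `x₁` of Thompson's group `F`, as a permutation of `ℝ`
(the identity outside `[0,1]`). -/
def x1 : Equiv.Perm ℝ where
  toFun := x1fun
  invFun := x1inv
  left_inv := by
    intro t
    show x1inv (x1fun t) = t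
    unfold x1fun
    split_ifs <;> (unfold x1inv; split_ifs <;> linarith)
  right_inv := by
    intro t
    show x1fun (x1inv t) = t
    unfold x1inv
    split_ifs <;> (unfold x1fun; split_ifs <;> linarith)

/-- Thompson's group `F`: the subgroup generated by `x₀` and `x₁`. -/
def ThompsonF : Subgroup (Equiv.Perm ℝ) :=
  Subgroup.closure ({x0, x1} : Set (Equiv.Perm ℝ))

/-- Word length with respect to the generating set `{x₀, x₁}`. -/
def wordLength (f : Equiv.Perm ℝ) : ℕ :=
  sInf {n | ∃ w : List (Equiv.Perm ℝ), w.length = n ∧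
    (∀ g ∈ w, g ∈ ({x0, x1, x0⁻¹, x1⁻¹} : Set (Equiv.Perm ℝ))) ∧ w.prod = f}
/-- Conjugator distance in Thompson's group `F` (the minimum word length of a conjugator). -/
def conjDist (f g : Equiv.Perm ℝ) : ℕ :=
  sInf {n | ∃ h ∈ ThompsonF, h⁻¹ * f * h = g ∧ wordLength h = n}

/-- The conjugator length function of Thompson's group `F`. -/
def CLF (n : ℕ) : ℕ :=
  sSup {m | ∃ f g : Equiv.Perm ℝ, f ∈ ThompsonF ∧ g ∈ ThompsonF ∧
    (∃ h ∈ ThompsonF, h⁻¹ * f * h = g) ∧ wordLength f + wordLength g ≤ n ∧ conjDist f g = m}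


namespace DyadicF

/-- The increasing affine bijection of `[0,1]` onto the standard dyadic interval addressed by a
binary word. -/
def aff : List Bool → ℝ → ℝ
  | [], t => t
  | b :: u, t => (cond b 1 0 + aff u t) / 2

@[simp] lemma aff_nil (t : ℝ) : aff [] t = t := rfl

lemma aff_cons (b : Bool) (u : List Bool) (t : ℝ) :
    aff (b :: u) t = (cond b 1 0 + aff u t) / 2 := rfl

lemma aff_append (u v : List Bool) (t : ℝ) : aff (u ++ v) t = aff u (aff v t) := by
  induction u with
  | nil => rfl
  | cons b u ih => simp [aff_cons, ih]

lemma aff_eq (u : List Bool) (t : ℝ) : aff u t = aff u 0 + t * (1 / 2) ^ u.length := by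
  induction u with
  | nil => simp
  | cons b u ih => rw [aff_cons, ih, aff_cons, List.length_cons]; ring

lemma aff_one (u : List Bool) : aff u 1 = aff u 0 + (1 / 2) ^ u.length := by
  rw [aff_eq u 1]; ring

lemma aff_strictMono (u : List Bool) : StrictMono (aff u) := by
  intro s t h
  rw [aff_eq u s, aff_eq u t]
  have : (0 : ℝ) < (1 / 2) ^ u.length := by positivity
  nlinarith

lemma aff_mem_Icc (u : List Bool) {t : ℝ} (ht : t ∈ Icc (0 : ℝ) 1) : aff u t ∈ Icc (0 : ℝ) 1 := by
  induction u with
  | nil => simpa using ht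
  | cons b u ih =>
    obtain ⟨h0, h1⟩ := ih
    cases b <;> simp only [aff_cons, cond_true, cond_false, mem_Icc] <;> constructor <;> linarith

/-- The open standard dyadic interval addressed by a binary word. -/
def cell (u : List Bool) : Set ℝ := Ioo (aff u 0) (aff u 1)

lemma mem_cell_iff {u : List Bool} {t : ℝ} : t ∈ cell u ↔ ∃ y ∈ Ioo (0 : ℝ) 1, t = aff u y := by
  have hp : (0 : ℝ) < (1 / 2) ^ u.length := by positivity
  constructor
  · rintro ⟨h0, h1⟩
    rw [aff_one] at h1
    refine ⟨(t - aff u 0) / (1 / 2) ^ u.length, ⟨?_, ?_⟩, ?_⟩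
    · exact div_pos (by linarith) hp
    · rw [div_lt_one hp]; linarith
    · rw [aff_eq u, div_mul_cancel₀ _ hp.ne']; ring
  · rintro ⟨y, ⟨h0, h1⟩, rfl⟩
    exact ⟨aff_strictMono u h0, aff_strictMono u h1⟩

lemma aff_mem_cell (u : List Bool) {y : ℝ} (hy : y ∈ Ioo (0 : ℝ) 1) : aff u y ∈ cell u :=
  mem_cell_iff.2 ⟨y, hy, rfl⟩

lemma cell_subset (u : List Bool) : cell u ⊆ Ioo (0 : ℝ) 1 := by
  rintro t ⟨h0, h1⟩
  exact ⟨(aff_mem_Icc u (by simp)).1.trans_lt h0, h1.trans_le (aff_mem_Icc u (by simp)).2⟩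

lemma mem_cell_cons {b : Bool} {u : List Bool} {t : ℝ} :
    t ∈ cell (b :: u) ↔ 2 * t - cond b 1 0 ∈ cell u := by
  simp only [cell, mem_Ioo, aff_cons]
  constructor <;> rintro ⟨h, h'⟩ <;> constructor <;> linarith

lemma cell_append (u v : List Bool) : cell (u ++ v) ⊆ cell u := by
  intro t ht
  obtain ⟨y, hy, rfl⟩ := mem_cell_iff.1 ht
  rw [aff_append]
  exact aff_mem_cell u (cell_subset v (aff_mem_cell v hy))

lemma cell_mono {u v : List Bool} (h : u <+: v) : cell v ⊆ cell u := by
  obtain ⟨y, rfl⟩ := h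
  exact cell_append u y

lemma prefix_or_prefix_of_mem_cell {u v : List Bool} {t : ℝ} (hu : t ∈ cell u) (hv : t ∈ cell v) :
    u <+: v ∨ v <+: u := by
  induction u generalizing v t with
  | nil => simp
  | cons b u ih =>
    cases v with
    | nil => simp
    | cons c v =>
      rw [mem_cell_cons] at hu hv
      have h1 := cell_subset _ hu
      have h2 := cell_subset _ hv
      simp only [mem_Ioo] at h1 h2
      have : b = c := by
        cases b <;> cases c <;> simp at h1 h2 ⊢ <;> linarith
      subst this
      rcases ih hu hv with h | h
      · left; simpa using h
      · right; simpa using h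

lemma eq_of_mem_cell_of_length {u v : List Bool} {t : ℝ} (hu : t ∈ cell u) (hv : t ∈ cell v)
    (h : u.length = v.length) : u = v := by
  rcases prefix_or_prefix_of_mem_cell hu hv with h' | h'
  · exact h'.eq_of_length h
  · exact (h'.eq_of_length h.symm).symm

lemma aff_injective {u v : List Bool} (h : ∀ t ∈ Icc (0 : ℝ) 1, aff u t = aff v t) : u = v := by
  have h0 := h 0 (by simp)
  have h1 := h 1 (by simp)
  have h2 := h (1 / 2) (by norm_num)
  apply eq_of_mem_cell_of_length (t := aff u (1 / 2)) (aff_mem_cell u (by norm_num))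
  · rw [h2]; exact aff_mem_cell v (by norm_num)
  · rw [aff_one, aff_one, h0] at h1
    have h3 : ((1 : ℝ) / 2) ^ u.length = (1 / 2) ^ v.length := by linarith
    exact pow_right_injective₀ (by norm_num) (by norm_num) h3

/-- `Carries p u v`: the map `p` is affine from the dyadic interval of `u` onto that of `v`. -/
def Carries (p : Equiv.Perm ℝ) (u v : List Bool) : Prop :=
  ∀ t ∈ Icc (0 : ℝ) 1, p (aff u t) = aff v t

namespace Carries
variable {p q : Equiv.Perm ℝ} {u v w : List Bool}

lemma one (u : List Bool) : Carries 1 u u := fun _ _ => rfl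

lemma append (h : Carries p u v) (y : List Bool) : Carries p (u ++ y) (v ++ y) := by
  intro t ht
  rw [aff_append, aff_append]
  exact h _ (aff_mem_Icc y ht)

lemma mul (hp : Carries p v w) (hq : Carries q u v) : Carries (p * q) u w := by
  intro t ht
  rw [Equiv.Perm.mul_apply, hq t ht, hp t ht]

lemma inv (h : Carries p u v) : Carries p⁻¹ v u := by
  intro t ht
  rw [← h t ht]; simp

lemma inv_iff : Carries p⁻¹ v u ↔ Carries p u v := ⟨fun h => by simpa using h.inv, fun h => h.inv⟩

lemma right_unique (h : Carries p u v) (h' : Carries p u w) : v = w :=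
  aff_injective fun t ht => by rw [← h t ht, ← h' t ht]

lemma left_unique (h : Carries p u w) (h' : Carries p v w) : u = v :=
  right_unique h.inv h'.inv

lemma mem_cell_iff (h : Carries p u v) {t : ℝ} : p t ∈ cell v ↔ t ∈ cell u := by
  have key : ∀ {p : Equiv.Perm ℝ} {u v : List Bool} (_ : Carries p u v) {t : ℝ},
      t ∈ cell u → p t ∈ cell v := by
    intro p u v h t ht
    obtain ⟨y, hy, rfl⟩ := DyadicF.mem_cell_iff.1 ht
    rw [h y ⟨hy.1.le, hy.2.le⟩]
    exact aff_mem_cell v hy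
  refine ⟨fun ht => ?_, key h⟩
  simpa using key h.inv ht

lemma eq_append (h : Carries p u v) {y : List Bool} (h' : Carries p (u ++ y) w) : w = v ++ y :=
  right_unique h' (h.append y)

end Carries

/-- The words on whose dyadic interval `p` is not a standard affine map. -/
def bad (p : Equiv.Perm ℝ) : Set (List Bool) := {u | ∀ v, ¬ Carries p u v}

lemma not_mem_bad {p : Equiv.Perm ℝ} {u : List Bool} : u ∉ bad p ↔ ∃ v, Carries p u v := by
  simp [bad]

lemma bad_of_initial {p : Equiv.Perm ℝ} {u v : List Bool} (h : u <+: v) (hv : v ∈ bad p) :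
    u ∈ bad p := by
  obtain ⟨y, rfl⟩ := h
  intro w hw
  exact hv _ (hw.append y)

lemma bad_mul_subset (p q : Equiv.Perm ℝ) :
    bad (p * q) ⊆ bad q ∪ {u | ∃ v ∈ bad p, Carries q u v} := by
  intro u hu
  by_cases h : u ∈ bad q
  · exact Or.inl h
  · obtain ⟨v, hv⟩ := not_mem_bad.1 h
    exact Or.inr ⟨v, fun w hw => hu w (hw.mul hv), hv⟩

lemma ncard_carries_le (q : Equiv.Perm ℝ) {S : Set (List Bool)} (hS : S.Finite) :
    {u | ∃ v ∈ S, Carries q u v}.Finite ∧ {u | ∃ v ∈ S, Carries q u v}.ncard ≤ S.ncard := by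
  classical
  have h : ∀ u ∈ {u | ∃ v ∈ S, Carries q u v}, ∃ v ∈ S, Carries q u v := fun u hu => hu
  choose! φ hφ using h
  have hinj : InjOn φ {u | ∃ v ∈ S, Carries q u v} := by
    intro a ha b hb hab
    have h1 := (hφ a ha).2
    rw [hab] at h1
    exact h1.left_unique (hφ b hb).2
  have hmaps : MapsTo φ {u | ∃ v ∈ S, Carries q u v} S := fun u hu => (hφ u hu).1
  exact ⟨Finite.of_injOn hmaps hinj hS, ncard_le_ncard_of_injOn φ hmaps hinj hS⟩

lemma bad_mul (p q : Equiv.Perm ℝ) (hp : (bad p).Finite) (hq : (bad q).Finite) :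
    (bad (p * q)).Finite ∧ (bad (p * q)).ncard ≤ (bad p).ncard + (bad q).ncard := by
  obtain ⟨h1, h2⟩ := ncard_carries_le q hp
  refine ⟨(hq.union h1).subset (bad_mul_subset p q), ?_⟩
  have h3 := ncard_le_ncard (bad_mul_subset p q) (hq.union h1)
  have h4 := ncard_union_le (bad q) {u | ∃ v ∈ bad p, Carries q u v}
  omega

lemma length_lt_ncard_bad {p : Equiv.Perm ℝ} (hp : (bad p).Finite) {u : List Bool}
    (hu : u ∈ bad p) : u.length < (bad p).ncard := by
  have h1 : MapsTo (fun k : ℕ => u.take k) (Finset.range (u.length + 1) : Set ℕ) (bad p) :=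
    fun k _ => bad_of_initial ⟨u.drop k, List.take_append_drop k u⟩ hu
  have h2 : InjOn (fun k : ℕ => u.take k) (Finset.range (u.length + 1) : Set ℕ) := by
    intro a ha b hb hab
    simp only [Finset.coe_range, mem_Iio] at ha hb
    have := congrArg List.length hab
    simp only [List.length_take] at this
    omega
  have := ncard_le_ncard_of_injOn _ h1 h2 hp
  rw [ncard_coe_finset, Finset.card_range] at this
  omega

lemma exists_carries_of_length {p : Equiv.Perm ℝ} (hp : (bad p).Finite) {u : List Bool}
    (hu : (bad p).ncard ≤ u.length) : ∃ v, Carries p u v :=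
  not_mem_bad.1 fun h => absurd (length_lt_ncard_bad hp h) (by omega)

lemma carries_x0_left : Carries x0 [false] [false, false] := by
  rintro t ⟨h0, h1⟩
  simp only [aff_cons, aff_nil, cond_false]
  show x0fun _ = _
  unfold x0fun; split_ifs <;> linarith

lemma carries_x0_mid : Carries x0 [true, false] [false, true] := by
  rintro t ⟨h0, h1⟩
  simp only [aff_cons, aff_nil, cond_false, cond_true]
  show x0fun _ = _
  unfold x0fun; split_ifs <;> linarith

lemma carries_x0_right : Carries x0 [true, true] [true] := by
  rintro t ⟨h0, h1⟩
  simp only [aff_cons, aff_nil, cond_true]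
  show x0fun _ = _
  unfold x0fun; split_ifs <;> linarith

lemma carries_x1_left : Carries x1 [false] [false] := by
  rintro t ⟨h0, h1⟩
  simp only [aff_cons, aff_nil, cond_false]
  show x1fun _ = _
  unfold x1fun; split_ifs <;> linarith

lemma carries_x1_mid : Carries x1 [true, false] [true, false, false] := by
  rintro t ⟨h0, h1⟩
  simp only [aff_cons, aff_nil, cond_false, cond_true]
  show x1fun _ = _
  unfold x1fun; split_ifs <;> linarith

lemma carries_x1_mid' : Carries x1 [true, true, false] [true, false, true] := by
  rintro t ⟨h0, h1⟩
  simp only [aff_cons, aff_nil, cond_false, cond_true]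
  show x1fun _ = _
  unfold x1fun; split_ifs <;> linarith

lemma carries_x1_right : Carries x1 [true, true, true] [true, true] := by
  rintro t ⟨h0, h1⟩
  simp only [aff_cons, aff_nil, cond_true]
  show x1fun _ = _
  unfold x1fun; split_ifs <;> linarith

lemma not_bad_append {p : Equiv.Perm ℝ} {u v : List Bool} (h : Carries p u v) (y : List Bool) :
    u ++ y ∉ bad p := not_mem_bad.2 ⟨_, h.append y⟩

lemma bad_x0 : bad x0 ⊆ {[], [true]} := by
  rintro u hu
  match u with
  | [] => simp
  | false :: y => exact absurd hu (not_bad_append carries_x0_left y)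
  | [true] => simp
  | true :: false :: y => exact absurd hu (not_bad_append carries_x0_mid y)
  | true :: true :: y => exact absurd hu (not_bad_append carries_x0_right y)

lemma bad_x0_inv : bad x0⁻¹ ⊆ {[], [false]} := by
  rintro u hu
  match u with
  | [] => simp
  | true :: y => exact absurd hu (not_bad_append carries_x0_right.inv y)
  | [false] => simp
  | false :: true :: y => exact absurd hu (not_bad_append carries_x0_mid.inv y)
  | false :: false :: y => exact absurd hu (not_bad_append carries_x0_left.inv y)

lemma bad_x1 : bad x1 ⊆ {[], [true], [true, true]} := by
  rintro u hu
  match u with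
  | [] => simp
  | false :: y => exact absurd hu (not_bad_append carries_x1_left y)
  | [true] => simp
  | true :: false :: y => exact absurd hu (not_bad_append carries_x1_mid y)
  | [true, true] => simp
  | true :: true :: false :: y => exact absurd hu (not_bad_append carries_x1_mid' y)
  | true :: true :: true :: y => exact absurd hu (not_bad_append carries_x1_right y)

lemma bad_x1_inv : bad x1⁻¹ ⊆ {[], [true], [true, false]} := by
  rintro u hu
  match u with
  | [] => simp
  | false :: y => exact absurd hu (not_bad_append carries_x1_left.inv y)
  | [true] => simp
  | true :: true :: y => exact absurd hu (not_bad_append carries_x1_right.inv y)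
  | [true, false] => simp
  | true :: false :: false :: y => exact absurd hu (not_bad_append carries_x1_mid.inv y)
  | true :: false :: true :: y => exact absurd hu (not_bad_append carries_x1_mid'.inv y)

/-- The symmetric generating set of `F`. -/
def gens : Set (Equiv.Perm ℝ) := {x0, x1, x0⁻¹, x1⁻¹}

lemma finite_and_ncard_le {S T : Set (List Bool)} (h : S ⊆ T) (hT : T.Finite) {n : ℕ}
    (hn : T.ncard ≤ n) : S.Finite ∧ S.ncard ≤ n :=
  ⟨hT.subset h, (ncard_le_ncard h hT).trans hn⟩

lemma ncard_triple_le {α : Type*} (a b c : α) : ({a, b, c} : Set α).ncard ≤ 3 := by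
  have h1 := ncard_insert_le a ({b, c} : Set α)
  have h2 := ncard_insert_le b ({c} : Set α)
  rw [ncard_singleton] at h2
  omega

lemma ncard_double_le {α : Type*} (b c : α) : ({b, c} : Set α).ncard ≤ 3 := by
  have h2 := ncard_insert_le b ({c} : Set α)
  rw [ncard_singleton] at h2
  omega

lemma bad_gens {g : Equiv.Perm ℝ} (hg : g ∈ gens) : (bad g).Finite ∧ (bad g).ncard ≤ 3 := by
  rcases hg with rfl | rfl | rfl | rfl
  · exact finite_and_ncard_le bad_x0 (by simp) (ncard_double_le _ _)
  · exact finite_and_ncard_le bad_x1 (by simp) (ncard_triple_le _ _ _)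
  · exact finite_and_ncard_le bad_x0_inv (by simp) (ncard_double_le _ _)
  · exact finite_and_ncard_le bad_x1_inv (by simp) (ncard_triple_le _ _ _)

lemma gens_inv {g : Equiv.Perm ℝ} (hg : g ∈ gens) : g⁻¹ ∈ gens := by
  rcases hg with rfl | rfl | rfl | rfl <;> simp [gens]

lemma x0_mem_gens : x0 ∈ gens := by simp [gens]
lemma x1_mem_gens : x1 ∈ gens := by simp [gens]

lemma gens_subset : gens ⊆ ThompsonF := by
  have h0 : x0 ∈ ThompsonF := Subgroup.subset_closure (by simp)
  have h1 : x1 ∈ ThompsonF := Subgroup.subset_closure (by simp)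
  rintro g (rfl | rfl | rfl | rfl)
  exacts [h0, h1, inv_mem h0, inv_mem h1]

lemma wordLength_prod_le {w : List (Equiv.Perm ℝ)} (hw : ∀ g ∈ w, g ∈ gens) :
    wordLength w.prod ≤ w.length := Nat.sInf_le ⟨w, rfl, hw, rfl⟩

lemma prod_mem {w : List (Equiv.Perm ℝ)} (hw : ∀ g ∈ w, g ∈ gens) : w.prod ∈ ThompsonF :=
  ThompsonF.list_prod_mem fun g hg => gens_subset (hw g hg)

lemma inv_word {w : List (Equiv.Perm ℝ)} (hw : ∀ g ∈ w, g ∈ gens) :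
    ∃ w' : List (Equiv.Perm ℝ), w'.length = w.length ∧ (∀ g ∈ w', g ∈ gens) ∧
      w'.prod = w.prod⁻¹ := by
  refine ⟨(w.map (·⁻¹)).reverse, by simp, ?_, ?_⟩
  · intro g hg
    simp only [List.mem_reverse, List.mem_map] at hg
    obtain ⟨a, ha, rfl⟩ := hg
    exact gens_inv (hw a ha)
  · rw [List.prod_inv_reverse]

lemma exists_word {p : Equiv.Perm ℝ} (hp : p ∈ ThompsonF) : ∃ w : List (Equiv.Perm ℝ),
    w.length = wordLength p ∧ (∀ g ∈ w, g ∈ gens) ∧ w.prod = p := by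
  have : {n | ∃ w : List (Equiv.Perm ℝ),
      w.length = n ∧ (∀ g ∈ w, g ∈ gens) ∧ w.prod = p}.Nonempty := by
    refine Subgroup.closure_induction (p := fun p _ => {n | ∃ w : List (Equiv.Perm ℝ),
      w.length = n ∧ (∀ g ∈ w, g ∈ gens) ∧ w.prod = p}.Nonempty) ?_ ?_ ?_ ?_ hp
    · rintro x hx
      refine ⟨1, [x], rfl, ?_, by simp⟩
      rcases hx with rfl | rfl <;> simp [gens]
    · exact ⟨0, [], rfl, by simp, rfl⟩
    · rintro _ _ _ _ ⟨_, w, rfl, hw, rfl⟩ ⟨_, v, rfl, hv, rfl⟩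
      refine ⟨_, w ++ v, rfl, ?_, by simp⟩
      intro g hg
      rcases List.mem_append.1 hg with h | h
      exacts [hw g h, hv g h]
    · rintro _ _ ⟨_, w, rfl, hw, rfl⟩
      obtain ⟨w', h1, h2, h3⟩ := inv_word hw
      exact ⟨_, w', rfl, h2, h3⟩
  exact Nat.sInf_mem this

lemma wordLength_mul {p q : Equiv.Perm ℝ} (hp : p ∈ ThompsonF) (hq : q ∈ ThompsonF) :
    wordLength (p * q) ≤ wordLength p + wordLength q := by
  obtain ⟨w, h1, h2, rfl⟩ := exists_word hp
  obtain ⟨v, h3, h4, rfl⟩ := exists_word hq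
  rw [← List.prod_append, ← h1, ← h3, ← List.length_append]
  refine wordLength_prod_le fun g hg => ?_
  rcases List.mem_append.1 hg with h | h
  exacts [h2 g h, h4 g h]

lemma wordLength_inv {p : Equiv.Perm ℝ} (hp : p ∈ ThompsonF) :
    wordLength p⁻¹ ≤ wordLength p := by
  obtain ⟨w, h1, h2, rfl⟩ := exists_word hp
  obtain ⟨w', h3, h4, h5⟩ := inv_word h2
  rw [← h5, ← h1, ← h3]
  exact wordLength_prod_le h4

lemma wordLength_gens {g : Equiv.Perm ℝ} (hg : g ∈ gens) : wordLength g ≤ 1 := by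
  simpa using wordLength_prod_le (w := [g]) (by simpa using hg)

lemma wordLength_one : wordLength 1 = 0 := by
  simpa using wordLength_prod_le (w := []) (by simp)

lemma wordLength_pow {p : Equiv.Perm ℝ} (hp : p ∈ ThompsonF) (n : ℕ) :
    wordLength (p ^ n) ≤ n * wordLength p := by
  induction n with
  | zero => simp [wordLength_one]
  | succ n ih =>
    rw [pow_succ]
    have := wordLength_mul (pow_mem hp n) hp
    linarith

/-- Induction along a geodesic word. -/
lemma induction_on_word {P : Equiv.Perm ℝ → ℕ → Prop} (h1 : P 1 0)
    (hm : ∀ g ∈ gens, ∀ p ∈ ThompsonF, ∀ n, P p n → P (g * p) (n + 1)) {p : Equiv.Perm ℝ}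
    (hp : p ∈ ThompsonF) : P p (wordLength p) := by
  obtain ⟨w, hl, hw, rfl⟩ := exists_word hp
  rw [← hl]
  clear hl hp
  induction w with
  | nil => simpa using h1
  | cons g w ih =>
    rw [List.prod_cons, List.length_cons]
    have hw' : ∀ g ∈ w, g ∈ gens := fun a ha => hw a (by simp [ha])
    exact hm g (hw g (by simp)) _ (prod_mem hw') _ (ih hw')

lemma bad_one : bad 1 = ∅ := by
  ext u
  simp only [mem_empty_iff_false, iff_false]
  exact not_mem_bad.2 ⟨u, Carries.one u⟩

lemma bad_of_mem {p : Equiv.Perm ℝ} (hp : p ∈ ThompsonF) :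
    (bad p).Finite ∧ (bad p).ncard ≤ 3 * wordLength p := by
  refine induction_on_word (P := fun p n => (bad p).Finite ∧ (bad p).ncard ≤ 3 * n) ?_ ?_ hp
  · simp [bad_one]
  · rintro g hg p _ n ⟨h1, h2⟩
    obtain ⟨h3, h4⟩ := bad_gens hg
    obtain ⟨h5, h6⟩ := bad_mul g p h3 h1
    exact ⟨h5, by omega⟩

lemma x0_strictMono : StrictMono x0 := by
  intro s t h
  show x0fun s < x0fun t
  unfold x0fun; split_ifs <;> linarith

lemma x1_strictMono : StrictMono x1 := by
  intro s t h
  show x1fun s < x1fun t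
  unfold x1fun; split_ifs <;> linarith

lemma strictMono_inv {p : Equiv.Perm ℝ} (hp : StrictMono p) : StrictMono (p⁻¹ : Equiv.Perm ℝ) := by
  intro s t h
  have : p (p⁻¹ s) < p (p⁻¹ t) := by simpa using h
  exact hp.lt_iff_lt.1 this

/-- Piecewise dyadic-affine increasing permutations of `ℝ` fixing the complement of `(0,1)`. -/
structure Dy (p : Equiv.Perm ℝ) : Prop where
  mono : StrictMono p
  fix : ∀ t, t ∉ Ioo (0 : ℝ) 1 → p t = t
  fin : (bad p).Finite
  fin_inv : (bad p⁻¹).Finite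

namespace Dy
variable {p q : Equiv.Perm ℝ}

lemma one : Dy 1 := ⟨fun _ _ h => h, fun _ _ => rfl, by simp [bad_one], by simp [bad_one]⟩

lemma inv (hp : Dy p) : Dy p⁻¹ where
  mono := strictMono_inv hp.mono
  fix t ht := by rw [Equiv.Perm.inv_eq_iff_eq, hp.fix t ht]
  fin := hp.fin_inv
  fin_inv := by simpa using hp.fin

lemma mul (hp : Dy p) (hq : Dy q) : Dy (p * q) where
  mono := hp.mono.comp hq.mono
  fix t ht := by rw [Equiv.Perm.mul_apply, hq.fix t ht, hp.fix t ht]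
  fin := (bad_mul p q hp.fin hq.fin).1
  fin_inv := by rw [mul_inv_rev]; exact (bad_mul _ _ hq.fin_inv hp.fin_inv).1

lemma pow (hp : Dy p) (n : ℕ) : Dy (p ^ n) := by
  induction n with
  | zero => simpa using Dy.one
  | succ n ih => rw [pow_succ]; exact ih.mul hp

lemma zpow (hp : Dy p) (n : ℤ) : Dy (p ^ n) := by
  cases n with
  | ofNat n => simpa using hp.pow n
  | negSucc n => rw [zpow_negSucc]; exact (hp.pow _).inv

lemma mem_Ioo_iff (hp : Dy p) {t : ℝ} : p t ∈ Ioo (0 : ℝ) 1 ↔ t ∈ Ioo (0 : ℝ) 1 := by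
  have h0 : p 0 = 0 := hp.fix 0 (by simp)
  have h1 : p 1 = 1 := hp.fix 1 (by simp)
  have h2 := hp.mono.lt_iff_lt (a := 0) (b := t)
  have h3 := hp.mono.lt_iff_lt (a := t) (b := 1)
  rw [h0] at h2
  rw [h1] at h3
  rw [mem_Ioo, mem_Ioo, h2, h3]

lemma map_zero (hp : Dy p) : p 0 = 0 := hp.fix 0 (by simp)
lemma map_one (hp : Dy p) : p 1 = 1 := hp.fix 1 (by simp)

end Dy

lemma dy_gens {g : Equiv.Perm ℝ} (hg : g ∈ gens) : Dy g := by
  have h0 : Dy x0 := by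
    refine ⟨x0_strictMono, fun t ht => ?_, (bad_gens x0_mem_gens).1,
      (bad_gens (gens_inv x0_mem_gens)).1⟩
    show x0fun t = t
    simp only [mem_Ioo, not_and_or, not_lt] at ht
    unfold x0fun; split_ifs <;> rcases ht with ht | ht <;> linarith
  have h1 : Dy x1 := by
    refine ⟨x1_strictMono, fun t ht => ?_, (bad_gens x1_mem_gens).1,
      (bad_gens (gens_inv x1_mem_gens)).1⟩
    show x1fun t = t
    simp only [mem_Ioo, not_and_or, not_lt] at ht
    unfold x1fun; split_ifs <;> rcases ht with ht | ht <;> linarith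
  rcases hg with rfl | rfl | rfl | rfl
  exacts [h0, h1, h0.inv, h1.inv]

lemma dy_of_mem {p : Equiv.Perm ℝ} (hp : p ∈ ThompsonF) : Dy p :=
  induction_on_word (P := fun p _ => Dy p) Dy.one (fun _ hg _ _ _ h => (dy_gens hg).mul h) hp

/-- Finite rooted binary trees. -/
inductive BTree
  | leaf : BTree
  | node : BTree → BTree → BTree

namespace BTree

/-- The number of carets. -/
def carets : BTree → ℕ
  | leaf => 0
  | node L R => carets L + carets R + 1

/-- The addresses of the leaves, from left to right. -/
def leaves : BTree → List (List Bool)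
  | leaf => [[]]
  | node L R => (leaves L).map (false :: ·) ++ (leaves R).map (true :: ·)

/-- The left vine with `n` carets. -/
def vine : ℕ → BTree
  | 0 => leaf
  | n + 1 => node (vine n) leaf

lemma length_leaves (T : BTree) : T.leaves.length = T.carets + 1 := by
  induction T with
  | leaf => rfl
  | node L R hL hR => simp [leaves, carets, hL, hR]; omega

lemma exists_leaf (T : BTree) {t : ℝ} (ht : t ∈ Icc (0 : ℝ) 1) :
    ∃ u ∈ T.leaves, ∃ y ∈ Icc (0 : ℝ) 1, t = aff u y := by
  induction T generalizing t with
  | leaf => exact ⟨[], by simp [leaves], t, ht, rfl⟩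
  | node L R hL hR =>
    obtain ⟨h0, h1⟩ := ht
    rcases le_total t (1 / 2) with h | h
    · obtain ⟨u, hu, y, hy, e⟩ := hL (t := 2 * t) ⟨by linarith, by linarith⟩
      refine ⟨false :: u, by simp [leaves, hu], y, hy, ?_⟩
      rw [aff_cons, ← e]; simp
    · obtain ⟨u, hu, y, hy, e⟩ := hR (t := 2 * t - 1) ⟨by linarith, by linarith⟩
      refine ⟨true :: u, by simp [leaves, hu], y, hy, ?_⟩
      rw [aff_cons, ← e]; simp

/-- `p` carries the leaves of `S` to those of `T`, in order. -/
def CarriesLeaves (p : Equiv.Perm ℝ) (S T : BTree) : Prop :=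
  List.Forall₂ (Carries p) S.leaves T.leaves

/-- `T` can be carried to `T'` by a word of length at most `n`. -/
def Red (T : BTree) (n : ℕ) (T' : BTree) : Prop :=
  ∃ w : List (Equiv.Perm ℝ), w.length ≤ n ∧ (∀ g ∈ w, g ∈ gens) ∧ CarriesLeaves w.prod T T'

lemma forall₂_trans {p q : Equiv.Perm ℝ} {a b c : List (List Bool)}
    (h : List.Forall₂ (Carries q) a b) (h' : List.Forall₂ (Carries p) b c) :
    List.Forall₂ (Carries (p * q)) a c := by
  induction h generalizing c with
  | nil => cases h'; exact List.Forall₂.nil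
  | cons h1 _ ih =>
    cases h' with
    | cons h3 h4 => exact List.Forall₂.cons (h3.mul h1) (ih h4)

lemma Red.trans {T T' T'' : BTree} {m n : ℕ} (h : Red T m T') (h' : Red T' n T'') :
    Red T (m + n) T'' := by
  obtain ⟨w, h1, h2, h3⟩ := h
  obtain ⟨v, h4, h5, h6⟩ := h'
  refine ⟨v ++ w, by rw [List.length_append]; omega, ?_, ?_⟩
  · intro g hg
    rcases List.mem_append.1 hg with h | h
    exacts [h5 g h, h2 g h]
  · rw [List.prod_append]; exact forall₂_trans h3 h6

lemma Red.mono {T T' : BTree} {m n : ℕ} (h : Red T m T') (hmn : m ≤ n) : Red T n T' := by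
  obtain ⟨w, h1, h2, h3⟩ := h
  exact ⟨w, h1.trans hmn, h2, h3⟩

lemma Red.refl (T : BTree) : Red T 0 T := by
  refine ⟨[], by simp, by simp, ?_⟩
  simp only [CarriesLeaves, List.prod_nil]
  exact List.forall₂_same.2 fun u _ => Carries.one u

lemma Red.of_gen {g : Equiv.Perm ℝ} (hg : g ∈ gens) {T T' : BTree} (h : CarriesLeaves g T T') :
    Red T 1 T' := ⟨[g], by simp, by simpa using hg, by simpa using h⟩

lemma forall₂_map {g : Equiv.Perm ℝ} {u v : List Bool} (h : Carries g u v) (l : List (List Bool)) :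
    List.Forall₂ (Carries g) (l.map (u ++ ·)) (l.map (v ++ ·)) := by
  induction l with
  | nil => simp
  | cons a l ih => exact List.Forall₂.cons (h.append a) ih

lemma red_x0 (A B C : BTree) : Red (node A (node B C)) 1 (node (node A B) C) := by
  refine Red.of_gen x0_mem_gens ?_
  simp only [CarriesLeaves, leaves, List.map_append, List.map_map, List.append_assoc]
  exact List.rel_append (forall₂_map carries_x0_left _) <|
    List.rel_append (forall₂_map carries_x0_mid _) (forall₂_map carries_x0_right _)

lemma red_x0_inv (A B C : BTree) : Red (node (node A B) C) 1 (node A (node B C)) := by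
  refine Red.of_gen (gens_inv x0_mem_gens) ?_
  simp only [CarriesLeaves, leaves, List.map_append, List.map_map, List.append_assoc]
  exact List.rel_append (forall₂_map carries_x0_left.inv _) <|
    List.rel_append (forall₂_map carries_x0_mid.inv _) (forall₂_map carries_x0_right.inv _)

lemma red_x1_inv (L A B C : BTree) :
    Red (node L (node (node A B) C)) 1 (node L (node A (node B C))) := by
  refine Red.of_gen (gens_inv x1_mem_gens) ?_
  simp only [CarriesLeaves, leaves, List.map_append, List.map_map, List.append_assoc]
  exact List.rel_append (forall₂_map carries_x1_left.inv _) <|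
    List.rel_append (forall₂_map carries_x1_mid.inv _) <|
    List.rel_append (forall₂_map carries_x1_mid'.inv _) (forall₂_map carries_x1_right.inv _)

lemma red_absorb (A : BTree) (k : ℕ) (B : BTree) :
    Red (node (vine k) (node A B)) (2 * carets A + 1) (node (vine (k + 1 + carets A)) B) := by
  induction A generalizing k B with
  | leaf => exact red_x0 _ _ _
  | node A₁ A₂ h1 h2 =>
    have h := ((red_x1_inv (vine k) A₁ A₂ B).trans (h1 k (node A₂ B))).trans (h2 _ B)
    have e : k + 1 + carets A₁ + 1 + carets A₂ = k + 1 + carets (node A₁ A₂) := by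
      simp only [carets]; omega
    rw [e] at h
    exact h.mono (by simp only [carets]; omega)

lemma red_right (R : BTree) (k : ℕ) :
    Red (node (vine k) R) (2 * carets R) (vine (k + 1 + carets R)) := by
  induction R generalizing k with
  | leaf => exact Red.refl _
  | node A B _ hB =>
    have h := (red_absorb A k B).trans (hB _)
    have e : k + 1 + carets A + 1 + carets B = k + 1 + carets (node A B) := by
      simp only [carets]; omega
    rw [e] at h
    exact h.mono (by simp only [carets]; omega)

lemma red_node (L R : BTree) :
    Red (node L R) (3 * carets L + 2 * carets R) (vine (carets L + carets R + 1)) := by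
  induction L generalizing R with
  | leaf =>
    have h := red_right R 0
    have e : 0 + 1 + carets R = carets leaf + carets R + 1 := by simp only [carets]; omega
    rw [e] at h
    exact h.mono (by simp only [carets]; omega)
  | node L₁ L₂ h1 _ =>
    have h := (red_x0_inv L₁ L₂ R).trans (h1 (node L₂ R))
    have e : carets L₁ + carets (node L₂ R) + 1 = carets (node L₁ L₂) + carets R + 1 := by
      simp only [carets]; omega
    rw [e] at h
    exact h.mono (by simp only [carets]; omega)

lemma red_vine (T : BTree) : Red T (3 * carets T) (vine (carets T)) := by
  cases T with
  | leaf => exact Red.refl _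
  | node L R => exact (red_node L R).mono (by simp only [carets]; omega)

end BTree

open BTree

/-- A list of words whose dyadic intervals are consecutive and fill `[a,b]`. -/
def Consec : ℝ → List (List Bool) → ℝ → Prop
  | a, [], b => a = b
  | a, u :: l, b => aff u 0 = a ∧ Consec (aff u 1) l b

lemma Consec.append {a b c : ℝ} {l m : List (List Bool)} (h : Consec a l b) (h' : Consec b m c) :
    Consec a (l ++ m) c := by
  induction l generalizing a with
  | nil => simp only [Consec] at h; subst h; exact h'
  | cons u l ih => exact ⟨h.1, ih h.2⟩

lemma Consec.map_cons {a b : ℝ} {l : List (List Bool)} (h : Consec a l b) (c : Bool) :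
    Consec ((cond c 1 0 + a) / 2) (l.map (c :: ·)) ((cond c 1 0 + b) / 2) := by
  induction l generalizing a with
  | nil => simp only [Consec] at h; subst h; rfl
  | cons u l ih =>
    refine ⟨?_, ih h.2⟩
    rw [aff_cons, h.1]

lemma consec_leaves (T : BTree) : Consec 0 T.leaves 1 := by
  induction T with
  | leaf => exact ⟨rfl, rfl⟩
  | node L R hL hR =>
    have h1 := hL.map_cons false
    have h2 := hR.map_cons true
    norm_num at h1 h2
    exact h1.append h2

lemma Consec.map {p : Equiv.Perm ℝ} {a b : ℝ} {l m : List (List Bool)} (h : Consec a l b)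
    (hp : List.Forall₂ (Carries p) l m) : Consec (p a) m (p b) := by
  induction hp generalizing a with
  | nil => simp only [Consec] at h; subst h; rfl
  | @cons u v _ _ huv _ ih =>
    refine ⟨?_, ?_⟩
    · rw [← h.1, huv 0 (by simp)]
    · rw [← huv 1 (by simp)]; exact ih h.2

lemma aff_zero_lt_one (u : List Bool) : aff u 0 < 1 :=
  (aff_strictMono u one_pos).trans_le (aff_mem_Icc u (by simp)).2

lemma aff_zero_nonneg (u : List Bool) : 0 ≤ aff u 0 := (aff_mem_Icc u (by simp)).1

lemma aff_one_pos (u : List Bool) : 0 < aff u 1 :=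
  (aff_zero_nonneg u).trans_lt (aff_strictMono u one_pos)

lemma aff_one_le_one (u : List Bool) : aff u 1 ≤ 1 := (aff_mem_Icc u (by simp)).2

lemma Consec.nil_not_mem {a b : ℝ} {l : List (List Bool)} (h : Consec a l b) (ha : 0 < a) :
    [] ∉ l := by
  induction l generalizing a with
  | nil => simp
  | cons u l ih =>
    intro hm
    rcases List.mem_cons.1 hm with rfl | hm
    · have := h.1; simp at this; linarith
    · exact ih h.2 (aff_one_pos u) hm

lemma Consec.right_half {a : ℝ} {l : List (List Bool)} (h : Consec a l 1) (ha : 1 / 2 ≤ a) :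
    ∃ m, l = m.map (true :: ·) ∧ Consec (2 * a - 1) m 1 := by
  induction l generalizing a with
  | nil => simp only [Consec] at h; exact ⟨[], rfl, by simp only [Consec]; linarith⟩
  | cons u l ih =>
    obtain ⟨h1, h2⟩ := h
    match u with
    | [] => simp at h1; linarith
    | false :: u =>
      have := aff_zero_lt_one u
      simp only [aff_cons, cond_false] at h1; linarith
    | true :: u =>
      simp only [aff_cons, cond_true] at h1 h2
      obtain ⟨m, rfl, hm⟩ := ih h2 (by linarith [aff_one_pos u])
      refine ⟨u :: m, rfl, by linarith, ?_⟩
      convert hm using 1; ring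

lemma Consec.left_half {a : ℝ} {l : List (List Bool)} (h : Consec a l 1) (ha : a ≤ 1 / 2)
    (hl : [] ∉ l) : ∃ m n, l = m.map (false :: ·) ++ n.map (true :: ·) ∧ Consec (2 * a) m 1 ∧
      Consec 0 n 1 := by
  induction l generalizing a with
  | nil => simp only [Consec] at h; linarith
  | cons u l ih =>
    rcases ha.lt_or_eq with ha' | rfl
    · obtain ⟨h1, h2⟩ := h
      match u with
      | [] => simp at hl
      | true :: u =>
        have := aff_zero_nonneg u
        simp only [aff_cons, cond_true] at h1; linarith
      | false :: u =>
        simp only [aff_cons, cond_false] at h1 h2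
        obtain ⟨m, n, rfl, hm, hn⟩ := ih h2 (by linarith [aff_one_le_one u])
          (fun h => hl (by simp [h]))
        refine ⟨u :: m, n, rfl, ⟨by linarith, ?_⟩, hn⟩
        convert hm using 1; ring
    · obtain ⟨n, e, hn⟩ := h.right_half le_rfl
      refine ⟨[], n, by simpa using e, ?_, ?_⟩
      · simp only [Consec]; norm_num
      · convert hn using 1; norm_num

lemma Consec.exists_tree {l : List (List Bool)} (h : Consec 0 l 1) : ∃ T : BTree, T.leaves = l := by
  induction hn : l.length using Nat.strong_induction_on generalizing l with
  | _ k ih =>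
    match l with
    | [] => simp [Consec] at h
    | [] :: [] => exact ⟨leaf, rfl⟩
    | [] :: u :: l =>
      have := h.2.1
      have h' := aff_zero_lt_one u
      simp only [aff_nil] at this; linarith
    | (c :: u) :: l =>
      have hnil : [] ∉ (c :: u) :: l := by
        intro hm
        rcases List.mem_cons.1 hm with h' | h'
        · simp at h'
        · exact h.2.nil_not_mem (aff_one_pos _) h'
      obtain ⟨m, n, e, hm, h0⟩ := h.left_half (by norm_num) hnil
      have hm0 : m ≠ [] := by rintro rfl; simp [Consec] at hm
      have hn0 : n ≠ [] := by rintro rfl; simp [Consec] at h0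
      have hlen := congrArg List.length e
      simp only [List.length_append, List.length_map] at hlen
      have h1 := List.length_pos_of_ne_nil hm0
      have h2 := List.length_pos_of_ne_nil hn0
      rw [mul_zero] at hm
      obtain ⟨L, rfl⟩ := ih m.length (by omega) hm rfl
      obtain ⟨R, rfl⟩ := ih n.length (by omega) h0 rfl
      exact ⟨node L R, e.symm⟩

lemma exists_good_tree {p : Equiv.Perm ℝ} (hp : (bad p).Finite) (u : List Bool) :
    ∃ T : BTree, T.carets ≤ {w ∈ bad p | u <+: w}.ncard ∧ ∀ w ∈ T.leaves, u ++ w ∉ bad p := by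
  induction hn : {w ∈ bad p | u <+: w}.ncard using Nat.strong_induction_on generalizing u with
  | _ k ih =>
    by_cases hu : u ∈ bad p
    · have fin : ∀ v, {w ∈ bad p | v <+: w}.Finite := fun v => hp.subset (sep_subset _ _)
      have hdisj : Disjoint {w ∈ bad p | u ++ [false] <+: w} {w ∈ bad p | u ++ [true] <+: w} := by
        rw [Set.disjoint_left]
        rintro w ⟨_, a, rfl⟩ ⟨_, b, hb⟩
        simp at hb
      have hsub : insert u ({w ∈ bad p | u ++ [false] <+: w} ∪ {w ∈ bad p | u ++ [true] <+: w}) ⊆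
          {w ∈ bad p | u <+: w} := by
        rintro w (rfl | ⟨h1, h2⟩ | ⟨h1, h2⟩)
        · exact ⟨hu, List.prefix_rfl⟩
        · exact ⟨h1, (List.prefix_append u _).trans h2⟩
        · exact ⟨h1, (List.prefix_append u _).trans h2⟩
      have hc := ncard_le_ncard hsub (fin u)
      have hnot : u ∉ {w ∈ bad p | u ++ [false] <+: w} ∪ {w ∈ bad p | u ++ [true] <+: w} := by
        rintro (⟨_, h2⟩ | ⟨_, h2⟩) <;> · have := h2.length_le; simp at this
      rw [ncard_insert_of_notMem hnot ((fin _).union (fin _)),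
        ncard_union_eq hdisj (fin _) (fin _)] at hc
      obtain ⟨L, hL, hL'⟩ := ih _ (by omega) (u ++ [false]) rfl
      obtain ⟨R, hR, hR'⟩ := ih _ (by omega) (u ++ [true]) rfl
      refine ⟨node L R, by simp only [carets]; omega, ?_⟩
      intro w hw
      simp only [leaves, List.mem_append, List.mem_map] at hw
      rcases hw with ⟨a, ha, rfl⟩ | ⟨a, ha, rfl⟩
      · simpa using hL' a ha
      · simpa using hR' a ha
    · exact ⟨leaf, by simp [carets], by simpa [leaves] using hu⟩

lemma eq_of_carriesLeaves {p q : Equiv.Perm ℝ} (hp : ∀ t, t ∉ Ioo (0 : ℝ) 1 → p t = t)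
    (hq : ∀ t, t ∉ Ioo (0 : ℝ) 1 → q t = t) {S T : BTree} (h : CarriesLeaves p S T)
    (h' : CarriesLeaves q S T) : p = q := by
  have key : ∀ l m, List.Forall₂ (Carries p) l m → List.Forall₂ (Carries q) l m →
      ∀ u ∈ l, ∃ v, Carries p u v ∧ Carries q u v := by
    intro l m h1 h2
    induction h1 with
    | nil => simp
    | @cons a b l m hab _ ih =>
      cases h2 with
      | cons h3 h4 =>
        intro u hu
        rcases List.mem_cons.1 hu with rfl | hu
        exacts [⟨b, hab, h3⟩, ih h4 u hu]
  ext t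
  by_cases ht : t ∈ Ioo (0 : ℝ) 1
  · obtain ⟨u, hu, y, hy, rfl⟩ := S.exists_leaf ⟨ht.1.le, ht.2.le⟩
    obtain ⟨v, h1, h2⟩ := key _ _ h h' u hu
    rw [h1 y hy, h2 y hy]
  · rw [hp t ht, hq t ht]

/-- Membership in `F` together with a linear bound for the word length. -/
theorem mem_and_wordLength_le {p : Equiv.Perm ℝ} (hp : (bad p).Finite)
    (hfix : ∀ t, t ∉ Ioo (0 : ℝ) 1 → p t = t) :
    p ∈ ThompsonF ∧ wordLength p ≤ 6 * (bad p).ncard := by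
  obtain ⟨S, hS, hS'⟩ := exists_good_tree hp []
  have hS2 : S.carets ≤ (bad p).ncard := by simpa using hS
  have hg : ∀ u ∈ S.leaves, ∃ v, Carries p u v := fun u hu => not_mem_bad.1 (by simpa using hS' u hu)
  choose! φ hφ using hg
  have h2 : List.Forall₂ (Carries p) S.leaves (S.leaves.map φ) := by
    rw [List.forall₂_map_right_iff]
    exact List.forall₂_same.2 hφ
  have hc := (consec_leaves S).map h2
  rw [hfix 0 (by simp), hfix 1 (by simp)] at hc
  obtain ⟨T, hT⟩ := hc.exists_tree
  rw [← hT] at h2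
  have hlen := h2.length_eq
  rw [length_leaves, length_leaves] at hlen
  obtain ⟨w, hw1, hw2, hw3⟩ := S.red_vine
  obtain ⟨v, hv1, hv2, hv3⟩ := T.red_vine
  rw [show T.carets = S.carets by omega] at hv1 hv3
  have hw := prod_mem hw2
  have hv := prod_mem hv2
  have e : v.prod * p = w.prod := by
    refine eq_of_carriesLeaves (fun t ht => ?_) (dy_of_mem hw).fix (forall₂_trans h2 hv3) hw3
    rw [Equiv.Perm.mul_apply, hfix t ht, (dy_of_mem hv).fix t ht]
  have e' : p = v.prod⁻¹ * w.prod := by rw [← e]; simp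
  rw [e']
  refine ⟨mul_mem (inv_mem hv) hw, ?_⟩
  have h3 := wordLength_mul (inv_mem hv) hw
  have h4 := wordLength_inv hv
  have h5 := wordLength_prod_le hw2
  have h6 := wordLength_prod_le hv2
  rw [← e'] at h3 ⊢
  omega

lemma irrational_aff {u : List Bool} {y : ℝ} : Irrational (aff u y) ↔ Irrational y := by
  induction u with
  | nil => rfl
  | cons b u ih =>
    have e : aff (b :: u) y = (((cond b 1 0 : ℕ) : ℝ) + aff u y) / ((2 : ℕ) : ℝ) := by
      cases b <;> simp [aff_cons]
    rw [← ih, e, irrational_div_natCast_iff, irrational_natCast_add_iff]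
    simp

/-- The irrational points of the unit interval. -/
def X : Set ℝ := {t | t ∈ Ioo (0 : ℝ) 1 ∧ Irrational t}

/-- The midpoint of a standard dyadic interval. -/
def mid (w : List Bool) : ℝ := aff w (1 / 2)

lemma mid_mem_cell (w : List Bool) : mid w ∈ cell w := aff_mem_cell w (by norm_num)

lemma mid_cons (b : Bool) (w : List Bool) : mid (b :: w) = (cond b 1 0 + mid w) / 2 := rfl

lemma exists_cell_or_mid (n : ℕ) {t : ℝ} (ht : t ∈ Ioo (0 : ℝ) 1) :
    (∃ u, u.length = n ∧ t ∈ cell u) ∨ ∃ w, t = mid w := by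
  induction n generalizing t with
  | zero => exact Or.inl ⟨[], rfl, by simpa [cell] using ht⟩
  | succ n ih =>
    obtain ⟨h0, h1⟩ := ht
    rcases lt_trichotomy t (1 / 2) with h | h | h
    · rcases ih (t := 2 * t) ⟨by linarith, by linarith⟩ with ⟨u, hu, hm⟩ | ⟨w, hw⟩
      · exact Or.inl ⟨false :: u, by simp [hu], mem_cell_cons.2 (by simpa using hm)⟩
      · exact Or.inr ⟨false :: w, by rw [mid_cons, ← hw]; simp⟩
    · exact Or.inr ⟨[], by simpa [mid] using h⟩
    · rcases ih (t := 2 * t - 1) ⟨by linarith, by linarith⟩ with ⟨u, hu, hm⟩ | ⟨w, hw⟩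
      · exact Or.inl ⟨true :: u, by simp [hu], mem_cell_cons.2 (by simpa using hm)⟩
      · exact Or.inr ⟨true :: w, by rw [mid_cons, ← hw]; simp⟩

lemma not_irrational_mid (w : List Bool) : ¬ Irrational (mid w) := by
  rw [mid, irrational_aff]
  have : ((1 / 2 : ℚ) : ℝ) = 1 / 2 := by norm_num
  rw [← this]
  exact Rat.not_irrational _

lemma exists_cell {t : ℝ} (ht : t ∈ X) (n : ℕ) : ∃ u, u.length = n ∧ t ∈ cell u := by
  rcases exists_cell_or_mid n ht.1 with h | ⟨w, rfl⟩
  · exact h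
  · exact absurd ht.2 (not_irrational_mid w)

lemma exists_mem_X {a b : ℝ} (ha : 0 ≤ a) (hab : a < b) (hb : b ≤ 1) : ∃ t ∈ X, a < t ∧ t < b := by
  obtain ⟨t, h1, h2, h3⟩ := exists_irrational_btwn hab
  exact ⟨t, ⟨⟨by linarith, by linarith⟩, h1⟩, h2, h3⟩

lemma mem_cell_of_mem_X {t : ℝ} (ht : t ∈ X) {w : List Bool} (h0 : aff w 0 ≤ t) (h1 : t ≤ aff w 1) :
    t ∈ cell w := by
  have key : ∀ {y : ℝ}, ¬ Irrational y → t ≠ aff w y := by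
    rintro y hy rfl
    exact hy (irrational_aff.1 ht.2)
  exact ⟨lt_of_le_of_ne h0 (key (by simp)).symm, lt_of_le_of_ne h1 (key (by simp))⟩

namespace Dy
variable {p : Equiv.Perm ℝ}

lemma map_mem_X (hp : Dy p) {t : ℝ} (ht : t ∈ X) : p t ∈ X := by
  refine ⟨hp.mem_Ioo_iff.2 ht.1, ?_⟩
  obtain ⟨u, hu, hm⟩ := exists_cell ht (bad p).ncard
  obtain ⟨v, hv⟩ := exists_carries_of_length hp.fin hu.ge
  obtain ⟨y, hy, rfl⟩ := mem_cell_iff.1 hm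
  rw [hv y ⟨hy.1.le, hy.2.le⟩]
  exact irrational_aff.2 (irrational_aff.1 ht.2)

end Dy

/-- Between two points there is the midpoint of a dyadic interval containing both. -/
lemma exists_separating {a b : ℝ} (ha : 0 ≤ a) (hab : a < b) (hb : b ≤ 1) :
    ∃ w, aff w 0 ≤ a ∧ b ≤ aff w 1 ∧ a < mid w ∧ mid w < b := by
  obtain ⟨n, hn⟩ := exists_pow_lt_of_lt_one (sub_pos.2 hab) (by norm_num : (1 / 2 : ℝ) < 1)
  induction n generalizing a b with
  | zero => norm_num at hn; linarith
  | succ n ih =>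
    rw [pow_succ] at hn
    rcases le_or_gt b (1 / 2) with h | h
    · obtain ⟨w, h1, h2, h3, h4⟩ := ih (a := 2 * a) (b := 2 * b) (by linarith) (by linarith)
        (by linarith) (by linarith)
      refine ⟨false :: w, ?_, ?_, ?_, ?_⟩ <;> simp only [mid_cons, aff_cons, cond_false] <;> linarith
    rcases le_or_gt (1 / 2) a with h' | h'
    · obtain ⟨w, h1, h2, h3, h4⟩ := ih (a := 2 * a - 1) (b := 2 * b - 1) (by linarith) (by linarith)
        (by linarith) (by linarith)
      refine ⟨true :: w, ?_, ?_, ?_, ?_⟩ <;> simp only [mid_cons, aff_cons, cond_true] <;> linarith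
    · exact ⟨[], by simpa using ha, by simpa using hb, by simpa [mid] using h',
        by simpa [mid] using h⟩

/-- Points lying in a dyadic interval which `g` expands affinely over itself. -/
def Rep (g : Equiv.Perm ℝ) : Set ℝ :=
  {t | ∃ v x, x ≠ [] ∧ Carries g (v ++ x) v ∧ t ∈ cell (v ++ x)}

section Rep
variable {g : Equiv.Perm ℝ}

lemma inv_mem_cell_of_rep {v x : List Bool} (h : Carries g (v ++ x) v) {t : ℝ} (ht : t ∈ cell v) :
    g⁻¹ t ∈ cell (v ++ x) := h.inv.mem_cell_iff.2 ht

lemma inv_mem_Rep {t : ℝ} (ht : t ∈ Rep g) : g⁻¹ t ∈ Rep g := by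
  obtain ⟨v, x, hx, hc, hm⟩ := ht
  exact ⟨v, x, hx, hc, inv_mem_cell_of_rep hc (cell_append v x hm)⟩

lemma carries_sub {p : Equiv.Perm ℝ} {u v : List Bool} (h : Carries p u v) {s t : ℝ}
    (hs : s ∈ cell u) (ht : t ∈ cell u) :
    (p s - p t) * (1 / 2) ^ u.length = (s - t) * (1 / 2) ^ v.length := by
  obtain ⟨y, hy, rfl⟩ := mem_cell_iff.1 hs
  obtain ⟨z, hz, rfl⟩ := mem_cell_iff.1 ht
  rw [h y ⟨hy.1.le, hy.2.le⟩, h z ⟨hz.1.le, hz.2.le⟩, aff_eq v y, aff_eq v z, aff_eq u y, aff_eq u z]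
  ring

lemma two_mul_dist_le {t : ℝ} (ht : t ∈ Rep g) : 2 * |t - g⁻¹ t| ≤ |g t - t| := by
  obtain ⟨v, x, hx, hc, hm⟩ := ht
  have h := carries_sub hc hm (inv_mem_cell_of_rep hc (cell_append v x hm))
  have hv : (0 : ℝ) < (1 / 2) ^ v.length := by positivity
  rw [List.length_append, pow_add, show g (g⁻¹ t) = t by simp] at h
  have h' : (g t - t) * (1 / 2) ^ x.length = t - g⁻¹ t := by
    apply mul_right_cancel₀ hv.ne'
    linarith
  rw [← h', abs_mul, abs_of_pos (by positivity : (0 : ℝ) < (1 / 2) ^ x.length)]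
  have h1 : ((1 : ℝ) / 2) ^ x.length ≤ 1 / 2 := by
    calc ((1 : ℝ) / 2) ^ x.length ≤ (1 / 2) ^ 1 :=
          pow_le_pow_of_le_one (by norm_num) (by norm_num) (List.length_pos_of_ne_nil hx)
      _ = 1 / 2 := by norm_num
  nlinarith [abs_nonneg (g t - t)]

lemma exists_pow_notMem_Rep {t : ℝ} (ht : g t ≠ t) : ∃ n : ℕ, (g ^ n) t ∉ Rep g := by
  by_contra hcon
  push Not at hcon
  have key : ∀ n : ℕ, 2 ^ n * |g t - t| ≤ |(g ^ (n + 1)) t - (g ^ n) t| := by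
    intro n
    induction n with
    | zero => simp
    | succ n ih =>
      have := two_mul_dist_le (hcon (n + 1))
      have e1 : g⁻¹ ((g ^ (n + 1)) t) = (g ^ n) t := by
        rw [pow_succ', Equiv.Perm.mul_apply]; simp
      have e2 : g ((g ^ (n + 1)) t) = (g ^ (n + 1 + 1)) t := by
        rw [pow_succ' g (n + 1), Equiv.Perm.mul_apply]
      rw [e1, e2] at this
      rw [pow_succ]
      nlinarith
  have hpos : 0 < |g t - t| := abs_pos.2 (sub_ne_zero.2 ht)
  have bound : ∀ n : ℕ, (g ^ n) t ∈ Ioo (0 : ℝ) 1 := by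
    intro n
    obtain ⟨v, x, _, _, hm⟩ := hcon n
    exact cell_subset _ hm
  obtain ⟨n, hn⟩ := pow_unbounded_of_one_lt (1 / |g t - t|) (by norm_num : (1 : ℝ) < 2)
  rw [div_lt_iff₀ hpos] at hn
  have h1 := key n
  have h2 := bound n
  have h3 := bound (n + 1)
  have : |(g ^ (n + 1)) t - (g ^ n) t| ≤ 1 :=
    abs_le.2 ⟨by linarith [h2.2, h3.1], by linarith [h2.1, h3.2]⟩
  linarith

lemma notMem_Rep_inv {t : ℝ} (ht : t ∈ Rep g) : t ∉ Rep g⁻¹ := by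
  obtain ⟨v, x, hx, hc, hm⟩ := ht
  rintro ⟨v', x', hx', hc', hm'⟩
  have hc'' := Carries.inv_iff.1 hc'
  have l1 := List.length_pos_of_ne_nil hx
  have l2 := List.length_pos_of_ne_nil hx'
  rcases prefix_or_prefix_of_mem_cell hm (cell_append _ _ hm') with ⟨y, hy⟩ | ⟨y, hy⟩
  · have h1 := hc.append y
    rw [hy] at h1
    have := congrArg List.length (h1.right_unique hc'')
    have h3 := congrArg List.length hy
    simp only [List.length_append] at this h3
    omega
  · have h1 := hc''.append y
    rw [hy] at h1
    have := congrArg List.length (h1.right_unique hc)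
    have h3 := congrArg List.length hy
    simp only [List.length_append] at this h3
    omega

lemma mem_Rep_of_good {w w' : List Bool} (hc : Carries g w w') {s : ℝ} (hs : s ∈ cell w)
    (hgs : g s ∈ cell w) (hne : g s ≠ s) : s ∈ Rep g ∨ g s ∈ Rep g⁻¹ := by
  have h' : g s ∈ cell w' := hc.mem_cell_iff.2 hs
  rcases prefix_or_prefix_of_mem_cell hgs h' with ⟨x, rfl⟩ | ⟨x, rfl⟩
  · rcases eq_or_ne x [] with rfl | hx
    · obtain ⟨y, hy, rfl⟩ := mem_cell_iff.1 hs
      refine absurd ?_ hne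
      rw [hc y ⟨hy.1.le, hy.2.le⟩, List.append_nil]
    · exact Or.inr ⟨w, x, hx, hc.inv, h'⟩
  · rcases eq_or_ne x [] with rfl | hx
    · obtain ⟨y, hy, rfl⟩ := mem_cell_iff.1 hs
      refine absurd ?_ hne
      rw [hc y ⟨hy.1.le, hy.2.le⟩, List.append_nil]
    · exact Or.inl ⟨w', x, hx, hc, hs⟩

lemma zpow_succ_apply (i : ℤ) (t : ℝ) : (g ^ (i + 1)) t = g ((g ^ i) t) := by
  rw [add_comm, zpow_add, zpow_one, Equiv.Perm.mul_apply]

lemma zpow_add_apply (i j : ℤ) (t : ℝ) : (g ^ (i + j)) t = (g ^ i) ((g ^ j) t) := by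
  rw [zpow_add, Equiv.Perm.mul_apply]

lemma zpow_fixed {a : ℝ} (ha : g a = a) (i : ℤ) : (g ^ i) a = a :=
  Function.IsFixedPt.perm_zpow (e := g) (x := a) ha i

lemma zpow_apply_ne {t : ℝ} (ht : g t ≠ t) (i : ℤ) : g ((g ^ i) t) ≠ (g ^ i) t := by
  rw [← zpow_succ_apply, add_comm, add_comm, zpow_add, zpow_one, Equiv.Perm.mul_apply]
  exact fun h => ht ((g ^ i).injective h)

lemma inv_apply_ne {t : ℝ} (ht : g t ≠ t) : g⁻¹ t ≠ t := by
  rw [Ne, Equiv.Perm.inv_eq_iff_eq]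
  exact ht.symm

/-- The number of steps the orbit of `t` may spend outside both repelling sets. -/
lemma transit_le (hg : Dy g) {t : ℝ} (ht : t ∈ X) (hne : g t ≠ t) {a b : ℝ} (ha : g a = a)
    (hb : g b = b) (hat : a < t) (htb : t < b) {m n : ℤ}
    (h : ∀ j, m ≤ j → j < n → (g ^ j) t ∉ Rep g ∧ (g ^ (j + 1)) t ∉ Rep g⁻¹) :
    n - m ≤ {w ∈ bad g | a < mid w ∧ mid w < b}.ncard := by
  have hX : ∀ j : ℤ, (g ^ j) t ∈ X := fun j => (hg.zpow j).map_mem_X ht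
  have hab : ∀ j : ℤ, a < (g ^ j) t ∧ (g ^ j) t < b := fun j => by
    have h1 := (hg.zpow j).mono hat
    have h2 := (hg.zpow j).mono htb
    rw [zpow_fixed ha] at h1
    rw [zpow_fixed hb] at h2
    exact ⟨h1, h2⟩
  have hfin : {w ∈ bad g | a < mid w ∧ mid w < b}.Finite := hg.fin.subset (sep_subset _ _)
  have fin_of : ∀ φ : ℤ → List Bool,
      (∀ j, m ≤ j → j < n → φ j ∈ bad g ∧ a < mid (φ j) ∧ mid (φ j) < b) →
      (∀ i j, m ≤ i → i < j → j < n → mid (φ i) ≠ mid (φ j)) →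
      n - m ≤ {w ∈ bad g | a < mid w ∧ mid w < b}.ncard := by
    intro φ h1 h2
    have hmaps : MapsTo φ (Finset.Ico m n : Set ℤ) {w ∈ bad g | a < mid w ∧ mid w < b} := by
      intro j hj
      simp only [Finset.coe_Ico, mem_Ico] at hj
      exact h1 j hj.1 hj.2
    have hinj : InjOn φ (Finset.Ico m n : Set ℤ) := by
      intro i hi j hj hij
      simp only [Finset.coe_Ico, mem_Ico] at hi hj
      rcases lt_trichotomy i j with hl | hl | hl
      · exact absurd (congrArg mid hij) (h2 i j hi.1 hl hj.2)
      · exact hl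
      · exact absurd (congrArg mid hij.symm) (h2 j i hj.1 hl hi.2)
    have := ncard_le_ncard_of_injOn φ hmaps hinj hfin
    rw [ncard_coe_finset, Int.card_Ico] at this
    omega
  rcases lt_or_gt_of_ne hne with hlt | hgt
  · have hstep : ∀ j : ℤ, (g ^ (j + 1)) t < (g ^ j) t := fun j => by
      rw [zpow_add_apply, zpow_one]; exact (hg.zpow j).mono hlt
    have hanti : StrictAnti fun j : ℤ => (g ^ j) t := strictAnti_int_of_succ_lt hstep
    choose φ h1 h2 h3 h4 using fun j : ℤ =>
      exists_separating (hX (j + 1)).1.1.le (hstep j) (hX j).1.2.le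
    refine fin_of φ (fun j hj hj' => ⟨?_, (hab _).1.trans (h3 j), (h4 j).trans (hab _).2⟩) ?_
    · intro v hv
      have c1 := mem_cell_of_mem_X (hX (j + 1)) (h1 j) ((hstep j).le.trans (h2 j))
      have c2 := mem_cell_of_mem_X (hX j) ((h1 j).trans (hstep j).le) (h2 j)
      rw [zpow_succ_apply] at c1
      have := mem_Rep_of_good hv c2 c1 (zpow_apply_ne hne j)
      rw [← zpow_succ_apply] at this
      exact this.elim (h j hj hj').1 (h j hj hj').2
    · intro i j _ hij _
      have : (g ^ j) t ≤ (g ^ (i + 1)) t := hanti.antitone (by omega)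
      exact ne_of_gt (by linarith [h4 j, h3 i])
  · have hstep : ∀ j : ℤ, (g ^ j) t < (g ^ (j + 1)) t := fun j => by
      rw [zpow_add_apply, zpow_one]; exact (hg.zpow j).mono hgt
    have hmono : StrictMono fun j : ℤ => (g ^ j) t := strictMono_int_of_lt_succ hstep
    choose φ h1 h2 h3 h4 using fun j : ℤ =>
      exists_separating (hX j).1.1.le (hstep j) (hX (j + 1)).1.2.le
    refine fin_of φ (fun j hj hj' => ⟨?_, (hab _).1.trans (h3 j), (h4 j).trans (hab _).2⟩) ?_
    · intro v hv
      have c1 := mem_cell_of_mem_X (hX (j + 1)) ((h1 j).trans (hstep j).le) (h2 j)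
      have c2 := mem_cell_of_mem_X (hX j) (h1 j) ((hstep j).le.trans (h2 j))
      rw [zpow_succ_apply] at c1
      have := mem_Rep_of_good hv c2 c1 (zpow_apply_ne hne j)
      rw [← zpow_succ_apply] at this
      exact this.elim (h j hj hj').1 (h j hj hj').2
    · intro i j _ hij _
      have : (g ^ (i + 1)) t ≤ (g ^ j) t := hmono.monotone (by omega)
      exact ne_of_lt (by linarith [h4 i, h3 j])

lemma pow_inv_mem_Rep {t : ℝ} (ht : t ∈ Rep g) (n : ℕ) : (g ^ (-(n : ℤ))) t ∈ Rep g := by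
  induction n with
  | zero => simpa using ht
  | succ n ih =>
    have : (-((n + 1 : ℕ) : ℤ)) = -1 + -(n : ℤ) := by push_cast; ring
    rw [this, zpow_add_apply, zpow_neg_one]
    exact inv_mem_Rep ih

lemma zpow_mem_Rep_of_le {t : ℝ} {i j : ℤ} (hij : i ≤ j) (hj : (g ^ j) t ∈ Rep g) :
    (g ^ i) t ∈ Rep g := by
  obtain ⟨n, hn⟩ := Int.eq_ofNat_of_zero_le (sub_nonneg.2 hij)
  have : i = -(n : ℤ) + j := by omega
  rw [this, zpow_add_apply]
  exact pow_inv_mem_Rep hj n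

lemma exists_exit (hg : Dy g) {t : ℝ} (ht : t ∈ X) (hne : g t ≠ t) :
    ∃ e : ℤ, ∀ i : ℤ, (g ^ i) t ∈ Rep g ↔ i < e := by
  obtain ⟨n, hn⟩ := exists_pow_notMem_Rep hne
  have hbd : ∀ z : ℤ, (g ^ z) t ∈ Rep g → z ≤ n := by
    intro z hz
    by_contra hlt
    push Not at hlt
    have := zpow_mem_Rep_of_le hlt.le hz
    rw [zpow_natCast] at this
    exact hn this
  have hex : ∃ z : ℤ, (g ^ z) t ∈ Rep g := by
    by_contra hcon
    push Not at hcon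
    obtain ⟨m, hm⟩ := exists_pow_notMem_Rep (inv_apply_ne hne)
    have hm' : ∀ j : ℤ, j ≤ -(m : ℤ) → (g ^ j) t ∉ Rep g⁻¹ := by
      intro j hj hmem
      apply hm
      have : ((g⁻¹) ^ (-j)) t ∈ Rep g⁻¹ := by simpa using hmem
      have := zpow_mem_Rep_of_le (i := m) (by omega) this
      simpa using this
    have h0 : g 0 = 0 := hg.map_zero
    have h1 : g 1 = 1 := hg.map_one
    have := transit_le hg ht hne h0 h1 ht.1.1 ht.1.2 (n := -(m : ℤ))
      (m := -(m : ℤ) - ({w ∈ bad g | 0 < mid w ∧ mid w < 1}.ncard + 1))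
      (fun j _ hj => ⟨hcon j, hm' _ (by omega)⟩)
    omega
  obtain ⟨e, he, hmax⟩ := Int.exists_greatest_of_bdd ⟨n, hbd⟩ hex
  refine ⟨e + 1, fun i => ⟨fun hi => ?_, fun hi => zpow_mem_Rep_of_le (by omega) he⟩⟩
  have := hmax i hi
  omega

open Classical in
/-- The first time the orbit of `t` is outside the repelling set of `g`. -/
def exit (g : Equiv.Perm ℝ) (t : ℝ) : ℤ :=
  if h : ∃ e : ℤ, ∀ i : ℤ, (g ^ i) t ∈ Rep g ↔ i < e then h.choose else 0

lemma exit_spec (hg : Dy g) {t : ℝ} (ht : t ∈ X) (hne : g t ≠ t) (i : ℤ) :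
    (g ^ i) t ∈ Rep g ↔ i < exit g t := by
  have h := exists_exit hg ht hne
  rw [exit, dif_pos h]
  exact h.choose_spec i

lemma exit_zpow (hg : Dy g) {t : ℝ} (ht : t ∈ X) (hne : g t ≠ t) (n : ℤ) :
    exit g ((g ^ n) t) = exit g t - n := by
  have h1 := exit_spec hg ((hg.zpow n).map_mem_X ht) (zpow_apply_ne hne n)
  have h2 := exit_spec hg ht hne
  have h3 : ∀ i : ℤ, i < exit g ((g ^ n) t) ↔ i + n < exit g t := fun i => by
    rw [← h1, ← h2, zpow_add_apply]
  have a := (h3 (exit g t - n)).not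
  have b := h3 (exit g t - n - 1)
  have c := a.2 (by omega)
  have d := b.2 (by omega)
  omega

lemma exit_inv_spec (hg : Dy g) {t : ℝ} (ht : t ∈ X) (hne : g t ≠ t) (i : ℤ) :
    (g ^ i) t ∈ Rep g⁻¹ ↔ -exit g⁻¹ t < i := by
  have := exit_spec hg.inv ht (inv_apply_ne hne) (-i)
  rw [inv_zpow', neg_neg] at this
  rw [this]; omega

lemma exit_add_exit_inv_le (hg : Dy g) {t : ℝ} (ht : t ∈ X) (hne : g t ≠ t) :
    exit g t + exit g⁻¹ t ≤ 1 := by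
  by_contra hcon
  push Not at hcon
  have h1 := (exit_spec hg ht hne (exit g t - 1)).2 (by omega)
  have h2 := (exit_inv_spec hg ht hne (exit g t - 1)).2 (by omega)
  exact notMem_Rep_inv h1 h2

lemma le_exit_add_exit_inv (hg : Dy g) {t : ℝ} (ht : t ∈ X) (hne : g t ≠ t) {a b : ℝ}
    (ha : g a = a) (hb : g b = b) (hat : a < t) (htb : t < b) :
    -({w ∈ bad g | a < mid w ∧ mid w < b}.ncard : ℤ) ≤ exit g t + exit g⁻¹ t := by
  have := transit_le hg ht hne ha hb hat htb (m := exit g t) (n := -exit g⁻¹ t) fun j h1 h2 =>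
    ⟨fun h => by have := (exit_spec hg ht hne j).1 h; omega,
     fun h => by have := (exit_inv_spec hg ht hne (j + 1)).1 h; omega⟩
  omega

/-- Iterated concatenation of a word with itself. -/
def rp (x : List Bool) : ℕ → List Bool
  | 0 => []
  | n + 1 => x ++ rp x n

lemma rp_succ' (x : List Bool) (n : ℕ) : rp x (n + 1) = rp x n ++ x := by
  induction n with
  | zero => simp [rp]
  | succ n ih => rw [rp, ih, ← List.append_assoc, ← rp, ← ih]

lemma length_rp (x : List Bool) (n : ℕ) : (rp x n).length = n * x.length := by
  induction n with
  | zero => simp [rp]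
  | succ n ih => rw [rp, List.length_append, ih]; ring

lemma carries_rp {v x : List Bool} (h : Carries g (v ++ x) v) (n : ℕ) :
    Carries g (v ++ rp x (n + 1)) (v ++ rp x n) := by
  rw [rp, ← List.append_assoc]
  exact h.append _

lemma carries_pow_rp {v x : List Bool} (h : Carries g (v ++ x) v) (m n : ℕ) :
    Carries (g ^ n) (v ++ rp x (m + n)) (v ++ rp x m) := by
  induction n with
  | zero => simpa using Carries.one _
  | succ n ih =>
    rw [pow_succ]
    exact ih.mul (carries_rp h (m + n))

lemma apply_ne_of_mem_diff {v x : List Bool} (h : Carries g (v ++ x) v) {t : ℝ} (ht : t ∈ cell v)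
    (ht' : t ∉ cell (v ++ x)) : g t ≠ t := by
  intro e
  apply ht'
  have := inv_mem_cell_of_rep h ht
  rwa [Equiv.Perm.inv_eq_iff_eq.2 e.symm] at this

/-- Exit times in a fundamental domain of a repelling interval differ by at most one. -/
lemma exit_le_exit_add_one (hg : Dy g) {Q x : List Bool} (hx : x ≠ []) (hc : Carries g (Q ++ x) Q)
    {s t : ℝ} (hs : s ∈ X) (ht : t ∈ X) (hsQ : s ∈ cell Q) (hsx : s ∉ cell (Q ++ x))
    (htQ : t ∈ cell Q) (htx : t ∉ cell (Q ++ x)) : exit g t ≤ exit g s + 1 := by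
  have hns := apply_ne_of_mem_diff hc hsQ hsx
  have hnt := apply_ne_of_mem_diff hc htQ htx
  have he : 0 ≤ exit g s := by
    have : -1 < exit g s := by
      rw [← exit_spec hg hs hns, zpow_neg_one]
      exact ⟨Q, x, hx, hc, inv_mem_cell_of_rep hc hsQ⟩
    omega
  obtain ⟨k, hk⟩ := Int.eq_ofNat_of_zero_le he
  by_contra hcon
  push Not at hcon
  obtain ⟨v, y, hy, hvy, hm⟩ := (exit_spec hg ht hnt (k + 1)).2 (by omega)
  have c1 := carries_pow_rp hvy 1 (k + 1)
  have e1 : v ++ rp y 1 = v ++ y := by simp [rp]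
  have c1' : t ∈ cell (v ++ rp y (1 + (k + 1))) := by
    rw [← c1.mem_cell_iff, e1, ← zpow_natCast]
    exact_mod_cast hm
  have hle : v ++ rp y (1 + k) <+: v ++ rp y (1 + (k + 1)) := by
    rw [← add_assoc, rp_succ', ← List.append_assoc]
    exact List.prefix_append _ _
  rcases prefix_or_prefix_of_mem_cell (cell_mono hle c1') htQ with hp | ⟨z, hz⟩
  · have c2 := carries_pow_rp hvy 1 k
    have := c2.mem_cell_iff.2 (cell_mono hp hsQ)
    have h3 : (g ^ (k : ℤ)) s ∈ Rep g := by
      rw [zpow_natCast]; rw [e1] at this; exact ⟨v, y, hy, hvy, this⟩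
    have := (exit_spec hg hs hns k).1 h3
    omega
  · have c3 := (carries_rp hvy (1 + k)).inv
    rw [← hz] at c3
    have c4 := c3.right_unique (hc.inv.append z)
    apply htx
    apply cell_append _ z
    rw [← c4]
    exact c1'

end Rep

/-- `h` conjugates `f` to `g`. -/
structure Conj (f g h : Equiv.Perm ℝ) : Prop where
  dyf : Dy f
  dyg : Dy g
  dyh : Dy h
  comm : f * h = h * g

namespace Conj
variable {f g h : Equiv.Perm ℝ}

lemma inv (H : Conj f g h) : Conj f⁻¹ g⁻¹ h :=
  ⟨H.dyf.inv, H.dyg.inv, H.dyh, by rw [inv_mul_eq_iff_eq_mul, ← mul_assoc, H.comm]; group⟩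

lemma eq_conj (H : Conj f g h) : f = h * g * h⁻¹ := by rw [← H.comm]; group

lemma zpow_apply (H : Conj f g h) (n : ℤ) (t : ℝ) : (f ^ n) (h t) = h ((g ^ n) t) := by
  rw [H.eq_conj, conj_zpow]; simp

lemma apply (H : Conj f g h) (t : ℝ) : f (h t) = h (g t) := by
  simpa using H.zpow_apply 1 t

lemma apply_ne (H : Conj f g h) {t : ℝ} (ht : g t ≠ t) : f (h t) ≠ h t := by
  rw [H.apply]
  exact fun e => ht (h.injective e)

lemma apply_eq (H : Conj f g h) {t : ℝ} (ht : g t = t) : f (h t) = h t := by rw [H.apply, ht]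

end Conj

/-- The discrepancy of exit times of corresponding orbits of conjugate maps. -/
def dl (f g h : Equiv.Perm ℝ) (t : ℝ) : ℤ := exit f (h t) - exit g t

section
variable {f g h : Equiv.Perm ℝ}

lemma dl_zpow (H : Conj f g h) {t : ℝ} (ht : t ∈ X) (hne : g t ≠ t) (n : ℤ) :
    dl f g h ((g ^ n) t) = dl f g h t := by
  unfold dl
  rw [← H.zpow_apply, exit_zpow H.dyf (H.dyh.map_mem_X ht) (H.apply_ne hne),
    exit_zpow H.dyg ht hne]
  ring

lemma exists_pow_mem_diff {v x : List Bool} (hx : x ≠ []) (hc : Carries g (v ++ x) v) {s : ℝ}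
    (hs : s ∈ cell v) (hne : g s ≠ s) : ∃ n : ℕ, (g ^ n) s ∈ cell v ∧ (g ^ n) s ∉ cell (v ++ x) := by
  by_contra hcon
  push Not at hcon
  have key : ∀ n : ℕ, (g ^ n) s ∈ cell (v ++ x) := by
    intro n
    induction n with
    | zero => exact hcon 0 (by simpa using hs)
    | succ n ih =>
      apply hcon
      rw [pow_succ', Equiv.Perm.mul_apply, hc.mem_cell_iff]
      exact ih
  obtain ⟨n, hn⟩ := exists_pow_notMem_Rep hne
  exact hn ⟨v, x, hx, hc, key n⟩

lemma exists_zpow_mem_diff {v x : List Bool} (hx : x ≠ []) (hc : Carries g (v ++ x) v) {s : ℝ}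
    (hs : s ∈ cell v) (hne : g s ≠ s) (N : ℕ) :
    ∃ m : ℤ, (g ^ m) s ∈ cell (v ++ rp x N) ∧ (g ^ m) s ∉ cell (v ++ rp x N ++ x) := by
  obtain ⟨n, h1, h2⟩ := exists_pow_mem_diff hx hc hs hne
  have c0 := carries_pow_rp hc 0 N
  have c1 := carries_pow_rp hc 1 N
  have e : (g ^ (-(N : ℤ) + n)) s = (g ^ N)⁻¹ ((g ^ n) s) := by
    rw [zpow_add_apply, zpow_neg, zpow_natCast, zpow_natCast]
  refine ⟨-(N : ℤ) + n, ?_, ?_⟩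
  · rw [zero_add] at c0
    rw [e, ← c0.mem_cell_iff]
    simpa [rp] using h1
  · rw [e, List.append_assoc, ← rp_succ', add_comm, ← c1.mem_cell_iff]
    simpa [rp] using h2

/-- The discrepancy varies by at most two inside a repelling interval. -/
lemma abs_dl_sub_le_of_rep (H : Conj f g h) {v x : List Bool} (hx : x ≠ [])
    (hc : Carries g (v ++ x) v) {s t : ℝ} (hs : s ∈ X) (ht : t ∈ X) (hsv : s ∈ cell v)
    (htv : t ∈ cell v) (hns : g s ≠ s) (hnt : g t ≠ t) : |dl f g h s - dl f g h t| ≤ 2 := by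
  set N := (bad h).ncard
  obtain ⟨m, m1, m2⟩ := exists_zpow_mem_diff hx hc hsv hns N
  obtain ⟨n, n1, n2⟩ := exists_zpow_mem_diff hx hc htv hnt N
  have hlen : N ≤ (v ++ rp x N).length := by
    rw [List.length_append, length_rp]
    have := List.length_pos_of_ne_nil hx
    nlinarith
  obtain ⟨Q', hQ⟩ := exists_carries_of_length H.dyh.fin hlen
  set Q := v ++ rp x N
  have hcQ : Carries g (Q ++ x) Q := by
    have := carries_rp hc N
    rwa [rp_succ', ← List.append_assoc] at this
  have hcQ' : Carries f (Q' ++ x) Q' := by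
    rw [H.eq_conj]
    exact (hQ.mul hcQ).mul (hQ.append x).inv
  rw [← dl_zpow H hs hns m, ← dl_zpow H ht hnt n]
  have hs' := (H.dyg.zpow m).map_mem_X hs
  have ht' := (H.dyg.zpow n).map_mem_X ht
  generalize (g ^ m) s = s' at *
  generalize (g ^ n) t = t' at *
  have a1 := exit_le_exit_add_one H.dyg hx hcQ hs' ht' m1 m2 n1 n2
  have a2 := exit_le_exit_add_one H.dyg hx hcQ ht' hs' n1 n2 m1 m2
  have f1 : h s' ∈ cell Q' := hQ.mem_cell_iff.2 m1
  have f2 : h t' ∈ cell Q' := hQ.mem_cell_iff.2 n1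
  have f3 : h s' ∉ cell (Q' ++ x) := fun e => m2 ((hQ.append x).mem_cell_iff.1 e)
  have f4 : h t' ∉ cell (Q' ++ x) := fun e => n2 ((hQ.append x).mem_cell_iff.1 e)
  have a3 := exit_le_exit_add_one H.dyf hx hcQ' (H.dyh.map_mem_X hs') (H.dyh.map_mem_X ht')
    f1 f3 f2 f4
  have a4 := exit_le_exit_add_one H.dyf hx hcQ' (H.dyh.map_mem_X ht') (H.dyh.map_mem_X hs')
    f2 f4 f1 f3
  rw [abs_le]
  unfold dl
  constructor <;> omega

lemma inv_zpow_mem_cell {v x : List Bool} (hc : Carries g (v ++ x) v) {s : ℝ}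
    (hs : s ∈ cell (v ++ x)) (n : ℕ) : (g ^ (-(n : ℤ))) s ∈ cell (v ++ x) := by
  induction n with
  | zero => simpa using hs
  | succ n ih =>
    have : (-((n + 1 : ℕ) : ℤ)) = -1 + -(n : ℤ) := by push_cast; ring
    rw [this, zpow_add_apply, zpow_neg_one]
    exact inv_mem_cell_of_rep hc (cell_append _ _ ih)

lemma cell_ordConnected (u : List Bool) : (cell u).OrdConnected := ordConnected_Ioo

lemma abs_dl_sub_le_of_between (H : Conj f g h) {s t : ℝ} (hs : s ∈ X) (ht : t ∈ X) (hns : g s ≠ s)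
    (hnt : g t ≠ t) {k : ℕ} (hk : s ∈ uIcc t ((g ^ (-(k : ℤ))) t)) :
    |dl f g h s - dl f g h t| ≤ 2 := by
  obtain ⟨v, x, hx, hc, hm⟩ := (exit_spec H.dyg ht hnt (exit g t - 1)).2 (by omega)
  set m := exit g t - 1
  have h2 := inv_zpow_mem_cell hc hm k
  rw [← zpow_add_apply, add_comm, zpow_add_apply] at h2
  have h3 : (g ^ m) s ∈ uIcc ((g ^ m) t) ((g ^ m) ((g ^ (-(k : ℤ))) t)) := by
    have hmono := (H.dyg.zpow m).mono.monotone
    rw [mem_uIcc] at hk ⊢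
    exact hk.imp (fun h => ⟨hmono h.1, hmono h.2⟩) (fun h => ⟨hmono h.1, hmono h.2⟩)
  have h4 : (g ^ m) s ∈ cell (v ++ x) := (cell_ordConnected _).uIcc_subset hm h2 h3
  rw [← dl_zpow H hs hns m, ← dl_zpow H ht hnt m]
  exact abs_dl_sub_le_of_rep H hx hc ((H.dyg.zpow m).map_mem_X hs) ((H.dyg.zpow m).map_mem_X ht)
    (cell_append _ _ h4) (cell_append _ _ hm) (zpow_apply_ne hns m) (zpow_apply_ne hnt m)

lemma exists_lt_pow (hg : Dy g) {s t : ℝ} (hs : s < g s)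
    (hfix : ∀ x ∈ Icc s t, g x ≠ x) : ∃ k : ℕ, t < (g ^ k) s := by
  by_contra hcon
  push Not at hcon
  have hbdd : BddAbove (range fun n : ℕ => (g ^ n) s) := ⟨t, by rintro _ ⟨n, rfl⟩; exact hcon n⟩
  have hL := isLUB_ciSup hbdd
  set L := ⨆ n : ℕ, (g ^ n) s
  have h1 : ∀ n : ℕ, (g ^ n) s ≤ L := fun n => hL.1 ⟨n, rfl⟩
  have h2 : s ≤ L := by simpa using h1 0
  have h3 : L ≤ t := hL.2 (by rintro _ ⟨n, rfl⟩; exact hcon n)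
  apply hfix L ⟨h2, h3⟩
  apply le_antisymm
  · by_contra hlt
    push Not at hlt
    have h4 : g⁻¹ L < L := by
      have := hg.inv.mono hlt
      simpa using this
    obtain ⟨_, ⟨n, rfl⟩, hn⟩ := (lt_isLUB_iff hL).1 h4
    have := hg.mono hn
    have h5 := h1 (n + 1)
    rw [pow_succ', Equiv.Perm.mul_apply] at h5
    simp at this
    linarith
  · refine hL.2 ?_
    rintro _ ⟨n, rfl⟩
    calc (g ^ n) s ≤ (g ^ n) (g s) := (hg.pow n).mono.monotone hs.le
      _ = g ((g ^ n) s) := by rw [← Equiv.Perm.mul_apply, ← pow_succ, pow_succ', Equiv.Perm.mul_apply]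
      _ ≤ g L := hg.mono.monotone (h1 n)

lemma abs_dl_sub_le_of_lt (H : Conj f g h) {s t : ℝ} (hs : s ∈ X) (ht : t ∈ X) (hst : s ≤ t)
    (hfix : ∀ x ∈ Icc s t, g x ≠ x) : |dl f g h s - dl f g h t| ≤ 2 := by
  have hns := hfix s ⟨le_rfl, hst⟩
  have hnt := hfix t ⟨hst, le_rfl⟩
  rcases lt_or_gt_of_ne hns with hlt | hgt
  · have h1 : s < g⁻¹ s := by
      have := H.dyg.inv.mono hlt
      simpa using this
    have hfix' : ∀ x ∈ Icc s t, g⁻¹ x ≠ x := fun x hx => inv_apply_ne (hfix x hx)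
    obtain ⟨k, hk⟩ := exists_lt_pow H.dyg.inv h1 hfix'
    rw [abs_sub_comm]
    refine abs_dl_sub_le_of_between H ht hs hnt hns (k := k) ?_
    rw [mem_uIcc, zpow_neg, zpow_natCast, ← inv_pow]
    exact Or.inl ⟨hst, hk.le⟩
  · obtain ⟨k, hk⟩ := exists_lt_pow H.dyg hgt hfix
    refine abs_dl_sub_le_of_between H hs ht hns hnt (k := k) ?_
    rw [mem_uIcc, zpow_neg, zpow_natCast]
    refine Or.inr ⟨?_, hst⟩
    have := (H.dyg.pow k).inv.mono hk
    have e : (g ^ k)⁻¹ ((g ^ k) s) = s := by simp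
    exact (this.trans_eq e).le

lemma abs_dl_sub_le_of_cross (H : Conj f g h) {s t a : ℝ} (hs : s ∈ X) (ht : t ∈ X)
    {M M' : List Bool} (hM : Carries g M M') (hsM : s ∈ cell M) (htM : t ∈ cell M) (haM : a ∈ cell M)
    (ha : g a = a) (hns : g s ≠ s) (hnt : g t ≠ t) :
    |dl f g h s - dl f g h t| ≤ 2 ∨ |dl f⁻¹ g⁻¹ h s - dl f⁻¹ g⁻¹ h t| ≤ 2 := by
  have haM' : a ∈ cell M' := by rw [← ha]; exact hM.mem_cell_iff.2 haM
  have hne : M ≠ M' := by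
    rintro rfl
    obtain ⟨y, hy, rfl⟩ := mem_cell_iff.1 hsM
    exact hns (hM y ⟨hy.1.le, hy.2.le⟩)
  rcases prefix_or_prefix_of_mem_cell haM haM' with ⟨x, rfl⟩ | ⟨x, rfl⟩
  · right
    exact abs_dl_sub_le_of_rep H.inv (by rintro rfl; simp at hne) hM.inv hs ht hsM htM
      (inv_apply_ne hns) (inv_apply_ne hnt)
  · left
    exact abs_dl_sub_le_of_rep H (by rintro rfl; simp at hne) hM hs ht (cell_append _ _ hsM)
      (cell_append _ _ htM) hns hnt

lemma abs_dl_add_dl_inv_le (H : Conj f g h) {t a b : ℝ} (ht : t ∈ X) (hne : g t ≠ t)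
    (ha : g a = a) (hb : g b = b) (hat : a < t) (htb : t < b) :
    |dl f g h t + dl f⁻¹ g⁻¹ h t| ≤ 1 + {w ∈ bad g | a < mid w ∧ mid w < b}.ncard +
      {w ∈ bad f | h a < mid w ∧ mid w < h b}.ncard := by
  have a1 := exit_add_exit_inv_le H.dyg ht hne
  have a2 := le_exit_add_exit_inv H.dyg ht hne ha hb hat htb
  have a3 := exit_add_exit_inv_le H.dyf (H.dyh.map_mem_X ht) (H.apply_ne hne)
  have a4 := le_exit_add_exit_inv H.dyf (H.dyh.map_mem_X ht) (H.apply_ne hne) (H.apply_eq ha)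
    (H.apply_eq hb) (H.dyh.mono hat) (H.dyh.mono htb)
  rw [abs_le]
  unfold dl
  constructor <;> omega

/-- A maximal interval without interior fixed points. -/
structure Bump (g : Equiv.Perm ℝ) (a b : ℝ) : Prop where
  nonneg : 0 ≤ a
  lt : a < b
  le_one : b ≤ 1
  left : g a = a
  right : g b = b
  ne : ∀ x, a < x → x < b → g x ≠ x

lemma isLUB_fixed (hg : Dy g) {S : Set ℝ} {L : ℝ} (hL : IsLUB S L)
    (hS : ∀ x ∈ S, g x = x) : g L = L := by
  apply le_antisymm
  · by_contra hlt
    push Not at hlt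
    have h4 : g⁻¹ L < L := by
      have := hg.inv.mono hlt
      simpa using this
    obtain ⟨p, hp, hlp⟩ := (lt_isLUB_iff hL).1 h4
    have := hg.mono hlp
    rw [hS p hp] at this
    simp at this
    exact absurd (hL.1 hp) (not_le.2 this)
  · refine hL.2 fun x hx => ?_
    rw [← hS x hx]
    exact hg.mono.monotone (hL.1 hx)

lemma isGLB_fixed (hg : Dy g) {S : Set ℝ} {L : ℝ} (hL : IsGLB S L)
    (hS : ∀ x ∈ S, g x = x) : g L = L := by
  apply le_antisymm
  · refine hL.2 fun x hx => ?_
    rw [← hS x hx]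
    exact hg.mono.monotone (hL.1 hx)
  · by_contra hlt
    push Not at hlt
    have h4 : L < g⁻¹ L := by
      have := hg.inv.mono hlt
      simpa using this
    obtain ⟨p, hp, hlp⟩ := (isGLB_lt_iff hL).1 h4
    have := hg.mono hlp
    rw [hS p hp] at this
    simp at this
    exact absurd (hL.1 hp) (not_le.2 this)

lemma exists_bump (hg : Dy g) {t : ℝ} (ht : t ∈ Ioo (0 : ℝ) 1) (hne : g t ≠ t) :
    ∃ a b, Bump g a b ∧ a < t ∧ t < b := by
  set S := {x | g x = x ∧ x ≤ t}
  set T := {x | g x = x ∧ t ≤ x}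
  have hS : S.Nonempty := ⟨0, hg.map_zero, ht.1.le⟩
  have hT : T.Nonempty := ⟨1, hg.map_one, ht.2.le⟩
  have hS' : IsLUB S (sSup S) := isLUB_csSup hS ⟨t, fun x hx => hx.2⟩
  have hT' : IsGLB T (sInf T) := isGLB_csInf hT ⟨t, fun x hx => hx.2⟩
  have ha := isLUB_fixed hg hS' fun x hx => hx.1
  have hb := isGLB_fixed hg hT' fun x hx => hx.1
  have hat : sSup S < t := lt_of_le_of_ne (hS'.2 fun x hx => hx.2) (by
    intro e; rw [e] at ha; exact hne ha)
  have htb : t < sInf T := lt_of_le_of_ne (hT'.2 fun x hx => hx.2) (by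
    intro e; rw [← e] at hb; exact hne hb)
  refine ⟨_, _, ⟨hS'.1 ⟨hg.map_zero, ht.1.le⟩, hat.trans htb, hT'.1 ⟨hg.map_one, ht.2.le⟩, ha, hb,
    ?_⟩, hat, htb⟩
  intro x h1 h2 e
  rcases le_total x t with h | h
  · exact absurd (hS'.1 ⟨e, h⟩) (not_le.2 h1)
  · exact absurd (hT'.1 ⟨e, h⟩) (not_le.2 h2)

lemma carries_self_of_fixed {p : Equiv.Perm ℝ} {u v : List Bool} (hc : Carries p u v) {a b : ℝ}
    (hab : a ≠ b) (ha : a ∈ Icc (aff u 0) (aff u 1)) (hb : b ∈ Icc (aff u 0) (aff u 1))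
    (hpa : p a = a) (hpb : p b = b) : u = v := by
  have hp : (0 : ℝ) < (1 / 2) ^ u.length := by positivity
  have key : ∀ c ∈ Icc (aff u 0) (aff u 1), ∃ y ∈ Icc (0 : ℝ) 1, c = aff u y := by
    rintro c ⟨h0, h1⟩
    rw [aff_one] at h1
    refine ⟨(c - aff u 0) / (1 / 2) ^ u.length, ⟨?_, ?_⟩, ?_⟩
    · exact div_nonneg (by linarith) hp.le
    · rw [div_le_one hp]; linarith
    · rw [aff_eq u, div_mul_cancel₀ _ hp.ne']; ring
  obtain ⟨y, hy, rfl⟩ := key a ha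
  obtain ⟨z, hz, rfl⟩ := key b hb
  have hyz : y ≠ z := fun e => hab (by rw [e])
  rw [hc y hy] at hpa
  rw [hc z hz] at hpb
  apply aff_injective
  intro t _
  rw [aff_eq v y, aff_eq u y] at hpa
  rw [aff_eq v z, aff_eq u z] at hpb
  have h1 : (y - z) * ((1 / 2 : ℝ) ^ v.length - (1 / 2) ^ u.length) = 0 := by linarith
  have h2 : ((1 : ℝ) / 2) ^ v.length - (1 / 2) ^ u.length = 0 :=
    (mul_eq_zero.1 h1).resolve_left (sub_ne_zero.2 hyz)
  rw [aff_eq u t, aff_eq v t]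
  have h3 : ((1 : ℝ) / 2) ^ v.length = (1 / 2) ^ u.length := by linarith
  rw [h3] at hpa ⊢
  linarith

lemma Carries.fixed {p : Equiv.Perm ℝ} {u : List Bool} (hc : Carries p u u) {t : ℝ}
    (h0 : aff u 0 ≤ t) (h1 : t ≤ aff u 1) : p t = t := by
  have hp : (0 : ℝ) < (1 / 2) ^ u.length := by positivity
  rw [aff_one] at h1
  have e : t = aff u ((t - aff u 0) / (1 / 2) ^ u.length) := by
    rw [aff_eq u, div_mul_cancel₀ _ hp.ne']; ring
  rw [e]
  apply hc
  exact ⟨div_nonneg (by linarith) hp.le, by rw [div_le_one hp]; linarith⟩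

/-- Bad words with midpoint to the left of `x`. -/
def cnt (g : Equiv.Perm ℝ) (x : ℝ) : ℕ := {w ∈ bad g | mid w < x}.ncard

lemma cnt_add_le (hg : Dy g) {a b : ℝ} (hab : a ≤ b) :
    cnt g a + {w ∈ bad g | a < mid w ∧ mid w < b}.ncard ≤ cnt g b := by
  have fin : ∀ P : List Bool → Prop, {w ∈ bad g | P w}.Finite := fun P =>
    hg.fin.subset (sep_subset _ _)
  have hd : Disjoint {w ∈ bad g | mid w < a} {w ∈ bad g | a < mid w ∧ mid w < b} := by
    rw [Set.disjoint_left]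
    rintro w ⟨_, h1⟩ ⟨_, h2, _⟩
    linarith
  unfold cnt
  rw [← ncard_union_eq hd (fin _) (fin _)]
  refine ncard_le_ncard ?_ (fin _)
  rintro w (⟨h1, h2⟩ | ⟨h1, h2, h3⟩)
  exacts [⟨h1, by linarith⟩, ⟨h1, h3⟩]

lemma cnt_le (hg : Dy g) (x : ℝ) : cnt g x ≤ (bad g).ncard := ncard_le_ncard (sep_subset _ _) hg.fin

lemma cnt_lt (hg : Dy g) {a b : ℝ} (hb : Bump g a b) : cnt g a < cnt g b := by
  obtain ⟨w, h1, h2, h3, h4⟩ := exists_separating hb.nonneg hb.lt hb.le_one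
  have hw : w ∈ bad g := by
    intro v hv
    have := carries_self_of_fixed hv hb.lt.ne ⟨h1, hb.lt.le.trans h2⟩ ⟨h1.trans hb.lt.le, h2⟩
      hb.left hb.right
    subst this
    exact hb.ne _ h3 h4 (hv.fixed (h1.trans h3.le) (h4.le.trans h2))
  have h5 := cnt_add_le hg hb.lt.le
  have h6 : 0 < {w ∈ bad g | a < mid w ∧ mid w < b}.ncard := by
    rw [ncard_pos (hg.fin.subset (sep_subset _ _))]
    exact ⟨w, hw, h3, h4⟩
  omega

/-- The fixed points around which `g` need not be affine. -/
def crit (g : Equiv.Perm ℝ) : Set ℝ := insert 0 (Set.image mid (bad g))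

lemma crit_finite (hg : Dy g) : (crit g).Finite := (hg.fin.image mid).insert 0

lemma exists_good_cell (hg : Dy g) {a : ℝ} (ha : a ∈ Ioo (0 : ℝ) 1) (hac : a ∉ crit g) :
    ∃ M M', Carries g M M' ∧ a ∈ cell M := by
  rcases exists_cell_or_mid (bad g).ncard ha with ⟨u, hu, hm⟩ | ⟨w, rfl⟩
  · obtain ⟨v, hv⟩ := exists_carries_of_length hg.fin hu.ge
    exact ⟨u, v, hv, hm⟩
  · obtain ⟨v, hv⟩ := not_mem_bad.1 fun hw => hac (mem_insert_of_mem _ ⟨w, hw, rfl⟩)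
    exact ⟨w, v, hv, mid_mem_cell w⟩

/-- If the discrepancy vanishes somewhere in each bump starting at a critical point, then it is
linearly bounded everywhere. -/
lemma abs_dl_le (H : Conj f g h)
    (h0 : ∀ a b, Bump g a b → a ∈ crit g → ∃ t ∈ X, a < t ∧ t < b ∧ dl f g h t = 0)
    {a b : ℝ} (hab : Bump g a b) {t : ℝ} (ht : t ∈ X) (hat : a < t) (htb : t < b) :
    |dl f g h t| ≤ 6 * (cnt g b + cnt f (h b)) + 3 ∧
      |dl f⁻¹ g⁻¹ h t| ≤ 6 * (cnt g b + cnt f (h b)) + 3 := by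
  induction hn : cnt g b using Nat.strong_induction_on generalizing a b t with
  | _ k ih =>
  subst hn
  have same : ∀ {s t : ℝ}, s ∈ X → t ∈ X → a < s → s < b → a < t → t < b →
      |dl f g h s - dl f g h t| ≤ 2 ∧ |dl f⁻¹ g⁻¹ h s - dl f⁻¹ g⁻¹ h t| ≤ 2 := by
    intro s t hs ht h1 h2 h3 h4
    wlog hst : s ≤ t generalizing s t
    · rw [abs_sub_comm, abs_sub_comm (dl f⁻¹ g⁻¹ h s)]
      exact this ht hs h3 h4 h1 h2 (le_of_not_ge hst)
    have hfix : ∀ x ∈ Icc s t, g x ≠ x := fun x hx => hab.ne x (by linarith [hx.1])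
      (by linarith [hx.2])
    exact ⟨abs_dl_sub_le_of_lt H hs ht hst hfix,
      abs_dl_sub_le_of_lt H.inv hs ht hst fun x hx => inv_apply_ne (hfix x hx)⟩
  have hsum := abs_dl_add_dl_inv_le H ht (hab.ne t hat htb) hab.left hab.right hat htb
  have hlt := cnt_lt H.dyg hab
  have hga := cnt_add_le H.dyg hab.lt.le
  have hfa := cnt_add_le H.dyf (H.dyh.mono hab.lt).le
  by_cases hac : a ∈ crit g
  · obtain ⟨s, hs, h1, h2, h3⟩ := h0 a b hab hac
    have h4 := (same hs ht h1 h2 hat htb).1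
    rw [h3] at h4
    rw [abs_le] at *
    rw [abs_le]
    constructor <;> constructor <;> omega
  · have ha0 : 0 < a := lt_of_le_of_ne hab.nonneg fun e => hac (by rw [← e]; exact mem_insert _ _)
    have ha1 : a < 1 := hab.lt.trans_le hab.le_one
    obtain ⟨M, M', hM, haM⟩ := exists_good_cell H.dyg ⟨ha0, ha1⟩ hac
    have hM1 : 0 ≤ aff M 0 := (aff_mem_Icc M (by simp)).1
    have hM2 : aff M 1 ≤ 1 := (aff_mem_Icc M (by simp)).2
    obtain ⟨s, hs, s1, s2⟩ := exists_mem_X hM1 haM.1 ha1.le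
    obtain ⟨r, hr, r1, r2⟩ := exists_mem_X ha0.le (lt_min hab.lt haM.2) ((min_le_right _ _).trans hM2)
    have r3 := r2.trans_le (min_le_left _ _)
    have r4 := r2.trans_le (min_le_right _ _)
    have hrM : r ∈ cell M := ⟨haM.1.trans r1, r4⟩
    have hsM : s ∈ cell M := ⟨s1, s2.trans haM.2⟩
    have hnr := hab.ne r r1 r3
    have uniq : ∀ x ∈ cell M, x ≠ a → g x ≠ x := by
      intro x hx hxa e
      have := carries_self_of_fixed hM hxa ⟨hx.1.le, hx.2.le⟩ ⟨haM.1.le, haM.2.le⟩ e hab.left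
      subst this
      exact hnr (hM.fixed hrM.1.le hrM.2.le)
    have hns := uniq s hsM s2.ne
    obtain ⟨a', b', hab', h1, h2⟩ := exists_bump H.dyg hs.1 hns
    have hb' : b' = a := by
      by_contra hne
      rcases lt_or_gt_of_ne hne with hlt | hgt
      · exact uniq b' ⟨s1.trans h2, hlt.trans haM.2⟩ hne hab'.right
      · exact hab'.ne a (h1.trans s2) hgt hab.left
    subst hb'
    obtain ⟨i1, i2⟩ := ih _ hlt hab' hs h1 h2 rfl
    obtain ⟨j1, j2⟩ := same hr ht r1 r3 hat htb
    rcases abs_dl_sub_le_of_cross H hs hr hM hsM hrM haM hab.left hns hnr with hc | hc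
    · rw [abs_le] at *
      rw [abs_le]
      constructor <;> constructor <;> omega
    · rw [abs_le] at *
      rw [abs_le]
      constructor <;> constructor <;> omega

end

/-- The permutation equal to `p` to the left of `e` and to `q` to the right of it. -/
def glue (p q : Equiv.Perm ℝ) (e : ℝ) (hp : StrictMono p) (hq : StrictMono q) (he : p e = q e) :
    Equiv.Perm ℝ where
  toFun t := if t < e then p t else q t
  invFun s := if s < p e then p⁻¹ s else q⁻¹ s
  left_inv t := by
    by_cases h : t < e
    · simp [h, hp h]
    · have : ¬ q t < p e := by rw [he, hq.lt_iff_lt]; exact h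
      simp [h, this]
  right_inv s := by
    by_cases h : s < p e
    · have : p⁻¹ s < e := by rw [← hp.lt_iff_lt]; simpa using h
      change (if (if s < p e then p⁻¹ s else q⁻¹ s) < e then p _ else _) = s
      rw [if_pos h, if_pos this]
      beta_reduce
      rw [if_pos h]
      simp
    · have : ¬ q⁻¹ s < e := by rw [← hq.lt_iff_lt, ← he]; simpa using h
      change (if (if s < p e then p⁻¹ s else q⁻¹ s) < e then _ else q _) = s
      rw [if_neg h, if_neg this]
      beta_reduce
      rw [if_neg h]
      simp

section Glue
variable {p q : Equiv.Perm ℝ} {e : ℝ} {hp : StrictMono p} {hq : StrictMono q} {he : p e = q e}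

lemma glue_apply (t : ℝ) : glue p q e hp hq he t = if t < e then p t else q t := rfl

lemma glue_of_le {t : ℝ} (ht : t ≤ e) : glue p q e hp hq he t = p t := by
  rw [glue_apply]
  split_ifs with h
  · rfl
  · rw [le_antisymm ht (not_lt.1 h), he]

lemma glue_of_ge {t : ℝ} (ht : e ≤ t) : glue p q e hp hq he t = q t := by
  rw [glue_apply, if_neg (not_lt.2 ht)]

/-- The words whose open dyadic interval contains `e`. -/
def straddle (e : ℝ) : Set (List Bool) := {w | e ∈ cell w}

lemma aff_mem (w : List Bool) {t : ℝ} (ht : t ∈ Icc (0 : ℝ) 1) : aff w 0 ≤ aff w t ∧ aff w t ≤ aff w 1 :=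
  ⟨(aff_strictMono w).monotone ht.1, (aff_strictMono w).monotone ht.2⟩

lemma bad_glue : bad (glue p q e hp hq he) ⊆
    {w ∈ bad p | aff w 1 ≤ e} ∪ {w ∈ bad q | e ≤ aff w 0} ∪ straddle e := by
  intro w hw
  by_cases h1 : aff w 1 ≤ e
  · refine Or.inl (Or.inl ⟨fun v hv => hw v fun t ht => ?_, h1⟩)
    rw [glue_of_le ((aff_mem w ht).2.trans h1), hv t ht]
  by_cases h2 : e ≤ aff w 0
  · refine Or.inl (Or.inr ⟨fun v hv => hw v fun t ht => ?_, h2⟩)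
    rw [glue_of_ge (h2.trans (aff_mem w ht).1), hv t ht]
  · exact Or.inr ⟨not_le.1 h2, not_le.1 h1⟩

lemma prefix_of_mid_mem_cell {w u : List Bool} (h : mid w ∈ cell u) : u <+: w := by
  rcases prefix_or_prefix_of_mem_cell h (mid_mem_cell w) with h' | ⟨y, rfl⟩
  · exact h'
  · match y with
    | [] => simp
    | b :: y =>
      exfalso
      have h2 : mid w ∈ cell (w ++ [b]) := cell_mono ⟨y, by simp⟩ h
      obtain ⟨z, hz, e⟩ := mem_cell_iff.1 h2
      rw [aff_append] at e
      have := (aff_strictMono w).injective e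
      simp only [aff_cons, aff_nil] at this
      cases b <;> simp at this <;> linarith [hz.1, hz.2]

lemma straddle_zero : straddle 0 = ∅ := by
  ext w
  simp only [straddle, mem_ofPred_eq, mem_empty_iff_false, iff_false]
  intro h
  exact absurd (cell_subset w h).1 (lt_irrefl _)

lemma straddle_one : straddle 1 = ∅ := by
  ext w
  simp only [straddle, mem_ofPred_eq, mem_empty_iff_false, iff_false]
  intro h
  exact absurd (cell_subset w h).2 (lt_irrefl _)

lemma straddle_mid {g : Equiv.Perm ℝ} {w : List Bool} (hw : w ∈ bad g) :
    straddle (mid w) ⊆ bad g := fun _ hu => bad_of_initial (prefix_of_mid_mem_cell hu) hw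

lemma straddle_crit {g : Equiv.Perm ℝ} {e : ℝ} (h : e ∈ crit g) : straddle e ⊆ bad g := by
  rcases h with rfl | ⟨w, hw, rfl⟩
  · simp [straddle_zero]
  · exact straddle_mid hw

lemma glue_mem (hp' : p ∈ ThompsonF) (hq' : q ∈ ThompsonF) (hs : (straddle e).Finite) :
    glue p q e hp hq he ∈ ThompsonF := by
  have h1 := dy_of_mem hp'
  have h2 := dy_of_mem hq'
  refine (mem_and_wordLength_le (((h1.fin.subset (sep_subset _ _)).union
    (h2.fin.subset (sep_subset _ _))).union hs |>.subset bad_glue) ?_).1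
  intro t ht
  rw [glue_apply]
  split_ifs
  exacts [h1.fix t ht, h2.fix t ht]

end Glue

lemma mem_of_dy {p : Equiv.Perm ℝ} (hp : Dy p) : p ∈ ThompsonF :=
  (mem_and_wordLength_le hp.fin hp.fix).1

section
variable {f g h : Equiv.Perm ℝ}

lemma Bump.right_unique {a b c : ℝ} (h1 : Bump g a b) (h2 : Bump g a c) : b = c := by
  rcases lt_trichotomy b c with h | h | h
  · exact absurd h1.right (h2.ne b h1.lt h)
  · exact h
  · exact absurd h2.right (h1.ne c h2.lt h)

/-- The discrepancy vanishes somewhere in every bump starting at a point of `s`. -/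
def Normalized (f g h : Equiv.Perm ℝ) (s : Set ℝ) : Prop :=
  ∀ a b, Bump g a b → a ∈ s → ∃ t ∈ X, a < t ∧ t < b ∧ dl f g h t = 0

lemma exists_normalized_finset (H : Conj f g h) (s : Finset ℝ) (hs : (s : Set ℝ) ⊆ crit g) :
    ∃ h', Conj f g h' ∧ Normalized f g h' s := by
  induction s using Finset.induction_on_max with
  | empty => exact ⟨h, H, fun a b _ ha => by simp at ha⟩
  | insert e s hmax ih =>
    rw [Finset.coe_insert, insert_subset_iff] at hs
    obtain ⟨h', H', hn⟩ := ih hs.2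
    by_cases hb : ∃ b, Bump g e b
    · obtain ⟨b, hb⟩ := hb
      obtain ⟨t, ht, h1, h2⟩ := exists_mem_X hb.nonneg hb.lt hb.le_one
      have hnt := hb.ne t h1 h2
      set k := dl f g h' t
      have hgk := zpow_fixed hb.left k
      have heq : (1 : Equiv.Perm ℝ) e = (g ^ k) e := by rw [hgk]; rfl
      let z := glue 1 (g ^ k) e Dy.one.mono (H.dyg.zpow k).mono heq
      have hz : z ∈ ThompsonF := glue_mem (one_mem _) (zpow_mem (mem_of_dy H.dyg) k)
        (H.dyg.fin.subset (straddle_crit hs.1))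
      have hz1 : ∀ x, x ≤ e → z x = x := fun x hx => glue_of_le hx
      have hz2 : ∀ x, e ≤ x → z x = (g ^ k) x := fun x hx => glue_of_ge hx
      have hzg : g * z = z * g := by
        ext x
        rw [Equiv.Perm.mul_apply, Equiv.Perm.mul_apply]
        have hm := H.dyg.mono.monotone
        rcases le_total x e with hx | hx
        · rw [hz1 x hx, hz1 (g x) (by rw [← hb.left]; exact hm hx)]
        · rw [hz2 x hx, hz2 (g x) (by rw [← hb.left]; exact hm hx), ← zpow_succ_apply,
            zpow_add_apply, zpow_one]
      refine ⟨h' * z, ⟨H'.dyf, H'.dyg, H'.dyh.mul (dy_of_mem hz), ?_⟩, ?_⟩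
      · rw [← mul_assoc, H'.comm, mul_assoc, hzg, mul_assoc]
      · intro a c hac ha
        rw [Finset.coe_insert] at ha
        rcases ha with rfl | ha
        · have := hac.right_unique hb
          subst this
          refine ⟨t, ht, h1, h2, ?_⟩
          unfold dl
          rw [Equiv.Perm.mul_apply, hz2 t h1.le, ← H'.zpow_apply, exit_zpow H'.dyf
            (H'.dyh.map_mem_X ht) (H'.apply_ne hnt)]
          simp only [k, dl]
          ring
        · obtain ⟨r, hr, r1, r2, r3⟩ := hn a c hac ha
          refine ⟨r, hr, r1, r2, ?_⟩
          have hce : c ≤ e := by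
            by_contra hlt
            exact hac.ne e (hmax a ha) (not_le.1 hlt) hb.left
          unfold dl
          rw [Equiv.Perm.mul_apply, hz1 r (r2.le.trans hce)]
          exact r3
    · refine ⟨h', H', fun a b hab ha => ?_⟩
      rw [Finset.coe_insert] at ha
      rcases ha with rfl | ha
      · exact absurd ⟨b, hab⟩ hb
      · exact hn a b hab ha

lemma exists_normalized (H : Conj f g h) : ∃ h', Conj f g h' ∧ Normalized f g h' (crit g) := by
  have := exists_normalized_finset H (crit_finite H.dyg).toFinset (by simp)
  simpa using this

/-- A maximal interval of fixed points. -/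
structure MaxFix (g : Equiv.Perm ℝ) (c d : ℝ) : Prop where
  nonneg : 0 ≤ c
  lt : c < d
  le_one : d ≤ 1
  fixed : ∀ x, c ≤ x → x ≤ d → g x = x
  left : c = 0 ∨ ∀ y < c, ∃ x, y < x ∧ x < c ∧ g x ≠ x
  right : d = 1 ∨ ∀ y > d, ∃ x, d < x ∧ x < y ∧ g x ≠ x

lemma MaxFix.right_unique {c d d' : ℝ} (h1 : MaxFix g c d) (h2 : MaxFix g c d') : d = d' := by
  by_contra hne
  wlog hlt : d < d' generalizing d d'
  · exact this h2 h1 (Ne.symm hne) (lt_of_le_of_ne (not_lt.1 hlt) (Ne.symm hne))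
  rcases h1.right with rfl | hr
  · linarith [h2.le_one]
  · obtain ⟨x, hx1, hx2, hx3⟩ := hr d' hlt
    exact hx3 (h2.fixed x (h1.lt.le.trans hx1.le) hx2.le)

lemma MaxFix.map {c d : ℝ} (H : Conj f g h) (hm : MaxFix g c d) : MaxFix f (h c) (h d) where
  nonneg := by rw [← H.dyh.map_zero]; exact H.dyh.mono.monotone hm.nonneg
  lt := H.dyh.mono hm.lt
  le_one := by rw [← H.dyh.map_one]; exact H.dyh.mono.monotone hm.le_one
  fixed x h1 h2 := by
    have e : h (h⁻¹ x) = x := by simp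
    rw [← e] at h1 h2 ⊢
    rw [H.dyh.mono.le_iff_le] at h1 h2
    exact H.apply_eq (hm.fixed _ h1 h2)
  left := by
    rcases hm.left with rfl | hl
    · exact Or.inl H.dyh.map_zero
    · refine Or.inr fun y hy => ?_
      have e : h (h⁻¹ y) = y := by simp
      rw [← e, H.dyh.mono.lt_iff_lt] at hy
      obtain ⟨x, h1, h2, h3⟩ := hl _ hy
      refine ⟨h x, ?_, H.dyh.mono h2, H.apply_ne h3⟩
      rw [← e]; exact H.dyh.mono h1
  right := by
    rcases hm.right with rfl | hl
    · exact Or.inl H.dyh.map_one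
    · refine Or.inr fun y hy => ?_
      have e : h (h⁻¹ y) = y := by simp
      rw [← e, gt_iff_lt, H.dyh.mono.lt_iff_lt] at hy
      obtain ⟨x, h1, h2, h3⟩ := hl _ hy
      refine ⟨h x, H.dyh.mono h1, ?_, H.apply_ne h3⟩
      rw [← e]; exact H.dyh.mono h2

lemma exists_fixed_cell (hg : Dy g) {a : ℝ} (ha : a ∈ Ioo (0 : ℝ) 1) (hac : a ∉ Set.image mid (bad g))
    (hga : g a = a) (hfix : ∀ M, a ∈ cell M → ∃ x ∈ cell M, x ≠ a ∧ g x = x) :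
    ∃ M, a ∈ cell M ∧ Carries g M M := by
  obtain ⟨M, M', hM, haM⟩ := exists_good_cell hg ha (by
    rintro (rfl | h')
    · exact lt_irrefl _ ha.1
    · exact hac h')
  obtain ⟨x, hx, hxa, hgx⟩ := hfix M haM
  have := carries_self_of_fixed hM hxa ⟨hx.1.le, hx.2.le⟩ ⟨haM.1.le, haM.2.le⟩ hgx hga
  subst this
  exact ⟨M, haM, hM⟩

lemma MaxFix.left_mem {c d : ℝ} (hg : Dy g) (hm : MaxFix g c d) : c ∈ crit g := by
  rcases hm.left with rfl | hl
  · exact mem_insert _ _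
  · rcases hm.nonneg.eq_or_lt with rfl | h0
    · exact mem_insert _ _
    by_contra hcon
    obtain ⟨M, h1, h2⟩ := exists_fixed_cell hg ⟨h0, hm.lt.trans_le hm.le_one⟩
      (fun h' => hcon (mem_insert_of_mem _ h')) (hm.fixed c le_rfl hm.lt.le) (by
        intro M hM
        obtain ⟨x, hx1, hx2⟩ := exists_between (lt_min hm.lt hM.2)
        exact ⟨x, ⟨hM.1.trans hx1, hx2.trans_le (min_le_right _ _)⟩, hx1.ne',
          hm.fixed x hx1.le (hx2.le.trans (min_le_left _ _))⟩)
    obtain ⟨x, hx1, hx2, hx3⟩ := hl _ h1.1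
    exact hx3 (h2.fixed hx1.le (hx2.le.trans h1.2.le))

lemma MaxFix.right_mem {c d : ℝ} (hg : Dy g) (hm : MaxFix g c d) : d = 1 ∨ d ∈ Set.image mid (bad g) := by
  rcases hm.right with rfl | hl
  · exact Or.inl rfl
  · rcases hm.le_one.eq_or_lt with rfl | h0
    · exact Or.inl rfl
    right
    by_contra hcon
    obtain ⟨M, h1, h2⟩ := exists_fixed_cell hg ⟨hm.nonneg.trans_lt hm.lt, h0⟩
      hcon (hm.fixed d hm.lt.le le_rfl) (by
        intro M hM
        obtain ⟨x, hx1, hx2⟩ := exists_between (max_lt hm.lt hM.1)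
        exact ⟨x, ⟨(le_max_right _ _).trans_lt hx1, hx2.trans hM.2⟩, hx2.ne,
          hm.fixed x ((le_max_left _ _).trans hx1.le) hx2.le⟩)
    obtain ⟨x, hx1, hx2, hx3⟩ := hl _ h1.2
    exact hx3 (h2.fixed (h1.1.le.trans hx1.le) hx2.le)

lemma exists_maxFix (hg : Dy g) {a b : ℝ} (ha : 0 ≤ a) (hab : a < b) (hb : b ≤ 1)
    (hfix : ∀ x, a ≤ x → x ≤ b → g x = x) : ∃ c d, MaxFix g c d ∧ c ≤ a ∧ b ≤ d := by
  set S := {y | 0 ≤ y ∧ ∀ x, y ≤ x → x ≤ b → g x = x}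
  set T := {y | y ≤ 1 ∧ ∀ x, a ≤ x → x ≤ y → g x = x}
  have hS : a ∈ S := ⟨ha, hfix⟩
  have hT : b ∈ T := ⟨hb, hfix⟩
  have hS' : IsGLB S (sInf S) := isGLB_csInf ⟨a, hS⟩ ⟨0, fun x hx => hx.1⟩
  have hT' : IsLUB T (sSup T) := isLUB_csSup ⟨b, hT⟩ ⟨1, fun x hx => hx.1⟩
  have hca : sInf S ≤ a := hS'.1 hS
  have hbd : b ≤ sSup T := hT'.1 hT
  have fixS : ∀ x, sInf S ≤ x → x ≤ b → g x = x := by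
    intro x h1 h2
    rcases h1.eq_or_lt with rfl | h1
    · rcases lt_or_ge (sInf S) a with hlt | hge
      · refine isGLB_fixed hg (S := {y | sInf S < y ∧ y ≤ b}) ?_ ?_
        · have : {y | sInf S < y ∧ y ≤ b} = Ioc (sInf S) b := rfl
          rw [this]
          exact isGLB_Ioc (by linarith)
        · rintro y ⟨hy1, hy2⟩
          obtain ⟨z, hz, hzy⟩ := (isGLB_lt_iff hS').1 hy1
          exact hz.2 y hzy.le hy2
      · exact hfix _ hge h2
    · obtain ⟨z, hz, hzy⟩ := (isGLB_lt_iff hS').1 h1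
      exact hz.2 x hzy.le h2
  have fixT : ∀ x, a ≤ x → x ≤ sSup T → g x = x := by
    intro x h1 h2
    rcases h2.eq_or_lt with rfl | h2
    · rcases lt_or_ge b (sSup T) with hlt | hge
      · refine isLUB_fixed hg (S := {y | a ≤ y ∧ y < sSup T}) ?_ ?_
        · have : {y | a ≤ y ∧ y < sSup T} = Ico a (sSup T) := rfl
          rw [this]
          exact isLUB_Ico (by linarith)
        · rintro y ⟨hy1, hy2⟩
          obtain ⟨z, hz, hzy⟩ := (lt_isLUB_iff hT').1 hy2
          exact hz.2 y hy1 hzy.le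
      · exact hfix _ h1 hge
    · obtain ⟨z, hz, hzy⟩ := (lt_isLUB_iff hT').1 h2
      exact hz.2 x h1 hzy.le
  have hc0 : 0 ≤ sInf S := hS'.2 fun x hx => hx.1
  have hd1 : sSup T ≤ 1 := hT'.2 fun x hx => hx.1
  refine ⟨sInf S, sSup T, ⟨hc0, by linarith, hd1, ?_, ?_, ?_⟩, hca, hbd⟩
  · intro x h1 h2
    rcases le_total x b with h' | h'
    · exact fixS x h1 h'
    · exact fixT x (by linarith) h2
  · rcases hc0.eq_or_lt with e | h0
    · exact Or.inl e.symm
    · refine Or.inr fun y hy => ?_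
      by_contra hcon
      push Not at hcon
      obtain ⟨z, hz1, hz2⟩ := exists_between (max_lt hy h0)
      have hzS : z ∈ S := by
        refine ⟨(le_max_right _ _).trans hz1.le, fun x h1 h2 => ?_⟩
        rcases lt_or_ge x (sInf S) with h' | h'
        · exact hcon x ((le_max_left _ _).trans_lt (hz1.trans_le h1)) h'
        · exact fixS x h' h2
      exact absurd (hS'.1 hzS) (not_le.2 hz2)
  · rcases hd1.eq_or_lt with e | h0
    · exact Or.inl e
    · refine Or.inr fun y hy => ?_
      by_contra hcon
      push Not at hcon
      obtain ⟨z, hz1, hz2⟩ := exists_between (lt_min hy h0)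
      have hzT : z ∈ T := by
        refine ⟨hz2.le.trans (min_le_right _ _), fun x h1 h2 => ?_⟩
        rcases lt_or_ge (sSup T) x with h' | h'
        · exact hcon x h' (h2.trans_lt (hz2.trans_le (min_le_left _ _)))
        · exact fixT x h1 h'
      exact absurd (hT'.1 hzT) (not_le.2 hz1)

end

section TwoPoint

lemma Consec.le {a b : ℝ} {l : List (List Bool)} (h : Consec a l b) : a ≤ b := by
  induction l generalizing a with
  | nil => exact le_of_eq h
  | cons u l ih =>
    have := ih h.2
    rw [← h.1]
    exact (aff_strictMono u one_pos).le.trans this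

lemma Consec.right_unique {a b c : ℝ} {l : List (List Bool)} (h : Consec a l b)
    (h' : Consec a l c) : b = c := by
  induction l generalizing a with
  | nil => exact h.symm.trans h'
  | cons u l ih => exact ih h.2 h'.2

lemma Consec.eq_nil_iff {a b : ℝ} {l : List (List Bool)} (h : Consec a l b) : l = [] ↔ a = b := by
  cases l with
  | nil => simp only [true_iff]; exact h
  | cons u l =>
    simp only [reduceCtorEq, false_iff]
    have h1 := h.2.le
    have h2 := aff_strictMono u one_pos
    rw [← h.1]
    exact (h2.trans_le h1).ne

lemma Consec.split {a b c : ℝ} {l : List (List Bool)} (h : Consec a l b) (hac : a ≤ c) (hcb : c ≤ b)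
    (hc : ∀ u ∈ l, c ∉ cell u) : ∃ l₁ l₂, l = l₁ ++ l₂ ∧ Consec a l₁ c ∧ Consec c l₂ b := by
  induction l generalizing a with
  | nil =>
    have e : a = b := h
    subst e
    have : a = c := le_antisymm hac hcb
    exact ⟨[], [], rfl, this, this.symm⟩
  | cons u l ih =>
    rcases hac.eq_or_lt with rfl | hlt
    · exact ⟨[], u :: l, rfl, rfl, h⟩
    · have h1 : aff u 1 ≤ c := by
        by_contra hcon
        exact hc u (by simp) ⟨by rw [h.1]; exact hlt, not_le.1 hcon⟩
      obtain ⟨l₁, l₂, rfl, h2, h3⟩ := ih h.2 h1 fun u hu => hc u (by simp [hu])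
      exact ⟨u :: l₁, l₂, rfl, ⟨h.1, h2⟩, h3⟩

lemma Consec.pad {a b : ℝ} {l : List (List Bool)} (h : Consec a l b) (hl : l ≠ []) {m : ℕ}
    (hm : l.length ≤ m) : ∃ l', Consec a l' b ∧ l'.length = m := by
  induction m, hm using Nat.le_induction with
  | base => exact ⟨l, h, rfl⟩
  | succ m hm ih =>
    obtain ⟨l', h1, h2⟩ := ih
    match l' with
    | [] =>
      have := List.length_pos_of_ne_nil hl
      simp at h2; omega
    | u :: l' =>
      refine ⟨(u ++ [false]) :: (u ++ [true]) :: l', ⟨?_, ?_, ?_⟩, by simpa using h2⟩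
      · rw [← h1.1, aff_append]; simp [aff_cons]
      · rw [aff_append, aff_append]; simp [aff_cons]
      · rw [aff_append]; simpa [aff_cons] using h1.2

lemma Consec.exists_pad_pair {a b a' b' : ℝ} {l l' : List (List Bool)} (h : Consec a l b)
    (h' : Consec a' l' b') (hiff : a = b ↔ a' = b') :
    ∃ m m', Consec a m b ∧ Consec a' m' b' ∧ m.length = m'.length ∧
      m.length ≤ l.length + l'.length := by
  by_cases hl : l = []
  · have h2 : l' = [] := h'.eq_nil_iff.2 (hiff.1 (h.eq_nil_iff.1 hl))
    subst hl h2
    exact ⟨[], [], h, h', rfl, by simp⟩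
  · have h2 : l' ≠ [] := fun e => hl (h.eq_nil_iff.2 (hiff.2 (h'.eq_nil_iff.1 e)))
    obtain ⟨m, m1, m2⟩ := h.pad hl (m := l.length + l'.length) (by omega)
    obtain ⟨m', m3, m4⟩ := h'.pad h2 (m := l.length + l'.length) (by omega)
    exact ⟨m, m', m1, m3, by omega, by omega⟩

lemma exists_forall₂_carries {l l' : List (List Bool)} (h : Consec 0 l 1) (h' : Consec 0 l' 1)
    (hlen : l.length = l'.length) : ∃ u ∈ ThompsonF, wordLength u ≤ 6 * l.length ∧
      List.Forall₂ (Carries u) l l' := by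
  obtain ⟨S, rfl⟩ := h.exists_tree
  obtain ⟨T, rfl⟩ := h'.exists_tree
  rw [BTree.length_leaves, BTree.length_leaves] at hlen
  obtain ⟨w, hw1, hw2, hw3⟩ := S.red_vine
  obtain ⟨v, hv1, hv2, hv3⟩ := T.red_vine
  rw [show T.carets = S.carets by omega] at hv1 hv3
  have hw := prod_mem hw2
  have hv := prod_mem hv2
  refine ⟨v.prod⁻¹ * w.prod, mul_mem (inv_mem hv) hw, ?_, ?_⟩
  · have h3 := wordLength_mul (inv_mem hv) hw
    have h4 := wordLength_inv hv
    have h5 := wordLength_prod_le hw2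
    have h6 := wordLength_prod_le hv2
    rw [BTree.length_leaves]
    omega
  · refine BTree.forall₂_trans hw3 ?_
    have := hv3.flip
    exact this.imp fun a b hab => Carries.inv hab

lemma forall₂_append_left {α : Type*} {R : α → α → Prop} {a b a' b' : List α}
    (hlen : a.length = a'.length) (h : List.Forall₂ R (a ++ b) (a' ++ b')) :
    List.Forall₂ R a a' ∧ List.Forall₂ R b b' := by
  induction a generalizing a' with
  | nil =>
    have : a' = [] := List.length_eq_zero_iff.1 (by simpa using hlen.symm)
    subst this
    exact ⟨List.Forall₂.nil, h⟩
  | cons x a ih =>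
    match a' with
    | [] => simp at hlen
    | y :: a' =>
      cases h with
      | cons h1 h2 =>
        obtain ⟨h3, h4⟩ := ih (by simpa using hlen) h2
        exact ⟨List.Forall₂.cons h1 h3, h4⟩

/-- An element of `F` with prescribed values at two points, of controlled length. -/
lemma exists_two_point {f g h : Equiv.Perm ℝ} (H : Conj f g h) {c d : ℝ} (hm : MaxFix g c d) :
    ∃ u ∈ ThompsonF, wordLength u ≤ 6 * ((bad f).ncard + (bad g).ncard + 2) ∧ u c = h c ∧
      u d = h d := by
  have key : ∀ {g : Equiv.Perm ℝ} {c d : ℝ}, Dy g → MaxFix g c d → ∃ l₁ l₂ l₃,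
      Consec 0 l₁ c ∧ Consec c l₂ d ∧ Consec d l₃ 1 ∧
      l₁.length + l₂.length + l₃.length ≤ (bad g).ncard + 1 := by
    intro g c d hg hm
    obtain ⟨T, hT1, hT2⟩ := exists_good_tree hg.fin []
    have hT : T.carets ≤ (bad g).ncard := by simpa using hT1
    have hnot : ∀ u ∈ T.leaves, ∀ e, straddle e ⊆ bad g → e ∉ cell u := fun u hu e he hmem =>
      hT2 u hu (he hmem)
    have hsc := straddle_crit (hm.left_mem hg)
    have hsd : straddle d ⊆ bad g := by
      rcases hm.right_mem hg with rfl | ⟨w, hw, rfl⟩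
      · simp [straddle_one]
      · exact straddle_mid hw
    obtain ⟨l₁, l, e1, h1, h2⟩ := (consec_leaves T).split hm.nonneg (hm.lt.le.trans hm.le_one)
      (fun u hu => hnot u hu c hsc)
    obtain ⟨l₂, l₃, e2, h3, h4⟩ := h2.split hm.lt.le hm.le_one
      (fun u hu => hnot u (by rw [e1]; simp [hu]) d hsd)
    refine ⟨l₁, l₂, l₃, h1, h3, h4, ?_⟩
    have := congrArg List.length e1
    rw [BTree.length_leaves, e2] at this
    simp only [List.length_append] at this
    omega
  obtain ⟨l₁, l₂, l₃, a1, a2, a3, a4⟩ := key H.dyg hm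
  obtain ⟨k₁, k₂, k₃, b1, b2, b3, b4⟩ := key H.dyf (hm.map H)
  have i1 : (0 : ℝ) = c ↔ 0 = h c := by
    nth_rw 2 [← H.dyh.map_zero]
    exact h.injective.eq_iff.symm
  have i2 : c = d ↔ h c = h d := h.injective.eq_iff.symm
  have i3 : d = 1 ↔ h d = 1 := by
    nth_rw 2 [← H.dyh.map_one]
    exact h.injective.eq_iff.symm
  obtain ⟨m₁, n₁, c1, c2, c3, c4⟩ := a1.exists_pad_pair b1 i1
  obtain ⟨m₂, n₂, d1, d2, d3, d4⟩ := a2.exists_pad_pair b2 i2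
  obtain ⟨m₃, n₃, e1, e2, e3, e4⟩ := a3.exists_pad_pair b3 i3
  obtain ⟨u, hu, hlen, hF⟩ := exists_forall₂_carries (c1.append (d1.append e1))
    (c2.append (d2.append e2)) (by simp only [List.length_append]; omega)
  simp only [List.length_append] at hlen
  obtain ⟨F1, F'⟩ := forall₂_append_left c3 hF
  obtain ⟨F2, -⟩ := forall₂_append_left d3 F'
  have g1 := c1.map F1
  rw [(dy_of_mem hu).map_zero] at g1
  have uc := g1.right_unique c2
  have g2 := d1.map F2
  rw [uc] at g2
  exact ⟨u, hu, by omega, uc, g2.right_unique d2⟩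

end TwoPoint

section
variable {f g h : Equiv.Perm ℝ}

/-- Among normalized conjugators one with the fewest bad words has few of them inside each
interval of fixed points. -/
lemma ncard_inside_le (H : Conj f g h) (hN : Normalized f g h (crit g))
    (hmin : ∀ h', Conj f g h' → Normalized f g h' (crit g) → (bad h).ncard ≤ (bad h').ncard)
    {c d : ℝ} (hm : MaxFix g c d) :
    {w ∈ bad h | c ≤ aff w 0 ∧ aff w 1 ≤ d}.ncard ≤ 19 * ((bad f).ncard + (bad g).ncard + 2) := by
  obtain ⟨u, hu, hlen, uc, ud⟩ := exists_two_point H hm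
  have hdu := dy_of_mem hu
  have hh := mem_of_dy H.dyh
  have hsc := straddle_crit (hm.left_mem H.dyg)
  have hsd : straddle d ⊆ bad g := by
    rcases hm.right_mem H.dyg with rfl | ⟨w, hw, rfl⟩
    · simp [straddle_one]
    · exact straddle_mid hw
  let k₁ := glue h u c H.dyh.mono hdu.mono uc.symm
  have hk₁ : k₁ ∈ ThompsonF := glue_mem hh hu (H.dyg.fin.subset hsc)
  have hk₁d : k₁ d = h d := by rw [← ud]; exact glue_of_ge hm.lt.le
  let k := glue k₁ h d (dy_of_mem hk₁).mono H.dyh.mono hk₁d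
  have hk : k ∈ ThompsonF := glue_mem hk₁ hh (H.dyg.fin.subset hsd)
  have kl : ∀ t, t ≤ c → k t = h t := fun t ht => by
    rw [show k t = k₁ t from glue_of_le (ht.trans hm.lt.le)]
    exact glue_of_le ht
  have kr : ∀ t, d ≤ t → k t = h t := fun t ht => glue_of_ge ht
  have km : ∀ t, c ≤ t → t ≤ d → k t = u t := fun t h1 h2 => by
    rw [show k t = k₁ t from glue_of_le h2]
    exact glue_of_ge h1
  have gc := hm.fixed c le_rfl hm.lt.le
  have gd := hm.fixed d hm.lt.le le_rfl
  have gmono := H.dyg.mono.monotone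
  have Hk : Conj f g k := by
    refine ⟨H.dyf, H.dyg, dy_of_mem hk, ?_⟩
    ext t
    rw [Equiv.Perm.mul_apply, Equiv.Perm.mul_apply]
    rcases le_total t c with ht | ht
    · rw [kl t ht, kl (g t) (by rw [← gc]; exact gmono ht), H.apply]
    rcases le_total t d with ht' | ht'
    · rw [hm.fixed t ht ht', km t ht ht']
      refine (hm.map H).fixed _ ?_ ?_
      · rw [← uc]; exact hdu.mono.monotone ht
      · rw [← ud]; exact hdu.mono.monotone ht'
    · rw [kr t ht', kr (g t) (by rw [← gd]; exact gmono ht'), H.apply]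
  have hNk : Normalized f g k (crit g) := by
    intro a b hab ha
    obtain ⟨t, ht, h1, h2, h3⟩ := hN a b hab ha
    refine ⟨t, ht, h1, h2, ?_⟩
    have hne := hab.ne t h1 h2
    have : k t = h t := by
      rcases le_total t c with h' | h'
      · exact kl t h'
      rcases le_total t d with h'' | h''
      · exact absurd (hm.fixed t h' h'') hne
      · exact kr t h''
    unfold dl at h3 ⊢
    rw [this, h3]
  have hle := hmin k Hk hNk
  set I := {w ∈ bad h | c ≤ aff w 0 ∧ aff w 1 ≤ d}
  set O := {w ∈ bad h | aff w 1 ≤ c ∨ d ≤ aff w 0}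
  have fI : I.Finite := H.dyh.fin.subset (sep_subset _ _)
  have fO : O.Finite := H.dyh.fin.subset (sep_subset _ _)
  have hsub : bad k ⊆ O ∪ (bad u ∪ bad g) := by
    intro w hw
    rcases bad_glue hw with (⟨h1, h2⟩ | ⟨h1, h2⟩) | h1
    · rcases bad_glue h1 with (⟨h3, h4⟩ | ⟨h3, h4⟩) | h3
      · exact Or.inl ⟨h3, Or.inl h4⟩
      · exact Or.inr (Or.inl h3)
      · exact Or.inr (Or.inr (hsc h3))
    · exact Or.inl ⟨h1, Or.inr h2⟩
    · exact Or.inr (Or.inr (hsd h1))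
  have hk1 := ncard_le_ncard hsub (fO.union (hdu.fin.union H.dyg.fin))
  have hk2 := ncard_union_le O (bad u ∪ bad g)
  have hk3 := ncard_union_le (bad u) (bad g)
  have hdisj : Disjoint I O := by
    rw [Set.disjoint_left]
    rintro w ⟨_, h1, h2⟩ ⟨_, h3 | h3⟩
    · have := aff_strictMono w one_pos; linarith
    · have := aff_strictMono w one_pos; linarith
  have hk4 := ncard_le_ncard (union_subset (sep_subset _ _) (sep_subset _ _) : I ∪ O ⊆ bad h)
    H.dyh.fin
  rw [ncard_union_eq hdisj fI fO] at hk4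
  have hk5 := (bad_of_mem hu).2
  omega

lemma exists_good_conj (H : Conj f g h) : ∃ h', Conj f g h' ∧ Normalized f g h' (crit g) ∧
    ∀ c d, MaxFix g c d → {w ∈ bad h' | c ≤ aff w 0 ∧ aff w 1 ≤ d}.ncard ≤
      19 * ((bad f).ncard + (bad g).ncard + 2) := by
  classical
  obtain ⟨h₁, H₁, hN₁⟩ := exists_normalized H
  have hex : ∃ n, ∃ h', Conj f g h' ∧ Normalized f g h' (crit g) ∧ (bad h').ncard = n :=
    ⟨_, h₁, H₁, hN₁, rfl⟩
  obtain ⟨h', H', hN, hn⟩ := Nat.find_spec hex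
  refine ⟨h', H', hN, fun c d hm => ncard_inside_le H' hN (fun k Hk hNk => ?_) hm⟩
  rw [hn]
  exact Nat.find_min' hex ⟨k, Hk, hNk, rfl⟩

end

section
variable {f g h : Equiv.Perm ℝ}

lemma Conj.carries (H : Conj f g h) {u v u' v' : List Bool} (h1 : Carries g u v)
    (h2 : Carries h u u') (h3 : Carries f u' v') : Carries h v v' := by
  have e : h = f * h * g⁻¹ := by rw [H.comm]; group
  rw [e]
  exact (h3.mul h2).mul h1.inv

lemma apply_ne_of_carries {w w' : List Bool} (hc : Carries g w w') (hne : w ≠ w') {t : ℝ}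
    (ht : t ∈ X) (htw : t ∈ cell w) : g t ≠ t := by
  have key : ∀ {x : List Bool} {y : ℝ}, x ≠ [] → Irrational y → aff x y ≠ y := by
    intro x y hx hy e
    have h1 : ((1 : ℝ) / 2) ^ x.length < 1 :=
      pow_lt_one₀ (by norm_num) (by norm_num) (by simpa using hx)
    have h2 : ∀ x : List Bool, ∃ q : ℚ, aff x 0 = q := by
      intro x
      by_contra hcon
      push Not at hcon
      have : Irrational (aff x 0) := by
        rintro ⟨q, hq⟩
        exact hcon q hq.symm
      rw [irrational_aff] at this
      simp at this
    obtain ⟨q, hq⟩ := h2 x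
    rw [aff_eq, hq] at e
    apply hy
    refine ⟨q / (1 - (1 / 2) ^ x.length), ?_⟩
    push_cast
    rw [div_eq_iff (by linarith)]
    linarith
  intro e
  obtain ⟨y, hy, rfl⟩ := mem_cell_iff.1 htw
  have hyi : Irrational y := irrational_aff.1 ht.2
  have h1 := hc y ⟨hy.1.le, hy.2.le⟩
  rw [e] at h1
  have h2 : aff w y ∈ cell w' := by rw [h1]; exact aff_mem_cell w' hy
  rcases prefix_or_prefix_of_mem_cell htw h2 with ⟨x, rfl⟩ | ⟨x, rfl⟩
  · rw [aff_append] at h1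
    exact key (by rintro rfl; simp at hne) hyi ((aff_strictMono w).injective h1.symm)
  · rw [aff_append] at h1
    exact key (by rintro rfl; simp at hne) hyi ((aff_strictMono w').injective h1)

lemma exists_mem_diff {w Q : List Bool} (hQ : ¬ Q <+: w) : ∃ t ∈ X, t ∈ cell w ∧ t ∉ cell Q := by
  have hb : ∃ b, ¬ w ++ [b] <+: Q := by
    by_contra hcon
    push Not at hcon
    obtain ⟨y, hy⟩ := hcon true
    obtain ⟨z, hz⟩ := hcon false
    rw [← hz, List.append_assoc, List.append_assoc, List.append_right_inj] at hy
    simp at hy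
  obtain ⟨b, hb⟩ := hb
  obtain ⟨t, ht, h1, h2⟩ := exists_mem_X (aff_mem_Icc (w ++ [b]) (by simp)).1
    (aff_strictMono (w ++ [b]) one_pos) (aff_mem_Icc (w ++ [b]) (by simp)).2
  refine ⟨t, ht, cell_append w [b] ⟨h1, h2⟩, fun hc => ?_⟩
  rcases prefix_or_prefix_of_mem_cell hc ⟨h1, h2⟩ with h' | h'
  · rcases List.prefix_concat_iff.1 h' with e | e
    · exact hb (by rw [e])
    · exact hQ e
  · exact hb h'

/-- A bad word of a conjugator which takes long to leave the repelling set forces a large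
discrepancy. -/
lemma exists_dl_le (H : Conj f g h) {w w' : List Bool} (hw : w ∈ bad h)
    (hfree : ∀ t ∈ X, t ∈ cell w → g t ≠ t) {j : ℕ} (hj : Carries (g ^ j) w w') (hw' : w' ∉ bad g)
    {t : ℝ} (htw : t ∈ cell w) (htr : (g ^ j) t ∈ Rep g) :
    ∃ s ∈ X, g s ≠ s ∧ dl f g h s ≤ -(j + 1 : ℤ) := by
  obtain ⟨v, x, hx, hc, y, rfl⟩ : ∃ v x, x ≠ [] ∧ Carries g (v ++ x) v ∧ v ++ x <+: w' := by
    obtain ⟨v, x, hx, hc, hm⟩ := htr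
    rcases prefix_or_prefix_of_mem_cell hm (hj.mem_cell_iff.2 htw) with hp | ⟨z, hz⟩
    · exact ⟨v, x, hx, hc, hp⟩
    · obtain ⟨w₁, hw₁⟩ := not_mem_bad.1 hw'
      have e : v = w₁ ++ z := hw₁.eq_append (by rw [hz]; exact hc)
      have hp : w₁ <+: w' := by
        refine List.prefix_of_prefix_length_le (l₃ := v ++ x) ?_ ⟨z, hz⟩ ?_
        · rw [e, List.append_assoc]; exact List.prefix_append _ _
        · have h1 := congrArg List.length hz
          have h2 := congrArg List.length e
          simp only [List.length_append] at h1 h2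
          omega
      obtain ⟨x', rfl⟩ := hp
      refine ⟨w₁, x', ?_, hw₁, List.prefix_rfl⟩
      rintro rfl
      have h1 := congrArg List.length hz
      have h2 := congrArg List.length e
      have h3 := List.length_pos_of_ne_nil hx
      simp only [List.length_append, List.length_nil] at h1 h2
      omega
  have cw := (carries_pow_rp hc 1 j).append y
  have e1 : v ++ rp x 1 = v ++ x := by simp [rp]
  rw [e1] at cw
  have hwe := hj.left_unique cw
  subst hwe
  have hbad : v ++ rp x (1 + j) ∈ bad h := bad_of_initial (List.prefix_append _ _) hw
  classical
  have hex : ∃ i, v ++ rp x i ∉ bad h := by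
    refine ⟨(bad h).ncard, not_mem_bad.2 (exists_carries_of_length H.dyh.fin ?_)⟩
    rw [List.length_append, length_rp]
    have := List.length_pos_of_ne_nil hx
    nlinarith
  have rp_initial : ∀ m n : ℕ, v ++ rp x m <+: v ++ rp x (m + n) := by
    intro m n
    induction n with
    | zero => simp
    | succ n ih =>
      rw [← add_assoc, rp_succ', ← List.append_assoc]
      exact ih.trans (List.prefix_append _ _)
  set i₀ := Nat.find hex
  have hi₀ : v ++ rp x i₀ ∉ bad h := Nat.find_spec hex
  have hlt : 1 + j < i₀ := by
    by_contra hcon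
    push Not at hcon
    obtain ⟨n, hn⟩ := Nat.exists_eq_add_of_le hcon
    rw [hn] at hbad
    exact hi₀ (bad_of_initial (rp_initial _ _) hbad)
  obtain ⟨r, hr⟩ := Nat.exists_eq_add_of_lt hlt
  set Q := v ++ rp x i₀ with hQ
  obtain ⟨Q', hQ'⟩ := not_mem_bad.1 hi₀
  have hQ0 : v ++ rp x (i₀ - 1) ∈ bad h := by
    by_contra hcon
    exact Nat.find_min hex (m := i₀ - 1) (by omega) hcon
  have hQbad : Q' ∈ bad f := by
    intro u hu
    have c := carries_rp hc (i₀ - 1)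
    rw [show i₀ - 1 + 1 = i₀ by omega] at c
    exact hQ0 _ (H.carries c hQ' hu)
  obtain ⟨s, hs, hsw, hsQ⟩ := exists_mem_diff (w := v ++ rp x (1 + j) ++ y) (Q := Q)
    fun hp => hi₀ (bad_of_initial hp hw)
  have hne := hfree s hs hsw
  refine ⟨s, hs, hne, ?_⟩
  have hg : j < exit g s := by
    rw [← exit_spec H.dyg hs hne, zpow_natCast]
    exact ⟨v, x, hx, hc, cell_append _ y (cw.mem_cell_iff.2 hsw)⟩
  have hf : ¬ 0 < exit f (h s) := by
    rw [← exit_spec H.dyf (H.dyh.map_mem_X hs) (H.apply_ne hne), zpow_zero]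
    rintro ⟨v', x', hx', hc', hm'⟩
    rw [Equiv.Perm.one_apply] at hm'
    have c1 := carries_pow_rp hc (1 + j) (r + 1)
    rw [show 1 + j + (r + 1) = i₀ by omega] at c1
    have c2 : (g ^ (r + 1))⁻¹ s ∈ cell Q :=
      c1.inv.mem_cell_iff.2 (cell_append _ y hsw)
    have c3 := hQ'.mem_cell_iff.2 c2
    have c4 := H.zpow_apply (-((r + 1 : ℕ) : ℤ)) s
    rw [zpow_neg, zpow_natCast, zpow_neg, zpow_natCast] at c4
    have c5 := carries_pow_rp hc' 1 (r + 1)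
    rw [show v' ++ rp x' 1 = v' ++ x' by simp [rp]] at c5
    have c6 := c5.inv.mem_cell_iff.2 hm'
    rw [c4, rp.eq_def] at c6
    have c7 : h ((g ^ (r + 1))⁻¹ s) ∈ cell (v' ++ x') := by
      rw [show 1 + (r + 1) = (r + 1) + 1 by omega] at c6
      simp only [← List.append_assoc] at c6
      exact cell_append _ _ c6
    rcases prefix_or_prefix_of_mem_cell c3 c7 with hp | hp
    · exact hsQ (hQ'.mem_cell_iff.1 (cell_mono hp hm'))
    · exact bad_of_initial hp hQbad _ hc'
  unfold dl
  omega

lemma carries_pow_chain {W : ℕ → List Bool} {m : ℕ}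
    (hW : ∀ i < m, Carries g (W i) (W (i + 1))) (j : ℕ) (hj : j ≤ m) :
    Carries (g ^ j) (W 0) (W j) := by
  induction j with
  | zero => simpa using Carries.one _
  | succ j ih =>
    rw [pow_succ']
    exact (hW j (by omega)).mul (ih (by omega))

lemma exit_le_of_chain (H : Conj f g h) {D : ℤ} (hD : 0 ≤ D)
    (hdl : ∀ t ∈ X, g t ≠ t → |dl f g h t| ≤ D) {W : ℕ → List Bool} {m : ℕ}
    (hW : ∀ i < m, Carries g (W i) (W (i + 1))) (h0 : W 0 ∈ bad h)
    (hfree : ∀ t ∈ X, t ∈ cell (W 0) → g t ≠ t) {t : ℝ} (ht : t ∈ X) (htW : t ∈ cell (W 0)) :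
    exit g t ≤ D ∨ (m : ℤ) ≤ D := by
  by_contra hcon
  push Not at hcon
  obtain ⟨n, hn⟩ := Int.eq_ofNat_of_zero_le hD
  have hne := hfree t ht htW
  have hm : n < m := by omega
  obtain ⟨s, hs, hns, hle⟩ := exists_dl_le H h0 hfree (carries_pow_chain hW n hm.le)
    (not_mem_bad.2 ⟨_, hW n hm⟩) htW (by
      rw [← zpow_natCast, exit_spec H.dyg ht hne]
      omega)
  have := abs_le.1 (hdl s hs hns)
  omega

/-- An orbit of bad words of a conjugator has bounded length. -/
lemma chain_length_le (H : Conj f g h) {D : ℤ} (hD : 0 ≤ D)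
    (hdl : ∀ t ∈ X, g t ≠ t → |dl f g h t| ≤ D ∧ |dl f⁻¹ g⁻¹ h t| ≤ D) {W : ℕ → List Bool} {m : ℕ}
    (hW : ∀ i < m, Carries g (W i) (W (i + 1))) (h0 : W 0 ∈ bad h) (hm : W m ∈ bad h)
    (hfree : ∀ t ∈ X, t ∈ cell (W 0) → g t ≠ t) : (m : ℤ) ≤ 2 * D + (bad g).ncard := by
  obtain ⟨t, ht, h1, h2⟩ := exists_mem_X (aff_mem_Icc (W 0) (by simp)).1
    (aff_strictMono (W 0) one_pos) (aff_mem_Icc (W 0) (by simp)).2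
  have htW : t ∈ cell (W 0) := ⟨h1, h2⟩
  have hne := hfree t ht htW
  have c := carries_pow_chain hW m le_rfl
  have hpow : ∀ s : ℝ, (g ^ m) s = (g ^ (m : ℤ)) s := fun s => by rw [zpow_natCast]
  have a := exit_le_of_chain H hD (fun t ht hn => (hdl t ht hn).1) hW h0 hfree ht htW
  have b := exit_le_of_chain (W := fun i => W (m - i)) (m := m) (t := (g ^ m) t) H.inv hD
    (fun t ht hn => (hdl t ht fun e => hn (Equiv.Perm.inv_eq_iff_eq.2 e.symm)).2)
    (fun i hi => by
      have := (hW (m - (i + 1)) (by omega)).inv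
      rwa [show m - (i + 1) + 1 = m - i by omega] at this) (by simpa using hm)
    (by
      intro s hs hsW
      have h3 : (g ^ m)⁻¹ s ∈ cell (W 0) := c.inv.mem_cell_iff.2 (by simpa using hsW)
      have h4 := hfree _ ((H.dyg.pow m).inv.map_mem_X hs) h3
      have h5 := zpow_apply_ne h4 m
      rw [← hpow] at h5
      rw [show (g ^ m) ((g ^ m)⁻¹ s) = s by simp] at h5
      exact inv_apply_ne h5)
    ((H.dyg.pow m).map_mem_X ht) (by simpa using c.mem_cell_iff.2 htW)
  have e : exit g⁻¹ ((g ^ m) t) = exit g⁻¹ t + m := by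
    have := exit_zpow H.dyg.inv ht (inv_apply_ne hne) (-(m : ℤ))
    rw [inv_zpow', neg_neg, ← hpow] at this
    omega
  have l := le_exit_add_exit_inv H.dyg ht hne H.dyg.map_zero H.dyg.map_one ht.1.1 ht.1.2
  have l' : {w ∈ bad g | 0 < mid w ∧ mid w < 1}.ncard ≤ (bad g).ncard :=
    ncard_le_ncard (sep_subset _ _) H.dyg.fin
  rw [e] at b
  omega

/-- A bad word of a conjugator reaches a bad word of one of the conjugate maps in few steps. -/
lemma exists_carries_bad (H : Conj f g h) {D : ℤ} (hD : 0 ≤ D)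
    (hdl : ∀ t ∈ X, g t ≠ t → |dl f g h t| ≤ D ∧ |dl f⁻¹ g⁻¹ h t| ≤ D) {K : ℕ}
    (hK : 2 * D + (bad g).ncard < K) {w : List Bool} (hw : w ∈ bad h) (hg : ¬ Carries g w w) :
    ∃ i ≤ K, (∃ v ∈ bad g, Carries (g ^ i) w v) ∨ ∃ v ∈ bad f⁻¹, Carries (h * g ^ (i + 1)) w v := by
  by_contra hcon
  push Not at hcon
  have step : ∀ i ≤ K + 1, ∃ v ∈ bad h, Carries (g ^ i) w v := by
    intro i hi
    induction i with
    | zero => exact ⟨w, hw, by simpa using Carries.one w⟩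
    | succ i ih =>
      obtain ⟨v, hv, hc⟩ := ih (by omega)
      obtain ⟨h1, h2⟩ := hcon i (by omega)
      obtain ⟨u, hu⟩ := not_mem_bad.1 fun hb => h1 v hb hc
      have hc' : Carries (g ^ (i + 1)) w u := by rw [pow_succ']; exact hu.mul hc
      refine ⟨u, fun z hz => ?_, hc'⟩
      obtain ⟨z', hz'⟩ := not_mem_bad.1 fun hb => h2 z hb (hz.mul hc')
      exact hv _ (H.inv.carries hu.inv hz hz')
  have : ∃ W : ℕ → List Bool, ∀ i ≤ K + 1, W i ∈ bad h ∧ Carries (g ^ i) w (W i) := by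
    choose W hW using step
    exact ⟨fun i => if hi : i ≤ K + 1 then W i hi else [], fun i hi => by
      simp only [hi, dif_pos]; exact hW i hi⟩
  obtain ⟨W, hW⟩ := this
  have hW0 : W 0 = w := by
    have := (hW 0 (by omega)).2
    rw [pow_zero] at this
    exact this.right_unique (Carries.one w)
  have hch : ∀ i < K, Carries g (W i) (W (i + 1)) := by
    intro i hi
    have h1 := (hW i (by omega)).2
    have h2 := (hW (i + 1) (by omega)).2
    have h3 := h2.mul h1.inv
    rwa [pow_succ', mul_inv_cancel_right] at h3
  have hK0 : 0 < K := by omega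
  have := chain_length_le H hD hdl hch (hW 0 (by omega)).1 (hW K (by omega)).1 (by
    intro t ht htw
    refine apply_ne_of_carries (hch 0 hK0) ?_ ht htw
    intro e
    have := hch 0 hK0
    rw [← e, hW0] at this
    exact hg this)
  omega

lemma ncard_bad_le (H : Conj f g h) (hN : Normalized f g h (crit g)) {A : ℕ}
    (hA : ∀ c d, MaxFix g c d → {w ∈ bad h | c ≤ aff w 0 ∧ aff w 1 ≤ d}.ncard ≤ A) :
    (bad h).ncard ≤ (13 * ((bad f).ncard + (bad g).ncard) + 8) *
      ((bad g).ncard + (bad f⁻¹).ncard) + ((bad g).ncard + 1) * A := by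
  classical
  set F := (bad f).ncard
  set G := (bad g).ncard
  set D : ℤ := 6 * (G + F) + 3 with hDdef
  set K : ℕ := 13 * (F + G) + 7
  have hdl : ∀ t ∈ X, g t ≠ t → |dl f g h t| ≤ D ∧ |dl f⁻¹ g⁻¹ h t| ≤ D := by
    intro t ht hne
    obtain ⟨a, b, hab, h1, h2⟩ := exists_bump H.dyg ht.1 hne
    have := abs_dl_le H hN hab ht h1 h2
    have c1 := cnt_le H.dyg b
    have c2 := cnt_le H.dyf (h b)
    exact ⟨this.1.trans (by omega), this.2.trans (by omega)⟩
  let S : ℕ → Set (List Bool) := fun i =>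
    {w | ∃ v ∈ bad g, Carries (g ^ i) w v} ∪ {w | ∃ v ∈ bad f⁻¹, Carries (h * g ^ (i + 1)) w v}
  have hS : ∀ i, (S i).Finite ∧ (S i).ncard ≤ G + (bad f⁻¹).ncard := by
    intro i
    obtain ⟨a1, a2⟩ := ncard_carries_le (g ^ i) H.dyg.fin
    obtain ⟨b1, b2⟩ := ncard_carries_le (h * g ^ (i + 1)) H.dyf.inv.fin
    exact ⟨a1.union b1, (ncard_union_le _ _).trans (by omega)⟩
  let T : ℝ → Set (List Bool) := fun c => {w ∈ bad h | ∃ d, MaxFix g c d ∧ c ≤ aff w 0 ∧ aff w 1 ≤ d}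
  have hT : ∀ c, (T c).ncard ≤ A := by
    intro c
    by_cases hc : ∃ d, MaxFix g c d
    · obtain ⟨d, hd⟩ := hc
      refine (ncard_le_ncard ?_ (H.dyh.fin.subset (sep_subset _ _))).trans (hA c d hd)
      rintro w ⟨hw, d', hd', h1, h2⟩
      rw [hd'.right_unique hd] at h2
      exact ⟨hw, h1, h2⟩
    · have : T c = ∅ := by
        ext w
        simp only [mem_empty_iff_false, iff_false]
        rintro ⟨_, d, hd, _⟩
        exact hc ⟨d, hd⟩
      simp [this]
  have hcrit : (crit_finite H.dyg).toFinset.card ≤ G + 1 := by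
    rw [← ncard_eq_toFinset_card _ (crit_finite H.dyg)]
    refine (ncard_insert_le _ _).trans ?_
    have := ncard_image_le (f := mid) H.dyg.fin
    omega
  have hsub : bad h ⊆ (⋃ i ∈ Finset.range (K + 1), S i) ∪
      ⋃ c ∈ (crit_finite H.dyg).toFinset, T c := by
    intro w hw
    by_cases hg : Carries g w w
    · right
      obtain ⟨c, d, hm, h1, h2⟩ := exists_maxFix H.dyg (aff_mem_Icc w (by simp : (0 : ℝ) ∈ _)).1
        (aff_strictMono w one_pos) (aff_mem_Icc w (by simp : (1 : ℝ) ∈ _)).2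
        fun x h1 h2 => hg.fixed h1 h2
      simp only [mem_iUnion]
      exact ⟨c, (crit_finite H.dyg).mem_toFinset.2 (hm.left_mem H.dyg), hw, d, hm, h1, h2⟩
    · left
      obtain ⟨i, hi, h'⟩ := exists_carries_bad H (by omega) hdl (K := K) (by omega) hw hg
      simp only [mem_iUnion]
      exact ⟨i, by simp; omega, h'⟩
  have fin1 : (⋃ i ∈ Finset.range (K + 1), S i).Finite :=
    Set.Finite.biUnion (Finset.finite_toSet _) fun i _ => (hS i).1
  have fin2 : (⋃ c ∈ (crit_finite H.dyg).toFinset, T c).Finite :=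
    Set.Finite.biUnion (Finset.finite_toSet _) fun c _ => H.dyh.fin.subset (sep_subset _ _)
  have b1 : (⋃ i ∈ Finset.range (K + 1), S i).ncard ≤ (K + 1) * (G + (bad f⁻¹).ncard) := by
    refine (Finset.set_ncard_biUnion_le _ _).trans ?_
    refine (Finset.sum_le_card_nsmul _ _ _ fun i _ => (hS i).2).trans ?_
    simp
  have b2 : (⋃ c ∈ (crit_finite H.dyg).toFinset, T c).ncard ≤ (G + 1) * A := by
    refine (Finset.set_ncard_biUnion_le _ _).trans ?_
    refine (Finset.sum_le_card_nsmul _ _ _ fun i _ => hT i).trans ?_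
    rw [smul_eq_mul]
    exact Nat.mul_le_mul_right _ hcrit
  have := (ncard_le_ncard hsub (fin1.union fin2)).trans (ncard_union_le _ _)
  refine this.trans (add_le_add b1 b2)

lemma conj_of_mem (hf : f ∈ ThompsonF) (hg : g ∈ ThompsonF) (hh : h ∈ ThompsonF)
    (e : h⁻¹ * f * h = g) : Conj f g h :=
  ⟨dy_of_mem hf, dy_of_mem hg, dy_of_mem hh, by rw [← e]; group⟩

theorem conjDist_le (hf : f ∈ ThompsonF) (hg : g ∈ ThompsonF)
    (hc : ∃ h ∈ ThompsonF, h⁻¹ * f * h = g) {n : ℕ} (hn : wordLength f + wordLength g ≤ n) :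
    conjDist f g ≤ 2000 * (n + 1) ^ 2 := by
  obtain ⟨h, hh, e⟩ := hc
  obtain ⟨h', H', hN, hA⟩ := exists_good_conj (conj_of_mem hf hg hh e)
  have hb := ncard_bad_le H' hN hA
  have hw := mem_and_wordLength_le H'.dyh.fin H'.dyh.fix
  have h1 : conjDist f g ≤ wordLength h' :=
    Nat.sInf_le ⟨h', hw.1, by rw [mul_assoc, H'.comm]; group, rfl⟩
  have bf := (bad_of_mem hf).2
  have bg := (bad_of_mem hg).2
  have bi := (bad_of_mem (inv_mem hf)).2
  have wi := wordLength_inv hf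
  have k1 : (13 * ((bad f).ncard + (bad g).ncard) + 8) * ((bad g).ncard + (bad f⁻¹).ncard) ≤
      (39 * n + 8) * (3 * n) := Nat.mul_le_mul (by omega) (by omega)
  have k2 : ((bad g).ncard + 1) * (19 * ((bad f).ncard + (bad g).ncard + 2)) ≤
      (3 * n + 1) * (19 * (3 * n + 2)) := Nat.mul_le_mul (by omega) (by omega)
  have k3 : 6 * ((39 * n + 8) * (3 * n) + (3 * n + 1) * (19 * (3 * n + 2))) ≤ 2000 * (n + 1) ^ 2 := by
    ring_nf
    nlinarith [sq_nonneg (n : ℤ)]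
  calc conjDist f g ≤ 6 * (bad h').ncard := h1.trans hw.2
    _ ≤ 6 * ((39 * n + 8) * (3 * n) + (3 * n + 1) * (19 * (3 * n + 2))) := by omega
    _ ≤ _ := k3

lemma CLF_bddAbove (n : ℕ) : BddAbove {m | ∃ f g : Equiv.Perm ℝ, f ∈ ThompsonF ∧ g ∈ ThompsonF ∧
    (∃ h ∈ ThompsonF, h⁻¹ * f * h = g) ∧ wordLength f + wordLength g ≤ n ∧ conjDist f g = m} := by
  refine ⟨2000 * (n + 1) ^ 2, ?_⟩
  rintro m ⟨f, g, hf, hg, hc, hn, rfl⟩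
  exact conjDist_le hf hg hc hn

theorem CLF_le (n : ℕ) : CLF n ≤ 2000 * (n + 1) ^ 2 := by
  refine csSup_le' ?_
  rintro m ⟨f, g, hf, hg, hc, hn, rfl⟩
  exact conjDist_le hf hg hc hn

theorem conjDist_le_CLF (hf : f ∈ ThompsonF) (hg : g ∈ ThompsonF)
    (hc : ∃ h ∈ ThompsonF, h⁻¹ * f * h = g) {n : ℕ} (hn : wordLength f + wordLength g ≤ n) :
    conjDist f g ≤ CLF n :=
  le_csSup (CLF_bddAbove n) ⟨f, g, hf, hg, hc, hn, rfl⟩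

end

/-- Near `x` the map `p` is affine with slope `2 ^ k` on the right and `2 ^ l` on the left. -/
def Germ (p : Equiv.Perm ℝ) (x : ℝ) (k l : ℤ) : Prop :=
  ∃ ε > 0, ∀ s, 0 ≤ s → s ≤ ε → p (x + s) = p x + 2 ^ k * s ∧ p (x - s) = p x - 2 ^ l * s

namespace Germ
variable {p q : Equiv.Perm ℝ} {x : ℝ} {k l k' l' : ℤ}

lemma unique (h : Germ p x k l) (h' : Germ p x k' l') : k = k' ∧ l = l' := by
  obtain ⟨ε, hε, H⟩ := h
  obtain ⟨ε', hε', H'⟩ := h'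
  have hm : 0 < min ε ε' := lt_min hε hε'
  obtain ⟨a1, a2⟩ := H _ hm.le (min_le_left _ _)
  obtain ⟨b1, b2⟩ := H' _ hm.le (min_le_right _ _)
  have inj := zpow_right_injective₀ (a := (2 : ℝ)) (by norm_num) (by norm_num)
  exact ⟨inj (mul_right_cancel₀ hm.ne' (by linarith)), inj (mul_right_cancel₀ hm.ne' (by linarith))⟩

lemma mul (hp : Germ p (q x) k' l') (hq : Germ q x k l) : Germ (p * q) x (k' + k) (l' + l) := by
  obtain ⟨ε, hε, H⟩ := hp
  obtain ⟨ε', hε', H'⟩ := hq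
  have hk : (0 : ℝ) < 2 ^ k := by positivity
  have hl : (0 : ℝ) < 2 ^ l := by positivity
  refine ⟨min ε' (min (ε / 2 ^ k) (ε / 2 ^ l)), by positivity, fun s h0 h1 => ?_⟩
  simp only [le_min_iff, le_div_iff₀ hk, le_div_iff₀ hl] at h1
  obtain ⟨h1, h2, h3⟩ := h1
  obtain ⟨a1, a2⟩ := H' s h0 h1
  have b1 := (H (2 ^ k * s) (by positivity) (by linarith)).1
  have b2 := (H (2 ^ l * s) (by positivity) (by linarith)).2
  simp only [Equiv.Perm.mul_apply, a1, a2, b1, b2, zpow_add₀ (two_ne_zero' ℝ)]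
  exact ⟨by ring, by ring⟩

lemma inv (h : Germ p x k l) : Germ p⁻¹ (p x) (-k) (-l) := by
  obtain ⟨ε, hε, H⟩ := h
  have hk : (0 : ℝ) < 2 ^ k := by positivity
  have hl : (0 : ℝ) < 2 ^ l := by positivity
  refine ⟨min (2 ^ k * ε) (2 ^ l * ε), by positivity, fun s h0 h1 => ?_⟩
  obtain ⟨h1, h2⟩ := le_min_iff.1 h1
  have b1 := (H ((2 ^ k)⁻¹ * s) (by positivity) (by rwa [inv_mul_le_iff₀ hk])).1
  have b2 := (H ((2 ^ l)⁻¹ * s) (by positivity) (by rwa [inv_mul_le_iff₀ hl])).2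
  rw [mul_inv_cancel_left₀ hk.ne'] at b1
  rw [mul_inv_cancel_left₀ hl.ne'] at b2
  rw [← b1, ← b2, zpow_neg, zpow_neg]
  simp

lemma one (x : ℝ) : Germ 1 x 0 0 := ⟨1, one_pos, fun s _ _ => by simp⟩

lemma of_carries {u v u' v' : List Bool} (hr : Carries p u v) (hl : Carries p u' v')
    (hx : aff u 0 = x) (hx' : aff u' 1 = x) :
    Germ p x (u.length - v.length : ℤ) (u'.length - v'.length : ℤ) := by
  have hu : (0 : ℝ) < (1 / 2) ^ u.length := by positivity
  have hu' : (0 : ℝ) < (1 / 2) ^ u'.length := by positivity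
  have e : ∀ a b : ℕ, (2 : ℝ) ^ ((a : ℤ) - b) = ((1 / 2) ^ a)⁻¹ * (1 / 2) ^ b := fun a b => by
    rw [zpow_sub₀ two_ne_zero]
    simp [div_eq_mul_inv]
  refine ⟨min ((1 / 2) ^ u.length) ((1 / 2) ^ u'.length), lt_min hu hu', fun s h0 h1 => ?_⟩
  obtain ⟨h1, h2⟩ := le_min_iff.1 h1
  constructor
  · have a := hr (((1 / 2) ^ u.length)⁻¹ * s) ⟨by positivity, by rwa [inv_mul_le_iff₀ hu, mul_one]⟩
    have b := hr 0 (by simp)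
    rw [aff_eq u, aff_eq v, ← b, hx, mul_right_comm, inv_mul_cancel₀ hu.ne', one_mul] at a
    rw [a, e]
    ring
  · have a := hl (1 - ((1 / 2) ^ u'.length)⁻¹ * s)
      ⟨by rw [sub_nonneg, inv_mul_le_iff₀ hu', mul_one]; exact h2,
        by rw [sub_le_self_iff]; positivity⟩
    have b := hl 1 (by simp)
    rw [aff_one] at hx'
    have c : aff u' (1 - ((1 / 2) ^ u'.length)⁻¹ * s) = x - s := by
      rw [aff_eq, sub_mul, mul_right_comm, inv_mul_cancel₀ hu'.ne']
      linarith
    rw [c, aff_eq v'] at a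
    rw [aff_one, hx', aff_one] at b
    rw [a, b, e]
    ring

end Germ

lemma Germ.of_pieces {p : Equiv.Perm ℝ} {a b x c d : ℝ} {k l : ℤ} (ha : a < x) (hb : x < b)
    (hl : ∀ t, a ≤ t → t ≤ x → p t = 2 ^ l * t + c) (hr : ∀ t, x ≤ t → t ≤ b → p t = 2 ^ k * t + d) :
    Germ p x k l := by
  refine ⟨min (x - a) (b - x), lt_min (by linarith) (by linarith), fun s h0 h1 => ?_⟩
  obtain ⟨h1, h2⟩ := le_min_iff.1 h1
  constructor
  · rw [hr (x + s) (by linarith) (by linarith), hr x le_rfl hb.le]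
    ring
  · rw [hl (x - s) (by linarith) (by linarith), hl x ha.le le_rfl]
    ring

lemma germ_x0 : ∃ B : Finset ℝ, B.card ≤ 4 ∧
    ∀ x, ∃ k l, Germ x0 x k l ∧ |k| ≤ 1 ∧ |l| ≤ 1 ∧ (x ∉ B → k = l) := by
  refine ⟨{0, 1 / 2, 3 / 4, 1}, Finset.card_le_four, fun x => ?_⟩
  have e0 : ∀ t : ℝ, t ≤ 0 → x0 t = (2 : ℝ) ^ (0 : ℤ) * t + 0 := by
    intro t h0
    show x0fun t = _
    unfold x0fun
    split_ifs <;> norm_num <;> linarith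
  have e1 : ∀ t : ℝ, 0 ≤ t → t ≤ 1 / 2 → x0 t = (2 : ℝ) ^ (-1 : ℤ) * t + 0 := by
    intro t h0 h1
    show x0fun t = _
    unfold x0fun
    split_ifs <;> norm_num <;> linarith
  have e2 : ∀ t : ℝ, 1 / 2 ≤ t → t ≤ 3 / 4 → x0 t = (2 : ℝ) ^ (0 : ℤ) * t + (-1 / 4) := by
    intro t h0 h1
    show x0fun t = _
    unfold x0fun
    split_ifs <;> norm_num <;> linarith
  have e3 : ∀ t : ℝ, 3 / 4 ≤ t → t ≤ 1 → x0 t = (2 : ℝ) ^ (1 : ℤ) * t + (-1) := by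
    intro t h0 h1
    show x0fun t = _
    unfold x0fun
    split_ifs <;> norm_num <;> linarith
  have e4 : ∀ t : ℝ, 1 ≤ t → x0 t = (2 : ℝ) ^ (0 : ℤ) * t + 0 := by
    intro t h0
    show x0fun t = _
    unfold x0fun
    split_ifs <;> norm_num <;> linarith
  rcases lt_trichotomy x (0) with h0 | h0 | h0
  · exact ⟨0, 0, Germ.of_pieces (a := x - 1) (b := 0) (by linarith) h0 (fun t a b => e0 t (by linarith)) (fun t a b => e0 t (by linarith)),
      by simp, by simp, by simp⟩
  · exact ⟨-1, 0, Germ.of_pieces (a := x - 1) (b := 1 / 2) (by linarith) (by norm_num [h0]) (fun t a b => e0 t (by linarith)) (fun t a b => e1 t (by linarith) (by linarith)),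
      by simp, by simp, by simp [h0]⟩
  rcases lt_trichotomy x (1 / 2) with h1 | h1 | h1
  · exact ⟨-1, -1, Germ.of_pieces (a := 0) (b := 1 / 2) h0 h1 (fun t a b => e1 t (by linarith) (by linarith)) (fun t a b => e1 t (by linarith) (by linarith)),
      by simp, by simp, by simp⟩
  · exact ⟨0, -1, Germ.of_pieces (a := 0) (b := 3 / 4) h0 (by norm_num [h1]) (fun t a b => e1 t (by linarith) (by linarith)) (fun t a b => e2 t (by linarith) (by linarith)),
      by simp, by simp, by simp [h1]⟩
  rcases lt_trichotomy x (3 / 4) with h2 | h2 | h2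
  · exact ⟨0, 0, Germ.of_pieces (a := 1 / 2) (b := 3 / 4) h1 h2 (fun t a b => e2 t (by linarith) (by linarith)) (fun t a b => e2 t (by linarith) (by linarith)),
      by simp, by simp, by simp⟩
  · exact ⟨1, 0, Germ.of_pieces (a := 1 / 2) (b := 1) h1 (by norm_num [h2]) (fun t a b => e2 t (by linarith) (by linarith)) (fun t a b => e3 t (by linarith) (by linarith)),
      by simp, by simp, by simp [h2]⟩
  rcases lt_trichotomy x (1) with h3 | h3 | h3
  · exact ⟨1, 1, Germ.of_pieces (a := 3 / 4) (b := 1) h2 h3 (fun t a b => e3 t (by linarith) (by linarith)) (fun t a b => e3 t (by linarith) (by linarith)),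
      by simp, by simp, by simp⟩
  · exact ⟨0, 1, Germ.of_pieces (a := 3 / 4) (b := x + 1) h2 (by linarith) (fun t a b => e3 t (by linarith) (by linarith)) (fun t a b => e4 t (by linarith)),
      by simp, by simp, by simp [h3]⟩
  exact ⟨0, 0, Germ.of_pieces (a := 1) (b := x + 1) h3 (by linarith) (fun t a b => e4 t (by linarith)) (fun t a b => e4 t (by linarith)),
    by simp, by simp, by simp⟩

lemma germ_x1 : ∃ B : Finset ℝ, B.card ≤ 4 ∧
    ∀ x, ∃ k l, Germ x1 x k l ∧ |k| ≤ 1 ∧ |l| ≤ 1 ∧ (x ∉ B → k = l) := by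
  refine ⟨{1 / 2, 3 / 4, 7 / 8, 1}, Finset.card_le_four, fun x => ?_⟩
  have e0 : ∀ t : ℝ, t ≤ 1 / 2 → x1 t = (2 : ℝ) ^ (0 : ℤ) * t + 0 := by
    intro t h0
    show x1fun t = _
    unfold x1fun
    split_ifs <;> norm_num
  have e1 : ∀ t : ℝ, 1 / 2 ≤ t → t ≤ 3 / 4 → x1 t = (2 : ℝ) ^ (-1 : ℤ) * t + 1 / 4 := by
    intro t h0 h1
    show x1fun t = _
    unfold x1fun
    split_ifs <;> norm_num <;> linarith
  have e2 : ∀ t : ℝ, 3 / 4 ≤ t → t ≤ 7 / 8 → x1 t = (2 : ℝ) ^ (0 : ℤ) * t + (-1 / 8) := by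
    intro t h0 h1
    show x1fun t = _
    unfold x1fun
    split_ifs <;> norm_num <;> linarith
  have e3 : ∀ t : ℝ, 7 / 8 ≤ t → t ≤ 1 → x1 t = (2 : ℝ) ^ (1 : ℤ) * t + (-1) := by
    intro t h0 h1
    show x1fun t = _
    unfold x1fun
    split_ifs <;> norm_num <;> linarith
  have e4 : ∀ t : ℝ, 1 ≤ t → x1 t = (2 : ℝ) ^ (0 : ℤ) * t + 0 := by
    intro t h0
    show x1fun t = _
    unfold x1fun
    split_ifs <;> norm_num <;> linarith
  rcases lt_trichotomy x (1 / 2) with h0 | h0 | h0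
  · exact ⟨0, 0, Germ.of_pieces (a := x - 1) (b := 1 / 2) (by linarith) h0 (fun t a b => e0 t (by linarith)) (fun t a b => e0 t (by linarith)),
      by simp, by simp, by simp⟩
  · exact ⟨-1, 0, Germ.of_pieces (a := x - 1) (b := 3 / 4) (by linarith) (by norm_num [h0]) (fun t a b => e0 t (by linarith)) (fun t a b => e1 t (by linarith) (by linarith)),
      by simp, by simp, by simp [h0]⟩
  rcases lt_trichotomy x (3 / 4) with h1 | h1 | h1
  · exact ⟨-1, -1, Germ.of_pieces (a := 1 / 2) (b := 3 / 4) h0 h1 (fun t a b => e1 t (by linarith) (by linarith)) (fun t a b => e1 t (by linarith) (by linarith)),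
      by simp, by simp, by simp⟩
  · exact ⟨0, -1, Germ.of_pieces (a := 1 / 2) (b := 7 / 8) h0 (by norm_num [h1]) (fun t a b => e1 t (by linarith) (by linarith)) (fun t a b => e2 t (by linarith) (by linarith)),
      by simp, by simp, by simp [h1]⟩
  rcases lt_trichotomy x (7 / 8) with h2 | h2 | h2
  · exact ⟨0, 0, Germ.of_pieces (a := 3 / 4) (b := 7 / 8) h1 h2 (fun t a b => e2 t (by linarith) (by linarith)) (fun t a b => e2 t (by linarith) (by linarith)),
      by simp, by simp, by simp⟩
  · exact ⟨1, 0, Germ.of_pieces (a := 3 / 4) (b := 1) h1 (by norm_num [h2]) (fun t a b => e2 t (by linarith) (by linarith)) (fun t a b => e3 t (by linarith) (by linarith)),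
      by simp, by simp, by simp [h2]⟩
  rcases lt_trichotomy x (1) with h3 | h3 | h3
  · exact ⟨1, 1, Germ.of_pieces (a := 7 / 8) (b := 1) h2 h3 (fun t a b => e3 t (by linarith) (by linarith)) (fun t a b => e3 t (by linarith) (by linarith)),
      by simp, by simp, by simp⟩
  · exact ⟨0, 1, Germ.of_pieces (a := 7 / 8) (b := x + 1) h2 (by linarith) (fun t a b => e3 t (by linarith) (by linarith)) (fun t a b => e4 t (by linarith)),
      by simp, by simp, by simp [h3]⟩
  exact ⟨0, 0, Germ.of_pieces (a := 1) (b := x + 1) h3 (by linarith) (fun t a b => e4 t (by linarith)) (fun t a b => e4 t (by linarith)),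
    by simp, by simp, by simp⟩

lemma germ_inv {p : Equiv.Perm ℝ} (H : ∃ B : Finset ℝ, B.card ≤ 4 ∧
      ∀ x, ∃ k l, Germ p x k l ∧ |k| ≤ 1 ∧ |l| ≤ 1 ∧ (x ∉ B → k = l)) :
    ∃ B : Finset ℝ, B.card ≤ 4 ∧
      ∀ x, ∃ k l, Germ p⁻¹ x k l ∧ |k| ≤ 1 ∧ |l| ≤ 1 ∧ (x ∉ B → k = l) := by
  classical
  obtain ⟨B, hB, H⟩ := H
  refine ⟨B.image p, Finset.card_image_le.trans hB, fun x => ?_⟩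
  obtain ⟨k, l, h1, h2, h3, h4⟩ := H (p⁻¹ x)
  have e : p (p⁻¹ x) = x := by simp
  refine ⟨-k, -l, by simpa [e] using h1.inv, by rwa [abs_neg], by rwa [abs_neg], fun hx => ?_⟩
  rw [h4]
  intro hmem
  exact hx (Finset.mem_image.2 ⟨_, hmem, e⟩)

lemma germ_gens {g : Equiv.Perm ℝ} (hg : g ∈ gens) : ∃ B : Finset ℝ, B.card ≤ 4 ∧
    ∀ x, ∃ k l, Germ g x k l ∧ |k| ≤ 1 ∧ |l| ≤ 1 ∧ (x ∉ B → k = l) := by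
  rcases hg with rfl | rfl | rfl | rfl
  exacts [germ_x0, germ_x1, germ_inv germ_x0, germ_inv germ_x1]

lemma exists_germ {p : Equiv.Perm ℝ} (hp : p ∈ ThompsonF) (x : ℝ) :
    ∃ k l, Germ p x k l ∧ |k| ≤ wordLength p ∧ |l| ≤ wordLength p := by
  refine induction_on_word (P := fun p n => ∃ k l, Germ p x k l ∧ |k| ≤ (n : ℤ) ∧ |l| ≤ (n : ℤ))
    ⟨0, 0, Germ.one x, by simp, by simp⟩ ?_ hp
  rintro g hg p _ n ⟨k, l, h, hk, hl⟩
  obtain ⟨B, _, H⟩ := germ_gens hg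
  obtain ⟨k', l', h', hk', hl', _⟩ := H (p x)
  refine ⟨k' + k, l' + l, h'.mul h, ?_, ?_⟩
  · have := abs_add_le k' k; push_cast; omega
  · have := abs_add_le l' l; push_cast; omega

open Classical in
/-- The jump of the logarithm of the slope of `p` at `x`. -/
def jump (p : Equiv.Perm ℝ) (x : ℝ) : ℤ :=
  if h : ∃ j, ∃ k l, Germ p x k l ∧ k - l = j then h.choose else 0

lemma Germ.jump_eq {p : Equiv.Perm ℝ} {x : ℝ} {k l : ℤ} (h : Germ p x k l) : jump p x = k - l := by
  have hex : ∃ j, ∃ k l, Germ p x k l ∧ k - l = j := ⟨_, k, l, h, rfl⟩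
  rw [jump, dif_pos hex]
  obtain ⟨k', l', h', e⟩ := hex.choose_spec
  rw [← e, (h.unique h').1, (h.unique h').2]

lemma jump_mul {p q : Equiv.Perm ℝ} (hp : p ∈ ThompsonF) (hq : q ∈ ThompsonF) (x : ℝ) :
    jump (p * q) x = jump p (q x) + jump q x := by
  obtain ⟨k, l, h, _⟩ := exists_germ hq x
  obtain ⟨k', l', h', _⟩ := exists_germ hp (q x)
  rw [h.jump_eq, h'.jump_eq, (h'.mul h).jump_eq]
  ring

/-- The total variation of the logarithm of the slope is controlled by the word length. -/
lemma sum_abs_jump_le {p : Equiv.Perm ℝ} (hp : p ∈ ThompsonF) (P : Finset ℝ) :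
    ∑ x ∈ P, |jump p x| ≤ 8 * wordLength p := by
  classical
  revert P
  refine induction_on_word (P := fun p n => ∀ P : Finset ℝ, ∑ x ∈ P, |jump p x| ≤ 8 * (n : ℤ))
    ?_ ?_ hp
  · intro P
    simp [(Germ.one _).jump_eq]
  · intro g hg p hp n ih P
    have h1 : ∑ x ∈ P, |jump g (p x)| ≤ 8 := by
      obtain ⟨B, hB, H⟩ := germ_gens hg
      rw [← Finset.sum_image (f := fun y => |jump g y|) (p.injective.injOn)]
      rw [← Finset.sum_filter_add_sum_filter_not _ (· ∈ B)]
      rw [Finset.sum_eq_zero (s := Finset.filter (· ∉ B) _), add_zero]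
      · refine (Finset.sum_le_card_nsmul _ _ 2 ?_).trans ?_
        · intro y _
          obtain ⟨k, l, h, hk, hl, _⟩ := H y
          rw [h.jump_eq]
          have := abs_sub k l
          omega
        · have h2 : (Finset.filter (· ∈ B) (P.image p)).card ≤ B.card :=
            Finset.card_le_card fun y hy => (Finset.mem_filter.1 hy).2
          rw [nsmul_eq_mul]
          have : ((Finset.filter (· ∈ B) (P.image p)).card : ℤ) ≤ 4 := by exact_mod_cast h2.trans hB
          linarith
      · intro y hy
        obtain ⟨k, l, h, _, _, hkl⟩ := H y
        rw [h.jump_eq, hkl (Finset.mem_filter.1 hy).2]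
        simp
    calc ∑ x ∈ P, |jump (g * p) x| ≤ ∑ x ∈ P, (|jump g (p x)| + |jump p x|) :=
          Finset.sum_le_sum fun x _ => by
            rw [jump_mul (gens_subset hg) hp]
            exact abs_add_le _ _
      _ ≤ 8 + 8 * n := by rw [Finset.sum_add_distrib]; exact add_le_add h1 (ih P)
      _ = _ := by push_cast; ring

lemma x0_mem : x0 ∈ ThompsonF := gens_subset x0_mem_gens
lemma x1_mem : x1 ∈ ThompsonF := gens_subset x1_mem_gens

lemma x0_of_mem {t : ℝ} (h0 : 0 ≤ t) (h1 : t ≤ 1 / 2) : x0 t = t / 2 := by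
  show x0fun t = _
  unfold x0fun
  split_ifs <;> linarith

lemma x0_one_sub {s : ℝ} (h0 : 0 ≤ s) (h1 : s ≤ 1 / 4) : x0 (1 - s) = 1 - 2 * s := by
  show x0fun _ = _
  unfold x0fun
  split_ifs <;> linarith

lemma x1_of_le {t : ℝ} (h1 : t ≤ 1 / 2) : x1 t = t := by
  show x1fun t = _
  unfold x1fun
  split_ifs <;> linarith

lemma x1_one_sub {s : ℝ} (h0 : 0 ≤ s) (h1 : s ≤ 1 / 8) : x1 (1 - s) = 1 - 2 * s := by
  show x1fun _ = _
  unfold x1fun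
  split_ifs <;> linarith

lemma pow_apply_of_fixed {p : Equiv.Perm ℝ} {t : ℝ} (h : p t = t) (n : ℕ) : (p ^ n) t = t := by
  induction n with
  | zero => simp
  | succ n ih => rw [pow_succ, Equiv.Perm.mul_apply, h, ih]

lemma jump_one (x : ℝ) : jump 1 x = 0 := by simp [(Germ.one x).jump_eq]

lemma jump_inv {p : Equiv.Perm ℝ} (hp : p ∈ ThompsonF) (x : ℝ) : jump p⁻¹ (p x) = -jump p x := by
  have h := jump_mul (inv_mem hp) hp x
  rw [inv_mul_cancel, jump_one] at h
  linarith

lemma jump_pow_of_fixed {p : Equiv.Perm ℝ} (hp : p ∈ ThompsonF) {x : ℝ} (h : p x = x) (n : ℕ) :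
    jump (p ^ n) x = n * jump p x := by
  induction n with
  | zero => simp [jump_one]
  | succ n ih =>
    rw [pow_succ, jump_mul (pow_mem hp n) hp, h, ih]
    push_cast
    ring

lemma jump_conj_of_fixed {p q : Equiv.Perm ℝ} (hp : p ∈ ThompsonF) (hq : q ∈ ThompsonF) {x : ℝ}
    (h : p x = x) : jump (q * p * q⁻¹) (q x) = jump p x := by
  have e : q⁻¹ (q x) = x := by simp
  rw [jump_mul (mul_mem hq hp) (inv_mem hq), jump_mul hq hp, e, h, jump_inv hq]
  ring

lemma jump_eq_zero_of_affine {p : Equiv.Perm ℝ} {a b x : ℝ} {k : ℤ} (ha : a < x) (hb : x < b)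
    (h : ∀ t, a ≤ t → t ≤ b → p t = 2 ^ k * t) : jump p x = 0 := by
  have H : Germ p x k k := Germ.of_pieces (c := 0) (d := 0) ha hb
    (fun t h1 h2 => by rw [h t h1 (by linarith), add_zero])
    (fun t h1 h2 => by rw [h t (by linarith) h2, add_zero])
  rw [H.jump_eq, sub_self]

lemma jump_eq_zero_of_fixed {p : Equiv.Perm ℝ} {a b x : ℝ} (ha : a < x) (hb : x < b)
    (h : ∀ t, a ≤ t → t ≤ b → p t = t) : jump p x = 0 :=
  jump_eq_zero_of_affine (k := 0) ha hb fun t h1 h2 => by simpa using h t h1 h2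

/-- An element of `F` supported on `[1 / 4, 1 / 2]`. -/
def psi : Equiv.Perm ℝ := x0 * x1 * x1 * x0⁻¹ * x1⁻¹ * x0 * x1⁻¹ * x0⁻¹

lemma psi_eq : psi = [x0, x1, x1, x0⁻¹, x1⁻¹, x0, x1⁻¹, x0⁻¹].prod := by
  simp [psi, mul_assoc]

lemma psi_word : ∀ g ∈ [x0, x1, x1, x0⁻¹, x1⁻¹, x0, x1⁻¹, x0⁻¹], g ∈ gens := by
  simp [gens]

lemma psi_mem : psi ∈ ThompsonF := psi_eq ▸ prod_mem psi_word

lemma wordLength_psi : wordLength psi ≤ 8 := psi_eq ▸ wordLength_prod_le psi_word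

lemma carries_psi_inner_left : Carries psi [false, true, false] [false, true, false, false] := by
  have h1 : Carries x0⁻¹ [false, true, false] [true, false, false] := carries_x0_mid.inv.append [false]
  have h2 : Carries x1⁻¹ [true, false, false] [true, false] := carries_x1_mid.inv
  have h3 : Carries x1⁻¹ [false, true] [false, true] := carries_x1_left.inv.append [true]
  have h4 : Carries x1 [true, false, false] [true, false, false, false] := carries_x1_mid.append [false]
  have h5 : Carries x0 [true, false, false, false] [false, true, false, false] :=
    carries_x0_mid.append [false, false]
  exact ((((((h5.mul h4).mul carries_x1_mid).mul carries_x0_mid.inv).mul h3).mul carries_x0_mid).mul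
    h2).mul h1

lemma carries_psi_inner_right : Carries psi [false, true, true, true] [false, true, true] := by
  have h1 : Carries x0⁻¹ [false, true, true, true] [true, false, true, true] :=
    carries_x0_mid.inv.append [true, true]
  have h2 : Carries x1⁻¹ [true, false, true, true] [true, true, false, true] :=
    carries_x1_mid'.inv.append [true]
  have h3 : Carries x0 [true, true, false, true] [true, false, true] :=
    carries_x0_right.append [false, true]
  have h4 : Carries x1⁻¹ [true, false, true] [true, true, false] := carries_x1_mid'.inv
  have h5 : Carries x0⁻¹ [true, true, false] [true, true, true, false] :=
    carries_x0_right.inv.append [true, false]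
  have h6 : Carries x1 [true, true, true, false] [true, true, false] :=
    carries_x1_right.append [false]
  have h7 : Carries x0 [true, false, true] [false, true, true] := carries_x0_mid.append [true]
  exact ((((((h7.mul carries_x1_mid').mul h6).mul h5).mul h4).mul h3).mul h2).mul h1

lemma carries_psi_left : Carries psi [false, false] [false, false] :=
  ((((((carries_x0_left.mul carries_x1_left).mul carries_x1_left).mul carries_x0_left.inv).mul
    (carries_x1_left.inv.append [false])).mul carries_x0_left).mul carries_x1_left.inv).mul
    carries_x0_left.inv

lemma carries_psi_right : Carries psi [true] [true] := by
  have h : Carries x0⁻¹ [true, true] [true, true, true] := carries_x0_right.inv.append [true]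
  have h4 : Carries x1⁻¹ [true, true, true] [true, true, true, true] :=
    carries_x1_right.inv.append [true]
  have h5 : Carries x0 [true, true, true, true] [true, true, true] :=
    carries_x0_right.append [true, true]
  have h6 : Carries x0⁻¹ [true, true, true] [true, true, true, true] :=
    carries_x0_right.inv.append [true, true]
  have h7 : Carries x1 [true, true, true, true] [true, true, true] := carries_x1_right.append [true]
  have h8 : Carries x0 [true, true, true] [true, true] := carries_x0_right.append [true]
  exact ((((((carries_x0_right.mul carries_x1_right).mul h7).mul h6).mul carries_x1_right.inv).mul
    h8).mul carries_x1_right.inv).mul carries_x0_right.inv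

lemma psi_apply {t : ℝ} (ht : t ∉ Ioo (1 / 4 : ℝ) (1 / 2)) : psi t = t := by
  by_cases h : t ∈ Ioo (0 : ℝ) 1
  · by_cases h' : 1 / 4 < t
    · have h2 : 1 / 2 ≤ t := by
        by_contra hc
        exact ht ⟨h', not_le.1 hc⟩
      exact carries_psi_right.fixed (by norm_num [aff]; linarith) (by norm_num [aff]; linarith [h.2])
    · push Not at h'
      exact carries_psi_left.fixed (by norm_num [aff]; linarith [h.1]) (by norm_num [aff]; linarith)
  · exact (dy_of_mem psi_mem).fix t h

lemma jump_psi_left : jump psi (1 / 4) = -1 := by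
  have h := Germ.of_carries (x := 1 / 4) carries_psi_inner_left carries_psi_left
    (by norm_num [aff]) (by norm_num [aff])
  rw [h.jump_eq]
  simp

lemma jump_psi_right : jump psi (1 / 2) = -1 := by
  have h := Germ.of_carries (x := 1 / 2) carries_psi_right carries_psi_inner_right
    (by norm_num [aff]) (by norm_num [aff])
  rw [h.jump_eq]
  simp

lemma x0_pow_apply (m : ℕ) {t : ℝ} (h0 : 0 ≤ t) (h1 : t ≤ 1 / 2) :
    (x0 ^ m) t = (1 / 2) ^ m * t := by
  induction m with
  | zero => simp
  | succ m ih =>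
    have hp : (1 / 2 : ℝ) ^ m ≤ 1 := pow_le_one₀ (by norm_num) (by norm_num)
    rw [pow_succ', Equiv.Perm.mul_apply, ih, x0_of_mem (by positivity) (by nlinarith)]
    ring

lemma x1_pow_one_sub (n : ℕ) {s : ℝ} (h0 : 0 ≤ s) (h1 : s ≤ 1 / 4) :
    (x1 ^ n) (1 - (1 / 2) ^ n * s) = 1 - s := by
  induction n with
  | zero => simp
  | succ n ih =>
    have hp : (1 / 2 : ℝ) ^ n ≤ 1 := pow_le_one₀ (by norm_num) (by norm_num)
    rw [pow_succ, Equiv.Perm.mul_apply, x1_one_sub (by positivity)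
      (by rw [pow_succ]; nlinarith), ← ih]
    congr 1
    ring

/-- The `n`-th power of `psi`, transported to `[2 ^ (-m - 2), 2 ^ (-m - 1)]`. -/
def spike (n m : ℕ) : Equiv.Perm ℝ := x0 ^ m * psi ^ n * (x0 ^ m)⁻¹

/-- A map attracting `(0, 1)` to `0`, with slope `2 ^ (n + 1)` at `1`. -/
def shrink (n : ℕ) : Equiv.Perm ℝ := x0 * x1 ^ n

/-- The maps `shrink n` perturbed by a spike; for fixed `n` they are all conjugate. -/
def twisted (n m : ℕ) : Equiv.Perm ℝ := shrink n * spike n m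

lemma spike_mem (n m : ℕ) : spike n m ∈ ThompsonF :=
  mul_mem (mul_mem (pow_mem x0_mem m) (pow_mem psi_mem n)) (inv_mem (pow_mem x0_mem m))

lemma shrink_mem (n : ℕ) : shrink n ∈ ThompsonF := mul_mem x0_mem (pow_mem x1_mem n)

lemma twisted_mem (n m : ℕ) : twisted n m ∈ ThompsonF := mul_mem (shrink_mem n) (spike_mem n m)

lemma wordLength_twisted (n m : ℕ) : wordLength (twisted n m) ≤ 2 * m + 9 * n + 1 := by
  have h0 := wordLength_gens x0_mem_gens
  have h1 := wordLength_gens x1_mem_gens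
  have a1 := wordLength_mul (shrink_mem n) (spike_mem n m)
  have a2 := wordLength_mul x0_mem (pow_mem x1_mem n)
  have a3 := wordLength_mul (mul_mem (pow_mem x0_mem m) (pow_mem psi_mem n))
    (inv_mem (pow_mem x0_mem m))
  have a4 := wordLength_mul (pow_mem x0_mem m) (pow_mem psi_mem n)
  have a5 := wordLength_inv (pow_mem x0_mem m)
  have a6 := (wordLength_pow x0_mem m).trans (Nat.mul_le_mul_left m h0)
  have a7 := (wordLength_pow psi_mem n).trans (Nat.mul_le_mul_left n wordLength_psi)
  have a8 := (wordLength_pow x1_mem n).trans (Nat.mul_le_mul_left n h1)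
  unfold twisted
  unfold shrink spike at *
  omega

lemma spike_apply {n m : ℕ} {t : ℝ} (ht : t ∉ Ioo ((1 / 2 : ℝ) ^ (m + 2)) ((1 / 2) ^ (m + 1))) :
    spike n m t = t := by
  obtain ⟨s, rfl⟩ := (x0 ^ m).surjective t
  have hs : psi s = s := by
    apply psi_apply
    rintro ⟨h1, h2⟩
    have hm := (dy_of_mem (pow_mem x0_mem m)).mono
    have a1 := hm h1
    have a2 := hm h2
    rw [x0_pow_apply m (by norm_num) (by norm_num)] at a1
    rw [x0_pow_apply m (t := 1 / 2) (by norm_num) (by norm_num)] at a2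
    exact ht ⟨by convert a1 using 1; ring, by convert a2 using 1; ring⟩
  have e : (x0 ^ m)⁻¹ ((x0 ^ m) s) = s := by simp
  rw [spike, Equiv.Perm.mul_apply, Equiv.Perm.mul_apply, e, pow_apply_of_fixed hs]

lemma jump_spike_outer (n m : ℕ) : jump (spike n m) ((1 / 2) ^ (m + 1)) = -n := by
  have h : psi (1 / 2) = 1 / 2 := psi_apply (by simp)
  have := jump_conj_of_fixed (pow_mem psi_mem n) (pow_mem x0_mem m) (pow_apply_of_fixed h n)
  rw [x0_pow_apply m (by norm_num) (by norm_num), jump_pow_of_fixed psi_mem h, jump_psi_right,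
    ← pow_succ] at this
  rw [spike, this]
  ring

lemma jump_spike_inner (n m : ℕ) : jump (spike n m) ((1 / 2) ^ (m + 2)) = -n := by
  have h : psi (1 / 4) = 1 / 4 := psi_apply (by simp)
  have := jump_conj_of_fixed (pow_mem psi_mem n) (pow_mem x0_mem m) (pow_apply_of_fixed h n)
  have e : (1 / 2 : ℝ) ^ m * (1 / 4) = (1 / 2) ^ (m + 2) := by ring
  rw [x0_pow_apply m (by norm_num) (by norm_num), jump_pow_of_fixed psi_mem h, jump_psi_left,
    e] at this
  rw [spike, this]
  ring

lemma half_pow_lt {a b : ℕ} (h : a < b) : (1 / 2 : ℝ) ^ b < (1 / 2) ^ a :=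
  pow_lt_pow_right_of_lt_one₀ (by norm_num) (by norm_num) h

lemma half_pow_le {a b : ℕ} (h : a ≤ b) : (1 / 2 : ℝ) ^ b ≤ (1 / 2) ^ a :=
  pow_le_pow_of_le_one (by norm_num) (by norm_num) h

lemma jump_spike (n m j : ℕ) (hj : 1 ≤ j) :
    jump (spike n m) ((1 / 2) ^ (j + 1)) = if j = m ∨ j = m + 1 then -(n : ℤ) else 0 := by
  split_ifs with h
  · rcases h with rfl | rfl
    exacts [jump_spike_outer n _, jump_spike_inner n m]
  · push Not at h
    rcases lt_or_ge j m with h' | h'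
    · refine jump_eq_zero_of_fixed (half_pow_lt (show j + 1 < m + 1 by omega))
        (half_pow_lt (show 0 < j + 1 by omega)) fun t h1 _ => spike_apply fun h2 => ?_
      linarith [h2.2]
    · refine jump_eq_zero_of_fixed (show (0 : ℝ) < (1 / 2) ^ (j + 1) by positivity)
        (half_pow_lt (show m + 2 < j + 1 by omega)) fun t _ h1 => spike_apply fun h2 => ?_
      linarith [h2.1]

lemma shrink_apply (n : ℕ) {t : ℝ} (h0 : 0 ≤ t) (h1 : t ≤ 1 / 2) : shrink n t = t / 2 := by
  rw [shrink, Equiv.Perm.mul_apply, pow_apply_of_fixed (x1_of_le h1), x0_of_mem h0 h1]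

lemma shrink_one_sub (n : ℕ) {s : ℝ} (h0 : 0 ≤ s) (h1 : s ≤ 1 / 2) :
    shrink n (1 - (1 / 2) ^ (n + 1) * s) = 1 - s := by
  have := x1_pow_one_sub n (s := s / 2) (by linarith) (by linarith)
  have e : (1 / 2 : ℝ) ^ (n + 1) * s = (1 / 2) ^ n * (s / 2) := by ring
  rw [shrink, Equiv.Perm.mul_apply, e, this, x0_one_sub (by linarith) (by linarith)]
  ring

lemma shrink_mul_spike (n m : ℕ) : shrink n * spike n m = spike n (m + 1) * shrink n := by
  have hd : Equiv.Perm.Disjoint (x1 ^ n) (spike n m) := by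
    intro t
    rcases le_or_gt t (1 / 2) with h | h
    · exact Or.inl (pow_apply_of_fixed (x1_of_le h) n)
    · refine Or.inr (spike_apply fun h' => ?_)
      have := half_pow_le (show 1 ≤ m + 1 by omega)
      linarith [h'.2]
  have e := hd.commute.eq
  rw [shrink, mul_assoc, e, spike, spike, pow_succ']
  group

lemma exists_conj_twisted (n m : ℕ) :
    ∃ h ∈ ThompsonF, h⁻¹ * twisted n 0 * h = twisted n m := by
  induction m with
  | zero => exact ⟨1, one_mem _, by simp⟩
  | succ m ih =>
    obtain ⟨h, hh, e⟩ := ih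
    refine ⟨h * spike n (m + 1), mul_mem hh (spike_mem n _), ?_⟩
    calc (h * spike n (m + 1))⁻¹ * twisted n 0 * (h * spike n (m + 1))
        = (spike n (m + 1))⁻¹ * (h⁻¹ * twisted n 0 * h) * spike n (m + 1) := by group
      _ = twisted n (m + 1) := by
        rw [e, twisted, shrink_mul_spike, twisted]
        group

/-- The orbit of `1 / 2` under `shrink n`. -/
def orb (n : ℕ) (j : ℤ) : ℝ := (shrink n ^ j) (1 / 2)

lemma orb_succ (n : ℕ) (j : ℤ) : orb n (j + 1) = shrink n (orb n j) := zpow_succ_apply _ _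

lemma orb_natCast (n i : ℕ) : orb n i = (1 / 2) ^ (i + 1) := by
  induction i with
  | zero => simp [orb]
  | succ i ih =>
    have := half_pow_le (show 1 ≤ i + 1 by omega)
    push_cast
    rw [orb_succ, ih, shrink_apply n (by positivity) (by linarith)]
    ring

lemma orb_neg (n i : ℕ) : orb n (-i) = 1 - (1 / 2) ^ ((n + 1) * i + 1) := by
  induction i with
  | zero => norm_num [orb]
  | succ i ih =>
    have e : shrink n (orb n (-(i + 1 : ℕ))) = orb n (-i) := by
      rw [← orb_succ]
      congr 1
      push_cast
      ring
    have := half_pow_le (show 1 ≤ (n + 1) * i + 1 by omega)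
    have e' := shrink_one_sub n (s := (1 / 2) ^ ((n + 1) * i + 1)) (by positivity) (by linarith)
    rw [ih, ← e'] at e
    rw [(shrink n).injective e]
    ring

lemma spike_orb (n m : ℕ) (j : ℤ) : spike n m (orb n j) = orb n j := by
  apply spike_apply
  rintro ⟨h1, h2⟩
  obtain ⟨i, rfl | rfl⟩ := j.eq_nat_or_neg
  · rw [orb_natCast] at h1 h2
    have a1 := (pow_lt_pow_iff_right_of_lt_one₀ (by norm_num : (0 : ℝ) < 1 / 2) (by norm_num)).1 h1
    have a2 := (pow_lt_pow_iff_right_of_lt_one₀ (by norm_num : (0 : ℝ) < 1 / 2) (by norm_num)).1 h2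
    omega
  · rw [orb_neg] at h2
    have := half_pow_le (show 1 ≤ (n + 1) * i + 1 by omega)
    have := half_pow_le (show 1 ≤ m + 1 by omega)
    linarith

lemma twisted_orb (n m : ℕ) (j : ℤ) : twisted n m (orb n j) = orb n (j + 1) := by
  rw [twisted, Equiv.Perm.mul_apply, spike_orb, orb_succ]

lemma zpow_twisted_orb (n m : ℕ) (j z : ℤ) : (twisted n m ^ z) (orb n j) = orb n (j + z) := by
  induction z with
  | zero => simp
  | succ i ih => rw [zpow_succ_apply, ih, twisted_orb, add_assoc]
  | pred i ih =>
    apply (twisted n m).injective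
    rw [← zpow_succ_apply, twisted_orb, sub_add_cancel, ih]
    congr 1
    ring

lemma jump_twisted (n m j : ℕ) (hj : 1 ≤ j) :
    jump (twisted n m) (orb n j) = if j = m ∨ j = m + 1 then -(n : ℤ) else 0 := by
  rw [twisted, jump_mul (shrink_mem n) (spike_mem n m), spike_orb, orb_natCast, jump_spike n m j hj,
    jump_eq_zero_of_affine (k := -1) (a := 0) (b := 1 / 2) (by positivity), zero_add]
  · simpa using half_pow_lt (show 1 < j + 1 by omega)
  · intro t h0 h1
    rw [shrink_apply n h0 h1, zpow_neg_one]
    ring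

lemma exists_half_pow_lt {ε : ℝ} (hε : 0 < ε) : ∃ M : ℕ, ∀ i ≥ M, (1 / 2 : ℝ) ^ i < ε := by
  obtain ⟨M, hM⟩ := exists_pow_lt_of_lt_one hε (by norm_num : (1 / 2 : ℝ) < 1)
  exact ⟨M, fun i hi => (half_pow_le hi).trans_lt hM⟩

lemma exists_conj_orb {n m : ℕ} {h : Equiv.Perm ℝ} (hh : h ∈ ThompsonF)
    (H : Conj (twisted n 0) (twisted n m) h) : ∃ k : ℤ, ∀ j, h (orb n j) = orb n (j + k) := by
  obtain ⟨κ, _, ⟨ε, hε, hg⟩, -⟩ := exists_germ hh 0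
  obtain ⟨M, hM⟩ := exists_half_pow_lt hε
  obtain ⟨i, e, hi⟩ : ∃ i j : ℕ, (j : ℤ) = i - κ ∧ M ≤ i :=
    ⟨M + κ.toNat, (M + κ.toNat - κ).toNat, by push_cast; omega, by omega⟩
  have hbase : h (orb n i) = orb n (i - κ) := by
    have := (hg ((1 / 2) ^ (i + 1)) (by positivity) (hM _ (by omega)).le).1
    rw [zero_add, H.dyh.map_zero, zero_add] at this
    rw [orb_natCast, this, ← hi.1, orb_natCast]
    have e2 : ∀ a : ℕ, (1 / 2 : ℝ) ^ a = 2 ^ (-(a : ℤ)) := fun a => by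
      rw [zpow_neg, zpow_natCast]
      simp
    rw [e2, e2, ← zpow_add₀ two_ne_zero]
    congr 1
    push_cast
    omega
  refine ⟨-κ, fun j => ?_⟩
  have := H.zpow_apply (n := j - i) (t := orb n i)
  rw [hbase, zpow_twisted_orb, zpow_twisted_orb] at this
  rw [show (i : ℤ) + (j - i) = j by ring] at this
  rw [← this]
  congr 1
  ring

lemma le_wordLength_of_neg {n : ℕ} {h : Equiv.Perm ℝ} (hh : h ∈ ThompsonF) {K : ℕ}
    (hk : ∀ j, h (orb n j) = orb n (j + -K)) : (n + 1) * K ≤ wordLength h := by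
  obtain ⟨_, l, ⟨ε, hε, hg⟩, -, hl⟩ := exists_germ hh 1
  obtain ⟨i, hi⟩ := exists_half_pow_lt hε
  have h1 : i ≤ (n + 1) * i + 1 := by nlinarith
  have := (hg ((1 / 2) ^ ((n + 1) * i + 1)) (by positivity) (hi _ h1).le).2
  have e : h (orb n (-i)) = orb n (-(i + K : ℕ)) := by
    rw [hk]
    congr 1
    push_cast
    ring
  rw [orb_neg, orb_neg, this, (dy_of_mem hh).map_one] at e
  have e2 : (2 : ℝ) ^ l = 2 ^ (-((n + 1) * K : ℕ) : ℤ) := by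
    have hp : (0 : ℝ) < (1 / 2) ^ ((n + 1) * i + 1) := by positivity
    apply mul_right_cancel₀ hp.ne'
    rw [zpow_neg, zpow_natCast, ← inv_pow, ← one_div, ← pow_add]
    rw [show (n + 1) * K + ((n + 1) * i + 1) = (n + 1) * (i + K) + 1 by ring]
    linarith
  have e3 := zpow_right_injective₀ (a := (2 : ℝ)) (by norm_num) (by norm_num) e2
  rw [e3, abs_neg, Nat.abs_cast] at hl
  exact_mod_cast hl

lemma jump_conj_eventually {n : ℕ} {h : Equiv.Perm ℝ} (hh : h ∈ ThompsonF) :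
    ∃ M : ℕ, ∀ i ≥ M, jump h (orb n i) = 0 := by
  obtain ⟨κ, _, ⟨ε, hε, hg⟩, -⟩ := exists_germ hh 0
  obtain ⟨M, hM⟩ := exists_half_pow_lt hε
  refine ⟨M, fun i hi => ?_⟩
  rw [orb_natCast]
  refine jump_eq_zero_of_affine (k := κ) (a := 0) (b := ε) (by positivity) (hM _ (by omega)) ?_
  intro t h0 h1
  have := (hg t h0 h1).1
  rwa [zero_add, (dy_of_mem hh).map_zero, zero_add] at this

lemma jump_conj_step {n m : ℕ} {h : Equiv.Perm ℝ} (hh : h ∈ ThompsonF)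
    (H : Conj (twisted n 0) (twisted n m) h) {k : ℤ} (hk : ∀ j, h (orb n j) = orb n (j + k))
    {i : ℕ} (hi : 1 ≤ i) (hik : 2 ≤ i + k) :
    jump h (orb n i) = jump h (orb n (i + 1 : ℕ)) + if i = m ∨ i = m + 1 then -(n : ℤ) else 0 := by
  have h1 := jump_mul (twisted_mem n 0) hh (orb n i)
  obtain ⟨j, hj⟩ := Int.eq_ofNat_of_zero_le (show 0 ≤ i + k by omega)
  rw [H.comm, jump_mul hh (twisted_mem n m), jump_twisted n m i hi, twisted_orb, hk, hj,
    jump_twisted n 0 j (by omega), if_neg (show ¬(j = 0 ∨ j = 0 + 1) by omega), zero_add] at h1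
  push_cast
  exact h1.symm

lemma jump_conj {n : ℕ} {h : Equiv.Perm ℝ} (hh : h ∈ ThompsonF)
    (H : Conj (twisted n 0) (twisted n n) h) {k : ℤ} (hk : ∀ j, h (orb n j) = orb n (j + k))
    {i : ℕ} (hi : 1 ≤ i) (hik : 2 ≤ i + k) (hin : i ≤ n) : jump h (orb n i) = -(2 * n) := by
  obtain ⟨M, hM⟩ := jump_conj_eventually (n := n) hh
  have far : ∀ d : ℕ, jump h (orb n (n + 2 : ℕ)) = jump h (orb n (n + 2 + d : ℕ)) := by
    intro d
    induction d with
    | zero => rfl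
    | succ d ih =>
      rw [ih, jump_conj_step hh H hk (by omega) (by push_cast; omega), if_neg (by omega), add_zero]
      rfl
  have h2 := (far M).trans (hM _ (by omega))
  have hn : jump h (orb n n) = -(2 * n) := by
    rw [jump_conj_step hh H hk (by omega) (by omega), if_pos (Or.inl rfl),
      jump_conj_step hh H hk (by omega) (by push_cast; omega), if_pos (Or.inr rfl), h2]
    ring
  have near : ∀ d : ℕ, i + d ≤ n → jump h (orb n i) = jump h (orb n (i + d : ℕ)) := by
    intro d
    induction d with
    | zero => intro _; rfl
    | succ d ih =>
      intro hd
      rw [ih (by omega), jump_conj_step hh H hk (by omega) (by push_cast; omega), if_neg (by omega),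
        add_zero]
      rfl
  rw [near (n - i) (by omega), show i + (n - i) = n by omega, hn]

lemma orb_injective (n : ℕ) : Function.Injective fun i : ℕ => orb n i := by
  intro i j h
  simp only [orb_natCast] at h
  have := (pow_right_injective₀ (by norm_num : (0 : ℝ) < 1 / 2) (by norm_num)) h
  omega

lemma le_wordLength_of_conj {n : ℕ} {h : Equiv.Perm ℝ} (hh : h ∈ ThompsonF)
    (H : Conj (twisted n 0) (twisted n n) h) : 2 * n * (n - 1) ≤ 10 * (wordLength h : ℤ) := by
  obtain ⟨k, hk⟩ := exists_conj_orb hh H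
  have key : ∀ a : ℕ, 1 ≤ a → 2 ≤ a + k → 2 * n * (n + 1 - a) ≤ 8 * (wordLength h : ℤ) := by
    intro a ha hak
    rcases le_or_gt a (n + 1) with han | han
    · have hs := sum_abs_jump_le hh ((Finset.Icc a n).map ⟨_, orb_injective n⟩)
      rw [Finset.sum_map, Finset.sum_congr rfl (g := fun _ => 2 * (n : ℤ))] at hs
      · rw [Finset.sum_const, Nat.card_Icc, nsmul_eq_mul, Nat.cast_sub han] at hs
        push_cast at hs
        linarith
      · intro i hi
        obtain ⟨h1, h2⟩ := Finset.mem_Icc.1 hi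
        simp only [Function.Embedding.coeFn_mk]
        rw [jump_conj hh H hk (by omega) (by omega) h2, abs_neg, abs_of_nonneg (by positivity)]
    · have : (n : ℤ) + 1 - a ≤ 0 := by omega
      nlinarith [Int.natCast_nonneg (wordLength h), Int.natCast_nonneg n]
  rcases le_or_gt 1 k with h1 | h1
  · have := key 1 le_rfl (by push_cast; omega)
    push_cast at this
    nlinarith [Int.natCast_nonneg (wordLength h), Int.natCast_nonneg n]
  · obtain ⟨K, hK⟩ := Int.eq_ofNat_of_zero_le (show 0 ≤ -k by omega)
    obtain rfl : k = -K := by omega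
    have a1 := key (2 + K) (by omega) (by push_cast; omega)
    have a2 : ((n : ℤ) + 1) * K ≤ wordLength h := by exact_mod_cast le_wordLength_of_neg hh hk
    push_cast at a1
    nlinarith [Int.natCast_nonneg K]

theorem le_conjDist_twisted (n : ℕ) :
    2 * n * (n - 1) ≤ 10 * (conjDist (twisted n 0) (twisted n n) : ℤ) := by
  obtain ⟨h₀, hh₀, e₀⟩ := exists_conj_twisted n n
  have hne : {l | ∃ h ∈ ThompsonF, h⁻¹ * twisted n 0 * h = twisted n n ∧ wordLength h = l}.Nonempty :=
    ⟨_, h₀, hh₀, e₀, rfl⟩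
  obtain ⟨h, hh, e, hl⟩ := Nat.sInf_mem hne
  rw [conjDist, ← hl]
  exact le_wordLength_of_conj hh (conj_of_mem (twisted_mem n 0) (twisted_mem n n) hh e)

theorem le_CLF (n : ℕ) : 2 * n * (n - 1) ≤ 10 * (CLF (20 * n + 2) : ℤ) := by
  have h1 := wordLength_twisted n 0
  have h2 := wordLength_twisted n n
  have h3 := conjDist_le_CLF (twisted_mem n 0) (twisted_mem n n) (exists_conj_twisted n n)
    (n := 20 * n + 2) (by omega)
  have h4 := le_conjDist_twisted n
  omega

lemma CLF_mono : Monotone CLF := by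
  intro m n hmn
  refine csSup_le' ?_
  rintro _ ⟨f, g, hf, hg, hc, hl, rfl⟩
  exact conjDist_le_CLF hf hg hc (hl.trans hmn)

end DyadicF

/-- The conjugator length function of Thompson's group `F` has quadratic growth. -/
theorem clf_quadratic_growth :
    ∃ a b : ℝ, 0 < a ∧ a < b ∧ ∃ N : ℕ, ∀ n : ℕ, N ≤ n →
      a * (n : ℝ) ^ 2 ≤ (CLF n : ℝ) ∧ (CLF n : ℝ) ≤ b * (n : ℝ) ^ 2 := by
  refine ⟨1 / 16000, 8000, by norm_num, by norm_num, 200, fun n hn => ⟨?_, ?_⟩⟩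
  · obtain ⟨q, h1, h2⟩ : ∃ q, 20 * q + 2 ≤ n ∧ n ≤ 40 * q := ⟨(n - 2) / 20, by omega, by omega⟩
    have h3 := DyadicF.le_CLF q
    have h4 := DyadicF.CLF_mono h1
    have h5 : 2 * (q : ℝ) * (q - 1) ≤ 10 * CLF (20 * q + 2) := by exact_mod_cast h3
    have h6 : (CLF (20 * q + 2) : ℝ) ≤ CLF n := by exact_mod_cast h4
    have h7 : (n : ℝ) ≤ 40 * q := by exact_mod_cast h2
    have h8 : (200 : ℝ) ≤ n := by exact_mod_cast hn
    nlinarith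
  · have h1 : (CLF n : ℝ) ≤ 2000 * (n + 1) ^ 2 := by exact_mod_cast DyadicF.CLF_le n
    have h8 : (200 : ℝ) ≤ n := by exact_mod_cast hn
    nlinarith

end
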